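/- arXiv:1610.09304 — 4 statements merged into one kernel-verified Lean document; each statement's English description precedes it below -/
import Mathlib

section
/- Let p be a prime and R = Z_p[x]/(px, x²), and let M = R/pR. Then M occurs as the cokernel of an R-linear endomorphism of R^N for some N ≥ 1 (indeed M = coker(p : R → R)), but M has infinite projective dimension as an R-module; in particular M admits no projective resolution of finite length, so M does not have projective dimension 1. -/
/- STATEMENT 13: Let p be a prime and R = ℤ_p[x]/(px, x²), and let M = R/pR.  Then M
   occurs as the cokernel of an R-linear endomorphism of R^N for some N ≥ 1, but M has
   infinite projective dimension as an R-module; in particular M admits no projective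
   resolution of finite length (so in particular M does not have projective dimension 1). -/

/-- `M` occurs as the cokernel of an `R`-linear endomorphism of `R^N` for some `N ≥ 1`. -/
def OccursAsCokernel (R M : Type) [CommRing R] [AddCommGroup M] [Module R M] : Prop :=
  ∃ N : ℕ, 0 < N ∧ ∃ G : (Fin N → R) →ₗ[R] (Fin N → R),
    Nonempty (((Fin N → R) ⧸ LinearMap.range G) ≃ₗ[R] M)

/-- `M` admits a projective resolution of length at most `n`, i.e. an exact complex
`0 → P_n → ⋯ → P_1 → P_0 → M → 0` with all `P_k` projective. -/
def HasProjectiveResolutionOfLength (R : Type) [CommRing R] (M : Type) [AddCommGroup M]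
    [Module R M] (n : ℕ) : Prop :=
  ∃ (P : ℕ → ModuleCat.{0} R) (d : ∀ k : ℕ, (P (k + 1) : Type) →ₗ[R] P k)
      (aug : (P 0 : Type) →ₗ[R] M),
    (∀ k, Module.Projective R (P k)) ∧
    Function.Surjective aug ∧
    LinearMap.range (d 0) = LinearMap.ker aug ∧
    (∀ k, LinearMap.range (d (k + 1)) = LinearMap.ker (d k)) ∧
    (∀ k, n < k → Subsingleton (P k))

/-- The ideal `(px, x²)` of `ℤ_p[x]`. -/
noncomputable def pxIdeal (p : ℕ) [Fact p.Prime] : Ideal (Polynomial ℤ_[p]) :=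
  Ideal.span {Polynomial.C (p : ℤ_[p]) * Polynomial.X, Polynomial.X ^ 2}

/-- `R = ℤ_p[x]/(px, x²)`. -/
noncomputable abbrev Rpx (p : ℕ) [Fact p.Prime] : Type :=
  Polynomial ℤ_[p] ⧸ pxIdeal p

open CategoryTheory

lemma pd_shift {R : Type} [CommRing R] {P M : Type} [AddCommGroup P] [Module R P]
    [AddCommGroup M] [Module R M] [Module.Projective R P] (f : P →ₗ[R] M)
    (hf : Function.Surjective f) (K : Submodule R P) (hK : K = LinearMap.ker f) (n : ℕ) :
    HasProjectiveDimensionLT (ModuleCat.of R M) (n + 2) ↔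
      HasProjectiveDimensionLT (ModuleCat.of R K) (n + 1) := by
  subst hK
  let S : ShortComplex (ModuleCat.{0} R) :=
    ShortComplex.mk (ModuleCat.ofHom (LinearMap.ker f).subtype) (ModuleCat.ofHom f)
      (by ext x; exact x.2)
  have hS : S.ShortExact :=
    { exact := by
        rw [ShortComplex.ShortExact.moduleCat_exact_iff_function_exact]
        exact LinearMap.exact_subtype_ker_map f
      mono_f := (ModuleCat.mono_iff_injective _).2 (Submodule.injective_subtype _)
      epi_g := (ModuleCat.epi_iff_surjective _).2 hf }
  have : Projective S.X₂ := (IsProjective.iff_projective P).1 inferInstance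
  exact hS.hasProjectiveDimensionLT_X₃_iff n this

lemma pd_of_res {R : Type} [CommRing R] {M : Type} [AddCommGroup M] [Module R M] {n : ℕ}
    (h : HasProjectiveResolutionOfLength R M n) :
    HasProjectiveDimensionLT (ModuleCat.of R M) (n + 2) := by
  obtain ⟨P, d, aug, hP, hs, h0, hd, hn⟩ := h
  have key : ∀ j k, n ≤ k + j →
      HasProjectiveDimensionLT (ModuleCat.of R (LinearMap.range (d k))) (j + 1) := by
    intro j
    induction j with
    | zero =>
      intro k hk
      have := hn (k + 1) (by omega)
      have hsub : Subsingleton (LinearMap.range (d k)) :=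
        (LinearMap.surjective_rangeRestrict (d k)).subsingleton
      have : Module.Projective R (LinearMap.range (d k)) := inferInstance
      have : Projective (ModuleCat.of R (LinearMap.range (d k))) :=
        (IsProjective.iff_projective _).1 this
      infer_instance
    | succ j ih =>
      intro k hk
      have := hP (k + 1)
      exact (pd_shift (d k).rangeRestrict (LinearMap.surjective_rangeRestrict (d k))
        (LinearMap.range (d (k + 1))) (by rw [hd, LinearMap.ker_rangeRestrict]) j).2
          (ih (k + 1) (by omega))
  have := hP 0
  exact (pd_shift aug hs _ h0 n).2 (key n 0 (by omega))

lemma abstract_inf {R : Type} [CommRing R] (p x : R) (hx : x ≠ 0) (hpx : p * x = 0)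
    (hxx : x * x = 0) (hp : ∀ a, p * a = 0 → a ∈ Ideal.span {x})
    (hm : ∀ a, x * a = 0 → a ∈ Ideal.span {p, x})
    (hi : ∀ a b, p * a = x * b → x * b = 0) (n : ℕ) :
    ¬ HasProjectiveDimensionLT (ModuleCat.of R (R ⧸ Ideal.span {p})) (n + 2) := by
  -- the surjections R → span {y}
  let π : ∀ y : R, R →ₗ[R] Ideal.span {y} := fun y =>
    (LinearMap.toSpanSingleton R R y).codRestrict (Ideal.span {y})
      (fun a => by
        rw [LinearMap.toSpanSingleton_apply, smul_eq_mul]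
        exact Ideal.mul_mem_left _ _ (Ideal.mem_span_singleton_self y))
  have hπv : ∀ y a, ((π y a : Ideal.span {y}) : R) = a * y := fun y a => rfl
  have hπ : ∀ y, Function.Surjective (π y) := by
    rintro y ⟨b, hb⟩
    obtain ⟨a, rfl⟩ := Ideal.mem_span_singleton'.1 hb
    exact ⟨a, rfl⟩
  have hπk : ∀ y a, a ∈ LinearMap.ker (π y) ↔ y * a = 0 := by
    intro y a
    rw [LinearMap.mem_ker, ← Subtype.coe_inj, hπv, mul_comm]; rfl
  have kp : Ideal.span {x} = LinearMap.ker (π p) := by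
    ext a
    rw [hπk]
    refine ⟨fun h => ?_, hp a⟩
    obtain ⟨b, rfl⟩ := Ideal.mem_span_singleton'.1 h
    linear_combination b * hpx
  have kx : Ideal.span {p, x} = LinearMap.ker (π x) := by
    ext a
    rw [hπk]
    refine ⟨fun h => ?_, hm a⟩
    obtain ⟨b, c, rfl⟩ := Ideal.mem_span_pair.1 h
    linear_combination b * hpx + c * hxx
  -- retraction
  let i : Ideal.span {x} →ₗ[R] Ideal.span {p, x} :=
    Submodule.inclusion (Ideal.span_mono (by simp))
  let i' : Ideal.span {p} →ₗ[R] Ideal.span {p, x} :=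
    Submodule.inclusion (Ideal.span_mono (by simp))
  have hbij : Function.Bijective (i'.coprod i) := by
    constructor
    · rw [← LinearMap.ker_eq_bot, LinearMap.ker_eq_bot']
      rintro ⟨⟨u, hu⟩, ⟨v, hv⟩⟩ h
      obtain ⟨a, rfl⟩ := Ideal.mem_span_singleton'.1 hu
      obtain ⟨b, rfl⟩ := Ideal.mem_span_singleton'.1 hv
      have h' : a * p + b * x = 0 := congrArg Subtype.val h
      have h1 := hi a (-b) (by linear_combination h')
      have h2 : b * x = 0 := by linear_combination -h1
      have h3 : a * p = 0 := by linear_combination h' - h2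
      ext
      · exact h3
      · exact h2
    · rintro ⟨u, hu⟩
      obtain ⟨b, c, rfl⟩ := Ideal.mem_span_pair.1 hu
      exact ⟨(π p b, π x c), rfl⟩
  let e := LinearEquiv.ofBijective _ hbij
  let r : Ideal.span {p, x} →ₗ[R] Ideal.span {x} := LinearMap.snd R _ _ ∘ₗ e.symm.toLinearMap
  have hr : ∀ v, r (i v) = v := by
    intro v
    have : e (0, v) = i v := by simp [e]
    simp [r, ← this]
  let ret : Retract (ModuleCat.of R (Ideal.span {x})) (ModuleCat.of R (Ideal.span {p, x})) :=
    { i := ModuleCat.ofHom i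
      r := ModuleCat.ofHom r
      retract := by ext v; exact congrArg Subtype.val (hr v) }
  have main : ∀ n, ¬ HasProjectiveDimensionLT (ModuleCat.of R (Ideal.span {x})) (n + 1) := by
    intro n
    induction n with
    | zero =>
      intro h
      have h1 : Projective (ModuleCat.of R (Ideal.span {x})) :=
        projective_iff_hasProjectiveDimensionLT_one.2 h
      have h2 : Module.Projective R (Ideal.span {x}) := (IsProjective.iff_projective _).2 h1
      obtain ⟨s, hs⟩ := Module.projective_lifting_property (π x) LinearMap.id (hπ x)
      have h3 : s (π x 1) * x = x := by
        have := congrArg Subtype.val (LinearMap.congr_fun hs (π x 1))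
        simpa [hπv] using this
      have h4 : x • π x 1 = 0 := by
        ext; simpa [hπv] using hxx
      have h5 : x * s (π x 1) = 0 := by
        rw [← smul_eq_mul, ← map_smul, h4, map_zero]
      exact hx (by rw [← h3, mul_comm, h5])
    | succ n ih =>
      intro h
      have h1 := (pd_shift (π x) (hπ x) _ kx n).1 h
      exact ih (ret.hasProjectiveDimensionLT _)
  intro h
  have h1 := (pd_shift (Submodule.mkQ (Ideal.span {p})) (Submodule.mkQ_surjective _) _
    (Submodule.ker_mkQ _).symm n).1 h
  have h2 : HasProjectiveDimensionLT (ModuleCat.of R (Ideal.span {p})) (n + 2) :=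
    hasProjectiveDimensionLT_of_ge _ (n + 1) _ (by omega)
  exact main n ((pd_shift (π p) (hπ p) _ kp n).1 h2)

open Polynomial in
lemma mem_pxIdeal (p : ℕ) [Fact p.Prime] (f : ℤ_[p][X]) :
    f ∈ pxIdeal p ↔ f.coeff 0 = 0 ∧ (p : ℤ_[p]) ∣ f.coeff 1 := by
  constructor
  · intro h
    obtain ⟨a, b, rfl⟩ := Ideal.mem_span_pair.1 h
    constructor
    · rw [coeff_zero_eq_eval_zero]; simp
    · have h1 : a * (C (p : ℤ_[p]) * X) + b * X ^ 2 = (C (p : ℤ_[p]) * a + b * X) * X := by ring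
      rw [h1, coeff_mul_X]
      simp
  · rintro ⟨h0, c, hc⟩
    have h1 := f.divX_mul_X_add
    have h2 := f.divX.divX_mul_X_add
    rw [coeff_divX, zero_add, hc] at h2
    rw [h0] at h1
    refine Ideal.mem_span_pair.2 ⟨C c, f.divX.divX, ?_⟩
    rw [C_mul] at h2
    rw [C_0] at h1
    linear_combination X * h2 + h1

theorem statement13 (p : ℕ) [Fact p.Prime] :
    OccursAsCokernel (Rpx p) (Rpx p ⧸ Ideal.span {(p : Rpx p)}) ∧
    ∀ n : ℕ, ¬ HasProjectiveResolutionOfLength (Rpx p)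
      (Rpx p ⧸ Ideal.span {(p : Rpx p)}) n := by
  constructor
  · refine ⟨1, one_pos, LinearMap.lsmul (Rpx p) (Fin 1 → Rpx p) (p : Rpx p), ⟨?_⟩⟩
    refine Submodule.Quotient.equiv _ _ (LinearEquiv.funUnique (Fin 1) (Rpx p) (Rpx p)) ?_
    ext a
    rw [Ideal.mem_span_singleton']
    constructor
    · rintro ⟨_, ⟨v, rfl⟩, rfl⟩
      exact ⟨v 0, mul_comm _ _⟩
    · rintro ⟨b, rfl⟩
      exact ⟨_, ⟨fun _ => b, rfl⟩, mul_comm (p : Rpx p) b⟩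
  · intro n h
    have hp0 : (p : ℤ_[p]) ≠ 0 := by exact_mod_cast (Fact.out : p.Prime).ne_zero
    have hpe : (p : Rpx p) = Ideal.Quotient.mk (pxIdeal p) (Polynomial.C (p : ℤ_[p])) := by simp
    refine abstract_inf (p : Rpx p) (Ideal.Quotient.mk (pxIdeal p) Polynomial.X)
      ?_ ?_ ?_ ?_ ?_ ?_ n (pd_of_res h) <;> try rw [hpe]
    · rw [Ne, Ideal.Quotient.eq_zero_iff_mem, mem_pxIdeal]
      rintro ⟨-, h⟩
      rw [Polynomial.coeff_X_one] at h
      exact PadicInt.prime_p.not_dvd_one h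
    · rw [← map_mul, Ideal.Quotient.eq_zero_iff_mem, mem_pxIdeal]
      simp
    · rw [← map_mul, Ideal.Quotient.eq_zero_iff_mem, mem_pxIdeal]
      simp [Polynomial.coeff_X]
    · intro a
      obtain ⟨f, rfl⟩ := Ideal.Quotient.mk_surjective a
      rw [← map_mul, Ideal.Quotient.eq_zero_iff_mem, mem_pxIdeal]
      rintro ⟨h, -⟩
      rw [Polynomial.coeff_C_mul, mul_eq_zero, or_iff_right hp0] at h
      obtain ⟨g, rfl⟩ := Polynomial.X_dvd_iff.2 h
      rw [map_mul]
      exact Ideal.mul_mem_right _ _ (Ideal.mem_span_singleton_self _)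
    · intro a
      obtain ⟨f, rfl⟩ := Ideal.Quotient.mk_surjective a
      rw [← map_mul, Ideal.Quotient.eq_zero_iff_mem, mem_pxIdeal]
      rintro ⟨-, h⟩
      rw [Polynomial.coeff_X_mul] at h
      obtain ⟨c, hc⟩ := h
      refine Ideal.mem_span_pair.2 ⟨Ideal.Quotient.mk _ (Polynomial.C c),
        Ideal.Quotient.mk _ f.divX, ?_⟩
      conv_rhs => rw [← f.divX_mul_X_add, hc, Polynomial.C_mul, map_add, map_mul, map_mul]
      ring
    · intro a b
      obtain ⟨f, rfl⟩ := Ideal.Quotient.mk_surjective a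
      obtain ⟨g, rfl⟩ := Ideal.Quotient.mk_surjective b
      rw [← map_mul, ← map_mul, Ideal.Quotient.eq, mem_pxIdeal, Ideal.Quotient.eq_zero_iff_mem,
        mem_pxIdeal]
      rintro ⟨-, h⟩
      rw [Polynomial.coeff_sub, Polynomial.coeff_C_mul] at h
      exact ⟨by simp, (dvd_sub_right (dvd_mul_right _ _)).1 h⟩
end

section
/- Let p be a prime and R = Z_p[x]/(px, x²). For every finite abelian p-group A, the sum of 1/#Aut_R(M), taken over isomorphism classes of finite R-modules M with d_M = 0 and M/xM ≅ A as abelian groups, is a finite sum and equals 1/#Aut_{Z_p}(A). -/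
/- STATEMENT 14: Let p be a prime and R = ℤ_p[x]/(px, x²).  For every finite abelian
   p-group A, the sum of 1/#Aut_R(M), taken over isomorphism classes of finite R-modules
   M with d_M = 0 and M/xM ≅ A as abelian groups, is a finite sum and equals
   1/#Aut_{ℤ_p}(A).

   Here d_M = dim_{F_R} Tor_1^R(M, F_R) − dim_{F_R}(M ⊗_R F_R), dimensions over the
   residue field F_R = F_p being expressed as base-|F_R| logarithms of cardinalities,
   and d_M = 0 means these two dimensions are equal.  The sum over isomorphism classes
   is expressed by a complete irredundant family of representatives of all finite
   R-modules.  (The hypothesis `IsLocalRing (Rpx p)` is a true fact about this ring.) -/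

open IsLocalRing CategoryTheory

/-- The number of `R`-module automorphisms of `M`. -/
noncomputable def numAut (R M : Type) [CommRing R] [AddCommGroup M] [Module R M] : ℕ :=
  Nat.card (M ≃ₗ[R] M)

/-- `Tor_1^R(M, N)` (as an object of `ModuleCat R`). -/
noncomputable def tor1 (R : Type) [CommRing R] (M : Type) [AddCommGroup M] [Module R M]
    (N : Type) [AddCommGroup N] [Module R N] : ModuleCat R :=
  ((Tor (ModuleCat R) 1).obj (ModuleCat.of R M)).obj (ModuleCat.of R N)

/-- The dimension over the residue field `F_R` of a finite module `X` which is an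
`F_R`-vector space: the base-`|F_R|` logarithm of its cardinality. -/
noncomputable def resDim (R : Type) [CommRing R] [IsLocalRing R] (X : Type) : ℕ :=
  Nat.log (Nat.card (ResidueField R)) (Nat.card X)

/-- `d_M = 0`, i.e. `dim_{F_R} Tor_1^R(M, F_R) = dim_{F_R}(M ⊗_R F_R)`. -/
def DZero (R : Type) [CommRing R] [IsLocalRing R] (M : Type) [AddCommGroup M]
    [Module R M] : Prop :=
  resDim R (tor1 R M (ResidueField R)) = resDim R (TensorProduct R M (ResidueField R))

/-- The class `x ∈ R = ℤ_p[x]/(px, x²)`. -/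
noncomputable def xElt (p : ℕ) [Fact p.Prime] : Rpx p :=
  Ideal.Quotient.mk (pxIdeal p) Polynomial.X

section TorPart
open CategoryTheory.Limits

lemma sq_aux {C : Type*} [Category C] {X Y : C} {f g : X ⟶ Y} (h : f = g) : 𝟙 X ≫ f = g ≫ 𝟙 Y := by
  rw [Category.id_comp, Category.comp_id, h]

variable {C : Type*} [Category C] [Abelian C] [EnoughProjectives C]

lemma syz_aux {X Y : C} (f : X ⟶ Y) : Projective.d f ≫ f = 0 := by
  have h : (Projective.π (kernel f) ≫ kernel.ι f) ≫ f = 0 := by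
    rw [Category.assoc, kernel.condition, comp_zero]
  exact h

noncomputable def resC {X₀ X₁ X₂ : C} (d₀ : X₁ ⟶ X₀) (d₁ : X₂ ⟶ X₁) (s : d₁ ≫ d₀ = 0) :
    ChainComplex C ℕ :=
  ChainComplex.mk X₀ X₁ X₂ d₀ d₁ s
    (fun S => ⟨Projective.syzygies S.f, Projective.d S.f, syz_aux S.f⟩)

lemma resC_d0 {X₀ X₁ X₂ : C} (d₀ : X₁ ⟶ X₀) (d₁ : X₂ ⟶ X₁) (s : d₁ ≫ d₀ = 0) :
    (resC d₀ d₁ s).d 1 0 = d₀ := ChainComplex.mk_d_1_0 _ _ _ _ _ _ _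

lemma resC_d1 {X₀ X₁ X₂ : C} (d₀ : X₁ ⟶ X₀) (d₁ : X₂ ⟶ X₁) (s : d₁ ≫ d₀ = 0) :
    (resC d₀ d₁ s).d 2 1 = d₁ := ChainComplex.mk_d_2_1 _ _ _ _ _ _ _

lemma resC_exact {X₀ X₁ X₂ : C} (d₀ : X₁ ⟶ X₀) (d₁ : X₂ ⟶ X₁) (s : d₁ ≫ d₀ = 0)
    (h : (ShortComplex.mk d₁ d₀ s).Exact) (n : ℕ) : (resC d₀ d₁ s).ExactAt (n + 1) := by
  rw [HomologicalComplex.exactAt_iff' _ (n + 1 + 1) (n + 1) n (by simp) (by simp)]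
  rcases n with _ | n
  · refine (ShortComplex.exact_iff_of_iso ?_).2 h
    exact ShortComplex.isoMk (Iso.refl _) (Iso.refl _) (Iso.refl _)
      (sq_aux (resC_d1 d₀ d₁ s).symm) (sq_aux (resC_d0 d₀ d₁ s).symm)
  · have e := ChainComplex.mk_d X₀ X₁ X₂ d₀ d₁ s
      (fun S => ⟨Projective.syzygies S.f, Projective.d S.f, syz_aux S.f⟩) n
    refine (ShortComplex.exact_iff_of_iso ?_).2 (exact_d_f ((resC d₀ d₁ s).d (n+2) (n+1)))
    exact ShortComplex.isoMk (ChainComplex.mkXIso X₀ X₁ X₂ d₀ d₁ s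
      (fun S => ⟨Projective.syzygies S.f, Projective.d S.f, syz_aux S.f⟩) n)
      (Iso.refl _) (Iso.refl _)
      (by
        refine Eq.trans ?_ (Eq.trans e.symm ?_)
        · rfl
        · exact (Category.comp_id _).symm) (sq_aux rfl)

lemma resC_proj {X₀ X₁ X₂ : C} (d₀ : X₁ ⟶ X₀) (d₁ : X₂ ⟶ X₁) (s : d₁ ≫ d₀ = 0)
    [Projective X₀] [Projective X₁] [Projective X₂] (n : ℕ) :
    Projective ((resC d₀ d₁ s).X n) := by
  obtain (_ | _ | _ | n) := n
  · assumption
  · assumption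
  · assumption
  · refine Projective.of_iso (ChainComplex.mkXIso X₀ X₁ X₂ d₀ d₁ s
      (fun S => ⟨Projective.syzygies S.f, Projective.d S.f, syz_aux S.f⟩) n).symm ?_
    apply Projective.projective_over

lemma resC_s {X₀ X₁ X₂ Z : C} (d₀ : X₁ ⟶ X₀) (d₁ : X₂ ⟶ X₁) (s : d₁ ≫ d₀ = 0)
    (π : X₀ ⟶ Z) (s' : d₀ ≫ π = 0) : (resC d₀ d₁ s).d 1 0 ≫ π = 0 := by
  rw [resC_d0]; exact s'

noncomputable def resP {X₀ X₁ X₂ Z : C} (d₀ : X₁ ⟶ X₀) (d₁ : X₂ ⟶ X₁) (s : d₁ ≫ d₀ = 0)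
    [Projective X₀] [Projective X₁] [Projective X₂]
    (h : (ShortComplex.mk d₁ d₀ s).Exact) (π : X₀ ⟶ Z) [Epi π] (s' : d₀ ≫ π = 0)
    (h' : (ShortComplex.mk d₀ π s').Exact) : ProjectiveResolution Z where
  complex := resC d₀ d₁ s
  projective := resC_proj d₀ d₁ s
  π := (ChainComplex.toSingle₀Equiv _ _).symm ⟨π, resC_s d₀ d₁ s π s'⟩
  quasiIso := ⟨fun n => by
    cases n
    · rw [ChainComplex.quasiIsoAt₀_iff, ShortComplex.quasiIso_iff_of_zeros']
      · refine (ShortComplex.exact_and_epi_g_iff_of_iso ?_).2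
          ⟨h', by dsimp; infer_instance⟩
        exact ShortComplex.isoMk (Iso.refl _) (Iso.refl _) (Iso.refl _)
          (sq_aux (resC_d0 d₀ d₁ s).symm) (sq_aux
            (ChainComplex.toSingle₀Equiv_symm_apply_f_zero (C := resC d₀ d₁ s) π
              (resC_s d₀ d₁ s π s')).symm)
      all_goals rfl
    · rw [quasiIsoAt_iff_exactAt']
      · apply resC_exact _ _ _ h
      · apply ChainComplex.exactAt_succ_single_obj⟩

end TorPart

lemma card_ker_mul_card_range {R M N : Type} [CommRing R] [AddCommGroup M] [Module R M]
    [AddCommGroup N] [Module R N] (f : M →ₗ[R] N) :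
    Nat.card (LinearMap.ker f) * Nat.card (LinearMap.range f) = Nat.card M := by
  rw [← Nat.card_congr f.quotKerEquivRange.toEquiv]
  exact ((LinearMap.ker f).card_eq_card_quotient_mul_card).symm

lemma tor1_equiv (R : Type) [CommRing R] (M N F₀ F₁ F₂ : Type) [AddCommGroup M] [Module R M]
    [AddCommGroup N] [Module R N] [AddCommGroup F₀] [Module R F₀] [AddCommGroup F₁] [Module R F₁]
    [AddCommGroup F₂] [Module R F₂] [Module.Projective R F₀] [Module.Projective R F₁]
    [Module.Projective R F₂] (d₁ : F₂ →ₗ[R] F₁) (d₀ : F₁ →ₗ[R] F₀) (π : F₀ →ₗ[R] N)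
    (h : Function.Exact d₁ d₀) (h' : Function.Exact d₀ π) (hπ : Function.Surjective π) :
    Nat.card (tor1 R M N) * Nat.card (LinearMap.range (d₁.lTensor M)) =
      Nat.card (LinearMap.ker (d₀.lTensor M)) := by
  have : Epi (ModuleCat.ofHom π) := (ModuleCat.epi_iff_surjective _).2 hπ
  have : Projective (ModuleCat.of R F₀) := (IsProjective.iff_projective _).1 inferInstance
  have : Projective (ModuleCat.of R F₁) := (IsProjective.iff_projective _).1 inferInstance
  have : Projective (ModuleCat.of R F₂) := (IsProjective.iff_projective _).1 inferInstance
  have s : ModuleCat.ofHom d₁ ≫ ModuleCat.ofHom d₀ = 0 := by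
    ext x; exact h.apply_apply_eq_zero x
  have s' : ModuleCat.ofHom d₀ ≫ ModuleCat.ofHom π = 0 := by
    ext x; exact h'.apply_apply_eq_zero x
  have e := (ShortComplex.ShortExact.moduleCat_exact_iff_function_exact (ShortComplex.mk _ _ s)).2 h
  have e' := (ShortComplex.ShortExact.moduleCat_exact_iff_function_exact
    (ShortComplex.mk _ _ s')).2 h'
  let P := resP _ _ s e (ModuleCat.ofHom π) s' e'
  let F := (MonoidalCategory.tensoringLeft (ModuleCat R)).obj (ModuleCat.of R M)
  have z : (d₀.lTensor M) ∘ₗ (d₁.lTensor M) = 0 := by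
    rw [← LinearMap.lTensor_comp, h.linearMap_comp_eq_zero, LinearMap.lTensor_zero]
  let S : ShortComplex (ModuleCat R) := ShortComplex.mk (ModuleCat.ofHom (d₁.lTensor M))
    (ModuleCat.ofHom (d₀.lTensor M)) (by
      rw [← ModuleCat.ofHom_comp, z]; rfl)
  let i1 : tor1 R M N ≅ _ := P.isoLeftDerivedObj F 1
  let i2 := HomologicalComplex.homologyIsoSc' ((F.mapHomologicalComplex _).obj P.complex) 2 1 0
    (by simp) (by simp)
  have e1 : P.complex.d 2 1 = ModuleCat.ofHom d₁ := resC_d1 _ _ s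
  have e0 : P.complex.d 1 0 = ModuleCat.ofHom d₀ := resC_d0 _ _ s
  let i3 : (((F.mapHomologicalComplex _).obj P.complex).sc' 2 1 0) ≅ S :=
    ShortComplex.isoMk (Iso.refl _) (Iso.refl _) (Iso.refl _)
      (sq_aux (congrArg F.map e1).symm) (sq_aux (congrArg F.map e0).symm)
  let i4 := i1 ≪≫ i2 ≪≫ ShortComplex.homologyMapIso i3 ≪≫ S.moduleCatHomologyIso
  have hle : LinearMap.range (d₁.lTensor M) ≤ LinearMap.ker (d₀.lTensor M) :=
    LinearMap.range_le_ker_iff.2 z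
  have e5 : S.moduleCatLeftHomologyData.H = ModuleCat.of R (LinearMap.ker (d₀.lTensor M) ⧸
     LinearMap.range ((d₁.lTensor M).codRestrict (LinearMap.ker (d₀.lTensor M))
      (fun x => hle ⟨x, rfl⟩))) := rfl
  rw [Nat.card_congr i4.toLinearEquiv.toEquiv, e5]
  rw [Submodule.card_eq_card_quotient_mul_card (LinearMap.range ((d₁.lTensor M).codRestrict
    (LinearMap.ker (d₀.lTensor M)) (fun x => hle ⟨x, rfl⟩))), mul_comm]
  refine congrArg (· * _) ?_
  rw [LinearMap.range_codRestrict]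
  exact (Nat.card_congr (Submodule.comapSubtypeEquivOfLe hle).toEquiv).symm

section RingPart
variable (p : ℕ) [Fact p.Prime]

lemma rpx_px : (p : Rpx p) * xElt p = 0 := by
  have : (p : Rpx p) * xElt p = Ideal.Quotient.mk (pxIdeal p)
      (Polynomial.C (p : ℤ_[p]) * Polynomial.X) := by
    simp [xElt]
  rw [this, Ideal.Quotient.eq_zero_iff_mem]
  exact Ideal.subset_span (by simp)

lemma rpx_xx : xElt p * xElt p = 0 := by
  have : xElt p * xElt p = Ideal.Quotient.mk (pxIdeal p) (Polynomial.X ^ 2) := by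
    simp [xElt, pow_two]
  rw [this, Ideal.Quotient.eq_zero_iff_mem]
  exact Ideal.subset_span (by simp)

/-- lifting maps out of `Rpx`. -/
noncomputable def rpxLift {S : Type} [CommRing S] (f : ℤ_[p] →+* S) (y : S)
    (h1 : (p : S) * y = 0) (h2 : y * y = 0) : Rpx p →+* S :=
  Ideal.Quotient.lift (pxIdeal p) (Polynomial.eval₂RingHom f y) (by
    intro a ha
    have : pxIdeal p ≤ RingHom.ker (Polynomial.eval₂RingHom f y) := by
      refine Ideal.span_le.2 ?_
      rintro a (rfl | rfl)
      · simp [RingHom.mem_ker, h1]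
      · simp [RingHom.mem_ker, pow_two, h2]
    exact this ha)

lemma rpxLift_x {S : Type} [CommRing S] (f : ℤ_[p] →+* S) (y : S)
    (h1 : (p : S) * y = 0) (h2 : y * y = 0) : rpxLift p f y h1 h2 (xElt p) = y := by
  exact (Ideal.Quotient.lift_mk (pxIdeal p) (Polynomial.eval₂RingHom f y) _).trans (by simp)

lemma rpxLift_alg {S : Type} [CommRing S] (f : ℤ_[p] →+* S) (y : S)
    (h1 : (p : S) * y = 0) (h2 : y * y = 0) (a : ℤ_[p]) :
    rpxLift p f y h1 h2 (algebraMap _ _ a) = f a := by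
  have : algebraMap ℤ_[p] (Rpx p) a = Ideal.Quotient.mk (pxIdeal p) (Polynomial.C a) := rfl
  rw [this]
  exact (Ideal.Quotient.lift_mk (pxIdeal p) (Polynomial.eval₂RingHom f y) _).trans (by simp)

noncomputable def rho : Rpx p →+* ℤ_[p] := rpxLift p (RingHom.id _) 0 (by simp) (by simp)

noncomputable def theta : Rpx p →+* DualNumber (ZMod p) :=
  rpxLift p ((TrivSqZeroExt.inlHom (ZMod p) (ZMod p)).comp PadicInt.toZMod) DualNumber.eps
    (by
      have : ((p : ℕ) : DualNumber (ZMod p)) = 0 := by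
        rw [← map_natCast (TrivSqZeroExt.inlHom (ZMod p) (ZMod p))]; simp
      rw [this, zero_mul]) (by simp)

lemma rho_x : rho p (xElt p) = 0 := rpxLift_x _ _ _ _ _
lemma rho_alg (a : ℤ_[p]) : rho p (algebraMap _ _ a) = a := rpxLift_alg _ _ _ _ _ _

lemma rpx_rep (r : Rpx p) : ∃ a c : ℤ_[p],
    r = algebraMap _ _ a + algebraMap _ _ c * xElt p := by
  obtain ⟨f, rfl⟩ := Ideal.Quotient.mk_surjective r
  refine ⟨f.coeff 0, f.divX.coeff 0, ?_⟩
  have e0 : ∀ g : Polynomial ℤ_[p], Ideal.Quotient.mk (pxIdeal p) g =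
      Ideal.Quotient.mk (pxIdeal p) g.divX * xElt p + algebraMap _ _ (g.coeff 0) := by
    intro g
    conv_lhs => rw [← Polynomial.divX_mul_X_add g]
    rw [map_add, map_mul]; rfl
  rw [e0 f, e0 f.divX, add_mul, mul_assoc, rpx_xx, mul_zero, zero_add, add_comm]

lemma rho_eq_zero {r : Rpx p} (h : rho p r = 0) : ∃ c, r = xElt p * c := by
  obtain ⟨a, c, rfl⟩ := rpx_rep p r
  rw [map_add, map_mul, rho_alg, rho_x, mul_zero, add_zero] at h
  exact ⟨algebraMap _ _ c, by rw [h, map_zero, zero_add, mul_comm]⟩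

lemma toZMod_zero {a : ℤ_[p]} (h : PadicInt.toZMod a = 0) : ∃ b, a = p * b := by
  have : a ∈ RingHom.ker (PadicInt.toZMod (p := p)) := h
  rw [PadicInt.ker_toZMod, PadicInt.maximalIdeal_eq_span_p, Ideal.mem_span_singleton] at this
  exact this

lemma alg_p : algebraMap ℤ_[p] (Rpx p) p = p := map_natCast _ _

lemma x_mul_eq_zero {r : Rpx p} : xElt p * r = 0 ↔ ∃ u v, r = p * u + xElt p * v := by
  constructor
  · intro h
    obtain ⟨a, c, rfl⟩ := rpx_rep p r
    have h1 : xElt p * algebraMap _ _ a = 0 := by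
      rw [mul_add, mul_comm (algebraMap _ _ c), ← mul_assoc, rpx_xx, zero_mul, add_zero] at h
      exact h
    have h2 := congrArg (fun z => (theta p z).snd) h1
    simp only [theta, map_mul, rpxLift_x, rpxLift_alg, map_zero] at h2
    simp at h2
    obtain ⟨b, rfl⟩ := toZMod_zero p h2
    exact ⟨algebraMap _ _ b, algebraMap _ _ c, by rw [map_mul, alg_p, mul_comm (xElt p)]⟩
  · rintro ⟨u, v, rfl⟩
    rw [mul_add, ← mul_assoc, ← mul_assoc, rpx_xx, mul_comm (xElt p), rpx_px]; simp

lemma rpx_syz {a b : Rpx p} (h : p * a + xElt p * b = 0) :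
    (∃ c, a = xElt p * c) ∧ ∃ u v, b = p * u + xElt p * v := by
  have h1 : ∃ c, a = xElt p * c := by
    apply rho_eq_zero
    have := congrArg (rho p) h
    rw [map_add, map_mul, map_mul, rho_x, zero_mul, add_zero, map_natCast, map_zero] at this
    exact (mul_eq_zero.1 this).resolve_left (by exact_mod_cast (Fact.out : p.Prime).ne_zero)
  refine ⟨h1, (x_mul_eq_zero p).1 ?_⟩
  obtain ⟨c, rfl⟩ := h1
  rwa [← mul_assoc, rpx_px, zero_mul, zero_add] at h

noncomputable def zmap : Rpx p →+* ZMod p := PadicInt.toZMod.comp (rho p)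

lemma zmap_zero {r : Rpx p} : zmap p r = 0 ↔ ∃ u v, r = p * u + xElt p * v := by
  constructor
  · intro h
    obtain ⟨a, c, rfl⟩ := rpx_rep p r
    have h : PadicInt.toZMod a = 0 := by
      rw [zmap, RingHom.comp_apply, map_add, map_mul, rho_alg, rho_x, mul_zero, add_zero] at h
      exact h
    obtain ⟨b, rfl⟩ := toZMod_zero p h
    exact ⟨algebraMap _ _ b, algebraMap _ _ c, by rw [map_mul, alg_p, mul_comm (xElt p)]⟩
  · rintro ⟨u, v, rfl⟩
    simp [zmap, rho_x]

lemma zmap_surj : Function.Surjective (zmap p) := ZMod.ringHom_surjective _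

variable [IsLocalRing (Rpx p)]

lemma ker_zmap : maximalIdeal (Rpx p) = RingHom.ker (zmap p) := by
  have : (RingHom.ker (zmap p)).IsMaximal := RingHom.ker_isMaximal_of_surjective _ (zmap_surj p)
  exact (IsLocalRing.eq_maximalIdeal this).symm

lemma card_res : Nat.card (ResidueField (Rpx p)) = p := by
  have e : ResidueField (Rpx p) ≃+* ZMod p :=
    (Ideal.quotEquivOfEq (ker_zmap p)).trans (RingHom.quotientKerEquivOfSurjective (zmap_surj p))
  rw [Nat.card_congr e.toEquiv, Nat.card_zmod]

lemma residue_zero {r : Rpx p} : residue (Rpx p) r = 0 ↔ ∃ u v, r = p * u + xElt p * v := by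
  rw [residue_eq_zero_iff, ker_zmap, RingHom.mem_ker, zmap_zero]

end RingPart

section ModPart

noncomputable def D0 {R : Type} [CommRing R] (a b : R) (M : Type) [AddCommGroup M] [Module R M] :
    M × M →ₗ[R] M := (LinearMap.lsmul R M a).coprod (LinearMap.lsmul R M b)

noncomputable def D1 {R : Type} [CommRing R] (a b : R) (M : Type) [AddCommGroup M] [Module R M] :
    M × (M × M) →ₗ[R] M × M := (LinearMap.lsmul R M b).prodMap (D0 a b M)

lemma D0_apply {R : Type} [CommRing R] (a b : R) (M : Type) [AddCommGroup M] [Module R M]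
    (z : M × M) : D0 a b M z = a • z.1 + b • z.2 := by simp [D0]

noncomputable def te1 (R : Type) [CommRing R] (M : Type) [AddCommGroup M] [Module R M] :
    TensorProduct R M (R × R) ≃ₗ[R] M × M :=
  TensorProduct.prodRight R R M R R ≪≫ₗ
    (TensorProduct.rid R M).prodCongr (TensorProduct.rid R M)

noncomputable def te2 (R : Type) [CommRing R] (M : Type) [AddCommGroup M] [Module R M] :
    TensorProduct R M (R × (R × R)) ≃ₗ[R] M × (M × M) :=
  TensorProduct.prodRight R R M R (R × R) ≪≫ₗ
    (TensorProduct.rid R M).prodCongr (te1 R M)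

lemma te_D0 {R : Type} [CommRing R] (a b : R) (M : Type) [AddCommGroup M] [Module R M] :
    (TensorProduct.rid R M).toLinearMap ∘ₗ (D0 a b R).lTensor M = D0 a b M ∘ₗ (te1 R M).toLinearMap := by
  apply TensorProduct.ext'
  intro m r
  simp [te1, D0_apply, add_smul, mul_smul]

lemma te_D1 {R : Type} [CommRing R] (a b : R) (M : Type) [AddCommGroup M] [Module R M] :
    (te1 R M).toLinearMap ∘ₗ (D1 a b R).lTensor M = D1 a b M ∘ₗ (te2 R M).toLinearMap := by
  apply TensorProduct.ext'
  intro m r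
  simp [te1, te2, D0_apply, D1, add_smul, mul_smul]
  exact smul_comm _ _ _

lemma card_range_conj {R : Type} [CommRing R] {A B C D : Type} [AddCommGroup A] [Module R A]
    [AddCommGroup B] [Module R B] [AddCommGroup C] [Module R C] [AddCommGroup D] [Module R D]
    (f : A →ₗ[R] B) (g : C →ₗ[R] D) (e : A ≃ₗ[R] C) (e' : B ≃ₗ[R] D)
    (h : e'.toLinearMap ∘ₗ f = g ∘ₗ e.toLinearMap) :
    Nat.card (LinearMap.range f) = Nat.card (LinearMap.range g) := by
  have h1 : LinearMap.range g = (LinearMap.range f).map e'.toLinearMap := by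
    rw [← LinearMap.range_comp, h, LinearMap.range_comp, LinearEquiv.range, LinearMap.range_eq_map]
  rw [h1]
  exact Nat.card_congr (e'.submoduleMap _).toEquiv

lemma card_prod_sub {R : Type} [CommRing R] {A B : Type} [AddCommGroup A] [Module R A]
    [AddCommGroup B] [Module R B] (S : Submodule R A) (T : Submodule R B) :
    Nat.card (S.prod T) = Nat.card S * Nat.card T := by
  rw [← Nat.card_prod]
  exact Nat.card_congr (Equiv.Set.prod (S : Set A) (T : Set B))

lemma card_D1 {R : Type} [CommRing R] (a b : R) (M : Type) [AddCommGroup M] [Module R M] :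
    Nat.card (LinearMap.range (D1 a b M)) =
      Nat.card (LinearMap.range (LinearMap.lsmul R M b)) * Nat.card (LinearMap.range (D0 a b M)) := by
  rw [D1, LinearMap.range_prodMap, card_prod_sub]

lemma smul_aux {R : Type} [CommRing R] {M : Type} [AddCommGroup M] [Module R M] {a b : R}
    (h : a * b = 0) (m : M) : a • b • m = 0 := by
  rw [smul_smul, h, zero_smul]

variable (p : ℕ) [Fact p.Prime]

lemma card_pow (M : Type) [AddCommGroup M] [Module (Rpx p) M] [Finite M] :
    ∃ e, Nat.card M = p ^ e := by
  refine ⟨_, Nat.eq_prime_pow_of_unique_prime_dvd Nat.card_pos.ne' ?_⟩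
  intro q hq hd
  by_contra hne
  have : Fact q.Prime := ⟨hq⟩
  obtain ⟨y, hy⟩ := exists_prime_addOrderOf_dvd_card' q hd
  have hy0 : (q : Rpx p) • y = 0 := by
    rw [Nat.cast_smul_eq_nsmul, ← hy]; exact addOrderOf_nsmul_eq_zero y
  have hu : IsUnit (q : ℤ_[p]) := by
    rw [PadicInt.isUnit_iff, PadicInt.norm_natCast_eq_one_iff]
    exact (Nat.coprime_primes Fact.out hq).2 (Ne.symm hne)
  have hu' : IsUnit (q : Rpx p) := by
    have := hu.map (algebraMap ℤ_[p] (Rpx p)); rwa [map_natCast] at this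
  have : y = 0 := (hu'.smul_eq_zero).1 hy0
  rw [this, addOrderOf_zero] at hy
  exact hq.one_lt.ne hy

lemma exact_D0 [IsLocalRing (Rpx p)] :
    Function.Exact (D0 (p : Rpx p) (xElt p) (Rpx p)) (Algebra.linearMap (Rpx p) (ResidueField (Rpx p))) := by
  intro r
  rw [Algebra.linearMap_apply, ResidueField.algebraMap_eq, residue_zero]
  constructor
  · rintro ⟨u, v, rfl⟩
    exact ⟨(u, v), by simp [D0_apply]⟩
  · rintro ⟨⟨u, v⟩, rfl⟩
    exact ⟨u, v, by simp [D0_apply]⟩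

lemma exact_D1 :
    Function.Exact (D1 (p : Rpx p) (xElt p) (Rpx p)) (D0 (p : Rpx p) (xElt p) (Rpx p)) := by
  rintro ⟨a, b⟩
  rw [D0_apply]
  constructor
  · intro h
    obtain ⟨⟨c, rfl⟩, u, v, rfl⟩ := rpx_syz p h
    exact ⟨(c, u, v), by simp [D1, D0_apply]⟩
  · rintro ⟨⟨c, u, v⟩, h⟩
    simp only [D1, LinearMap.prodMap_apply, D0_apply, LinearMap.lsmul_apply, smul_eq_mul,
      Prod.mk.injEq] at h
    obtain ⟨rfl, rfl⟩ := h
    simp only [smul_eq_mul]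
    linear_combination (c + v * 0 + u) * rpx_px p + v * rpx_xx p

/-- elementwise version of `d_M = 0`. -/
def Good (M : Type) [AddCommGroup M] [Module (Rpx p) M] : Prop :=
  ∀ m : M, xElt p • m = 0 → ∃ u v : M, m = (p : Rpx p) • u + xElt p • v

lemma x_p_smul {M : Type} [AddCommGroup M] [Module (Rpx p) M] (m : M) :
    xElt p • (p : Rpx p) • m = 0 := by
  exact smul_aux ((mul_comm _ _).trans (rpx_px p)) m

lemma x_x_smul {M : Type} [AddCommGroup M] [Module (Rpx p) M] (m : M) :
    xElt p • xElt p • m = 0 := by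
  exact smul_aux (rpx_xx p) m

lemma p_x_smul {M : Type} [AddCommGroup M] [Module (Rpx p) M] (m : M) :
    (p : Rpx p) • xElt p • m = 0 := by
  exact smul_aux (rpx_px p) m

lemma dzero_iff [IsLocalRing (Rpx p)] (M : Type) [AddCommGroup M] [Module (Rpx p) M] [Finite M] :
    DZero (Rpx p) M ↔ Good p M := by
  set D := D0 (p : Rpx p) (xElt p) M with hD
  set L := LinearMap.lsmul (Rpx p) M (xElt p) with hL
  have h1 := tor1_equiv (Rpx p) M (ResidueField (Rpx p)) (Rpx p) (Rpx p × Rpx p) (Rpx p × (Rpx p × Rpx p)) _ _ _ (exact_D1 p) (exact_D0 p)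
    residue_surjective
  have h2 := card_ker_mul_card_range ((D0 (p : Rpx p) (xElt p) (Rpx p)).lTensor M)
  have h3 := card_ker_mul_card_range
    ((Algebra.linearMap (Rpx p) (ResidueField (Rpx p))).lTensor M)
  have h4 : LinearMap.ker ((Algebra.linearMap (Rpx p) (ResidueField (Rpx p))).lTensor M) =
      LinearMap.range ((D0 (p : Rpx p) (xElt p) (Rpx p)).lTensor M) :=
    (lTensor_exact M (exact_D0 p) residue_surjective).linearMap_ker_eq
  have h5 : LinearMap.range ((Algebra.linearMap (Rpx p) (ResidueField (Rpx p))).lTensor M) = ⊤ :=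
    LinearMap.range_eq_top.2 (LinearMap.lTensor_surjective M residue_surjective)
  rw [h4, h5, Nat.card_congr Submodule.topEquiv.toEquiv,
    card_range_conj _ _ _ _ (te_D0 _ _ M), Nat.card_congr (TensorProduct.rid (Rpx p) M).toEquiv] at h3
  rw [card_range_conj _ _ _ _ (te_D0 _ _ M), Nat.card_congr (te1 (Rpx p) M).toEquiv, Nat.card_prod,
    ← h1, card_range_conj _ _ _ _ (te_D1 _ _ M), card_D1] at h2
  have h6 := card_ker_mul_card_range L
  have hle : LinearMap.range D ≤ LinearMap.ker L := by
    rintro _ ⟨z, rfl⟩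
    rw [LinearMap.mem_ker, hD, hL, D0_apply, LinearMap.lsmul_apply, smul_add, x_p_smul, x_x_smul,
      add_zero]
  rw [DZero, resDim, resDim, card_res]
  rw [← hD] at h2 h3
  rw [← hL] at h2
  have hb : 0 < Nat.card (LinearMap.range D) := Nat.card_pos
  have ha : 0 < Nat.card (LinearMap.range L) := Nat.card_pos
  have hn : 0 < Nat.card M := Nat.card_pos
  obtain ⟨e, he⟩ := card_pow p M
  have hgood : Good p M ↔ Nat.card (LinearMap.range D) = Nat.card (LinearMap.ker L) := by
    constructor
    · intro h
      have : LinearMap.range D = LinearMap.ker L := by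
        refine le_antisymm hle ?_
        intro m hm
        obtain ⟨u, v, rfl⟩ := h m hm
        exact ⟨(u, v), by rw [hD, D0_apply]⟩
      rw [this]
    · intro h m hm
      have : LinearMap.range D = LinearMap.ker L := by
        apply SetLike.coe_injective
        exact Set.eq_of_subset_of_ncard_le hle (le_of_eq h.symm) (Set.toFinite _)
      have hm : m ∈ LinearMap.range D := by rw [this]; exact hm
      obtain ⟨⟨u, v⟩, rfl⟩ := hm
      exact ⟨u, v, by rw [hD, D0_apply]⟩
  rw [hgood]
  generalize Nat.card (LinearMap.range D) = b at *
  generalize Nat.card (LinearMap.range L) = a at *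
  generalize Nat.card (LinearMap.ker L) = c at *
  generalize Nat.card (tor1 (Rpx p) M (ResidueField (Rpx p))) = t at *
  generalize Nat.card (TensorProduct (Rpx p) M (ResidueField (Rpx p))) = k at *
  generalize Nat.card M = n at *
  have hk : 0 < k := by
    rcases Nat.eq_zero_or_pos k with h | h
    · rw [h] at h3; omega
    · exact h
  have hta : t * a = k * k := by
    have : (b * b) * (t * a) = (b * b) * (k * k) := by
      rw [← h3] at h2; linarith
    exact Nat.eq_of_mul_eq_mul_left (by positivity) this
  obtain ⟨i, -, hi⟩ := (Nat.dvd_prime_pow Fact.out).1 (show k ∣ p ^ e from ⟨b, by rw [← he, ← h3, mul_comm]⟩)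
  obtain ⟨j, -, hj⟩ := (Nat.dvd_prime_pow Fact.out).1 (show t ∣ p ^ (i + i) from ⟨a, by rw [pow_add, ← hi, hta]⟩)
  rw [hi, hj, Nat.log_pow (Fact.out : p.Prime).one_lt, Nat.log_pow (Fact.out : p.Prime).one_lt]
  have hp := (Fact.out : p.Prime).pos
  constructor
  · rintro rfl
    have : t = k := hj.trans hi.symm
    subst this
    have : a = t := Nat.eq_of_mul_eq_mul_left hk hta
    subst this
    exact Nat.eq_of_mul_eq_mul_right ha (h3.trans h6.symm)
  · rintro rfl
    have hak : k = a := Nat.eq_of_mul_eq_mul_left hb (h3.trans h6.symm)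
    subst hak
    have : t = k := Nat.eq_of_mul_eq_mul_right ha hta
    rw [hi, hj] at this
    exact Nat.pow_right_injective (Fact.out : p.Prime).two_le this

end ModPart

section CorePart

/-- the submodule `xM`. -/
noncomputable abbrev xS {R : Type} [CommRing R] (x : R) (M : Type) [AddCommGroup M] [Module R M] :
    Submodule R M := LinearMap.range (LinearMap.lsmul R M x)

/-- abstract version of `Good`. -/
def GoodA {R : Type} [CommRing R] (P x : R) (M : Type) [AddCommGroup M] [Module R M] : Prop :=
  ∀ m : M, x • m = 0 → ∃ u v : M, m = P • u + x • v

/-- `K` is a complement of `xW` in `J`. -/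
def IsX {R : Type} [CommRing R] (x : R) {W : Type} [AddCommGroup W] [Module R W]
    (J K : Submodule R W) : Prop := K ⊓ xS x W = ⊥ ∧ K ⊔ xS x W = J

lemma mem_xS {R : Type} [CommRing R] {x : R} {M : Type} [AddCommGroup M] [Module R M] {m : M} :
    m ∈ xS x M ↔ ∃ m', x • m' = m := Iff.rfl

variable {R : Type} [CommRing R] {P x : R} {W : Type} [AddCommGroup W] [Module R W]
  {J : Submodule R W} {M : Type} [AddCommGroup M] [Module R M]

lemma core_good {K : Submodule R W} (hK : IsX x J K) (hW : GoodA P x W) : GoodA P x (W ⧸ K) := by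
  intro m hm
  obtain ⟨w, rfl⟩ := K.mkQ_surjective m
  rw [← map_smul, Submodule.mkQ_apply, Submodule.Quotient.mk_eq_zero] at hm
  have : x • w ∈ K ⊓ xS x W := ⟨hm, w, rfl⟩
  rw [hK.1, Submodule.mem_bot] at this
  obtain ⟨u, v, rfl⟩ := hW w this
  exact ⟨K.mkQ u, K.mkQ v, by simp⟩

lemma xS_map {s : W →ₗ[R] M} (hs : Function.Surjective s) : xS x M = (xS x W).map s := by
  ext m
  rw [Submodule.mem_map]
  constructor
  · rintro ⟨m', rfl⟩
    obtain ⟨w, rfl⟩ := hs m'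
    exact ⟨x • w, ⟨w, rfl⟩, by simp⟩
  · rintro ⟨_, ⟨w, rfl⟩, rfl⟩
    exact ⟨s w, by simp⟩

lemma core_quot {K : Submodule R W} (hK : IsX x J K) :
    Nonempty (((W ⧸ K) ⧸ xS x (W ⧸ K)) ≃ₗ[R] (W ⧸ J)) := by
  have h1 : K ≤ J := hK.2 ▸ le_sup_left
  have h2 : xS x (W ⧸ K) = J.map K.mkQ := by
    rw [xS_map K.mkQ_surjective, ← hK.2, Submodule.map_sup]
    simp
  exact ⟨(Submodule.quotEquivOfEq _ _ h2).trans (Submodule.quotientQuotientEquivQuotient K J h1)⟩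

lemma core_finite {K : Submodule R W} (hK : IsX x J K) [Finite (xS x W)] [Finite (W ⧸ J)] :
    Finite (W ⧸ K) := by
  obtain ⟨e⟩ := core_quot hK
  have : Finite ((W ⧸ K) ⧸ xS x (W ⧸ K)) := Finite.of_equiv _ e.symm.toEquiv
  have : Finite (xS x (W ⧸ K)) := by
    rw [xS_map K.mkQ_surjective]
    exact Set.Finite.image _ (Set.toFinite (xS x W : Set W))
  refine Nat.finite_of_card_ne_zero ?_
  rw [Submodule.card_eq_card_quotient_mul_card (xS x (W ⧸ K))]
  exact mul_ne_zero Nat.card_pos.ne' Nat.card_pos.ne'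

lemma core_surj (hxx : x * x = 0) (φ : (M ⧸ xS x M) ≃ₗ[R] (W ⧸ J)) (s : W →ₗ[R] M)
    (hs : φ.toLinearMap ∘ₗ (xS x M).mkQ ∘ₗ s = J.mkQ) : Function.Surjective s := by
  have key : ∀ m : M, ∃ w m', m = s w + x • m' := by
    intro m
    obtain ⟨w, hw⟩ := J.mkQ_surjective (φ ((xS x M).mkQ m))
    rw [← hs] at hw
    have h1 := φ.injective hw
    have h2 : m - s w ∈ xS x M := (Submodule.Quotient.eq _).1 h1.symm
    obtain ⟨m', hm'⟩ := h2
    exact ⟨w, m', by rw [LinearMap.lsmul_apply] at hm'; rw [hm']; abel⟩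
  intro m
  obtain ⟨w, m', rfl⟩ := key m
  obtain ⟨w', m'', rfl⟩ := key m'
  exact ⟨w + x • w', by simp [smul_smul, hxx]⟩

lemma core_isX (hxx : x * x = 0) (hpx : P * x = 0) (hJ1 : xS x W ≤ J) (hJ2 : ∀ w ∈ J, x • w = 0)
    (hM : GoodA P x M) (φ : (M ⧸ xS x M) ≃ₗ[R] (W ⧸ J)) (s : W →ₗ[R] M)
    (hs : φ.toLinearMap ∘ₗ (xS x M).mkQ ∘ₗ s = J.mkQ) : IsX x J (LinearMap.ker s) := by
  have hsurj := core_surj hxx φ s hs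
  have hker : LinearMap.ker s ≤ J := by
    intro w hw
    have := LinearMap.congr_fun hs w
    rw [LinearMap.comp_apply, LinearMap.comp_apply, LinearMap.mem_ker.1 hw, map_zero, map_zero] at this
    exact (Submodule.Quotient.mk_eq_zero _).1 this.symm
  refine ⟨?_, le_antisymm (sup_le hker hJ1) ?_⟩
  · rw [eq_bot_iff]
    rintro _ ⟨h1, w', rfl⟩
    change s (x • w') = 0 at h1
    change x • w' = 0
    rw [map_smul] at h1
    obtain ⟨u, v, huv⟩ := hM _ h1
    obtain ⟨u, rfl⟩ := hsurj u
    obtain ⟨v, rfl⟩ := hsurj v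
    have h2 : w' - (P • u + x • v) ∈ LinearMap.ker s := by
      rw [LinearMap.mem_ker, map_sub, huv]; simp
    have h3 := hJ2 _ (hker h2)
    rw [smul_sub, smul_add, smul_smul, smul_smul, hxx, mul_comm, hpx] at h3
    simpa using h3
  · intro w hw
    have h1 := LinearMap.congr_fun hs w
    have h2 : J.mkQ w = 0 := (Submodule.Quotient.mk_eq_zero _).2 hw
    rw [h2] at h1
    have h3 : (xS x M).mkQ (s w) = 0 := φ.injective (by rw [map_zero]; exact h1)
    obtain ⟨m', hm'⟩ := (Submodule.Quotient.mk_eq_zero _).1 h3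
    obtain ⟨w', rfl⟩ := hsurj m'
    rw [LinearMap.lsmul_apply] at hm'
    refine Submodule.mem_sup.2 ⟨w - x • w', ?_, x • w', ⟨w', rfl⟩, by abel⟩
    rw [LinearMap.mem_ker, map_sub, map_smul, hm', sub_self]

lemma core_card_xS {s : W →ₗ[R] M} (hs : Function.Surjective s)
    (hX : IsX x J (LinearMap.ker s)) : Nat.card (xS x M) = Nat.card (xS x W) := by
  rw [xS_map hs]
  refine (Nat.card_congr (Equiv.Set.imageOfInjOn s (xS x W : Set W) ?_)).symm
  intro a ha b hb hab
  have : a - b ∈ LinearMap.ker s ⊓ xS x W :=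
    ⟨by rw [SetLike.mem_coe, LinearMap.mem_ker, map_sub, hab, sub_self], Submodule.sub_mem _ ha hb⟩
  rw [hX.1, Submodule.mem_bot] at this
  exact sub_eq_zero.1 this

lemma core_phi {s : W →ₗ[R] M} (hs : Function.Surjective s)
    (hX : IsX x J (LinearMap.ker s)) :
    ∃ φ : (M ⧸ xS x M) ≃ₗ[R] (W ⧸ J), φ.toLinearMap ∘ₗ (xS x M).mkQ ∘ₗ s = J.mkQ := by
  have hker : LinearMap.ker s ≤ J := hX.2 ▸ le_sup_left
  have hJ1 : xS x W ≤ J := hX.2 ▸ le_sup_right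
  have h : J ≤ (xS x M).comap s := by
    rw [← hX.2, xS_map hs]
    refine sup_le ?_ (Submodule.le_comap_map _ _)
    intro w hw
    rw [Submodule.mem_comap, LinearMap.mem_ker.1 hw]; exact zero_mem _
  let f := J.mapQ (xS x M) s h
  have hf : Function.Bijective f := by
    constructor
    · rw [injective_iff_map_eq_zero]
      intro a ha
      obtain ⟨w, rfl⟩ := J.mkQ_surjective a
      have ha : s w ∈ xS x M := (Submodule.Quotient.mk_eq_zero _).1 ha
      obtain ⟨m', hm'⟩ := ha
      obtain ⟨w', rfl⟩ := hs m'
      rw [LinearMap.lsmul_apply] at hm'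
      have h1 : w - x • w' ∈ J := hker (by rw [LinearMap.mem_ker, map_sub, map_smul, hm', sub_self])
      have h2 : x • w' ∈ J := hJ1 ⟨w', rfl⟩
      refine (Submodule.Quotient.mk_eq_zero _).2 ?_
      simpa using J.add_mem h1 h2
    · intro b
      obtain ⟨m, rfl⟩ := (xS x M).mkQ_surjective b
      obtain ⟨w, rfl⟩ := hs m
      exact ⟨J.mkQ w, rfl⟩
  refine ⟨(LinearEquiv.ofBijective f hf).symm, ?_⟩
  ext w
  exact (LinearEquiv.symm_apply_eq _).2 rfl

lemma core_phi_unique {s : W →ₗ[R] M} (hs : Function.Surjective s)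
    {φ φ' : (M ⧸ xS x M) ≃ₗ[R] (W ⧸ J)}
    (h : φ.toLinearMap ∘ₗ (xS x M).mkQ ∘ₗ s = J.mkQ)
    (h' : φ'.toLinearMap ∘ₗ (xS x M).mkQ ∘ₗ s = J.mkQ) : φ = φ' := by
  ext a
  obtain ⟨m, rfl⟩ := (xS x M).mkQ_surjective a
  obtain ⟨w, rfl⟩ := hs m
  exact (LinearMap.congr_fun h w).trans (LinearMap.congr_fun h' w).symm

lemma core_lifts {r : ℕ} {Q : Type} [AddCommGroup Q] [Module R Q] (π : M →ₗ[R] Q)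
    (hπ : Function.Surjective π) (q : (Fin r → R) →ₗ[R] Q) :
    Nat.card {s : (Fin r → R) →ₗ[R] M // π ∘ₗ s = q} = Nat.card (LinearMap.ker π) ^ r := by
  obtain ⟨s0, hs0⟩ := Module.projective_lifting_property π q hπ
  have : Nat.card (LinearMap.ker π) ^ r = Nat.card (Fin r → LinearMap.ker π) := by
    rw [Nat.card_fun]; simp
  rw [this]
  refine Nat.card_congr ?_
  refine Equiv.trans (β := (Fin r → R) →ₗ[R] LinearMap.ker π) ?_
    ((Pi.basisFun R (Fin r)).constr R).toEquiv.symm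
  refine ⟨fun s => (s.1 - s0).codRestrict _ ?_, fun t => ⟨s0 + (LinearMap.ker π).subtype ∘ₗ t, ?_⟩,
    ?_, ?_⟩
  · intro w
    have h1 := LinearMap.congr_fun s.2 w
    have h2 := LinearMap.congr_fun hs0 w
    rw [LinearMap.comp_apply] at h1 h2
    rw [LinearMap.mem_ker, LinearMap.sub_apply, map_sub, h1, h2, sub_self]
  · rw [LinearMap.comp_add, hs0, ← LinearMap.comp_assoc, LinearMap.comp_ker_subtype]; simp
  · intro s
    ext : 2
    simp
  · intro t
    apply LinearMap.ext
    intro w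
    apply Subtype.ext
    simp

lemma core_cardS {r : ℕ} {J : Submodule R (Fin r → R)} (hxx : x * x = 0) (hpx : P * x = 0)
    (hJ1 : xS x (Fin r → R) ≤ J) (hJ2 : ∀ w ∈ J, x • w = 0) [Finite M]
    (hM : GoodA P x M) (hφ : Nonempty ((M ⧸ xS x M) ≃ₗ[R] ((Fin r → R) ⧸ J))) :
    Nat.card {s : (Fin r → R) →ₗ[R] M // Function.Surjective s ∧ IsX x J (LinearMap.ker s)} =
      Nat.card (((Fin r → R) ⧸ J) ≃ₗ[R] ((Fin r → R) ⧸ J)) * Nat.card (xS x (Fin r → R)) ^ r := by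
  obtain ⟨φ0⟩ := hφ
  have hfin0 : Finite (M ⧸ xS x M) := Finite.of_surjective _ (xS x M).mkQ_surjective
  have hfin : Finite ((Fin r → R) ⧸ J) := Finite.of_equiv _ φ0.toEquiv
  let T := Σ φ : (M ⧸ xS x M) ≃ₗ[R] ((Fin r → R) ⧸ J),
    {s : (Fin r → R) →ₗ[R] M // (φ.toLinearMap ∘ₗ (xS x M).mkQ) ∘ₗ s = J.mkQ}
  let F : T → {s : (Fin r → R) →ₗ[R] M // Function.Surjective s ∧ IsX x J (LinearMap.ker s)} :=
    fun t => ⟨t.2.1, core_surj hxx t.1 _ t.2.2, core_isX hxx hpx hJ1 hJ2 hM t.1 _ t.2.2⟩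
  have hF : Function.Bijective F := by
    constructor
    · rintro ⟨φ, s, hs⟩ ⟨φ', s', hs'⟩ h
      have h1 : s = s' := congrArg Subtype.val h
      subst h1
      have h2 : φ = φ' := core_phi_unique (core_surj hxx φ _ hs) hs hs'
      subst h2
      rfl
    · rintro ⟨s, hs, hX⟩
      obtain ⟨φ, hφ⟩ := core_phi hs hX
      exact ⟨⟨φ, s, hφ⟩, rfl⟩
  rw [← Nat.card_congr (Equiv.ofBijective F hF)]
  have hc : ∀ φ : (M ⧸ xS x M) ≃ₗ[R] ((Fin r → R) ⧸ J),
      Nat.card {s : (Fin r → R) →ₗ[R] M // (φ.toLinearMap ∘ₗ (xS x M).mkQ) ∘ₗ s = J.mkQ} =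
        Nat.card (xS x (Fin r → R)) ^ r := by
    intro φ
    have hsj : Function.Surjective (φ.toLinearMap ∘ₗ (xS x M).mkQ) :=
      φ.surjective.comp (xS x M).mkQ_surjective
    rw [core_lifts _ hsj]
    obtain ⟨s0, hs0⟩ := Module.projective_lifting_property _ J.mkQ hsj
    rw [← core_card_xS (core_surj hxx φ s0 hs0) (core_isX hxx hpx hJ1 hJ2 hM φ s0 hs0)]
    rw [LinearEquiv.ker_comp, Submodule.ker_mkQ]
  have : Finite ((M ⧸ xS x M) ≃ₗ[R] ((Fin r → R) ⧸ J)) :=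
    Finite.of_injective (fun φ => (φ : _ → _)) DFunLike.coe_injective
  have : Fintype ((M ⧸ xS x M) ≃ₗ[R] ((Fin r → R) ⧸ J)) := Fintype.ofFinite _
  have hMf : Finite ((Fin r → R) →ₗ[R] M) :=
    Finite.of_equiv _ ((Pi.basisFun R (Fin r)).constr R).toEquiv
  rw [Nat.card_sigma, Finset.sum_congr rfl (fun φ _ => hc φ), Finset.sum_const, smul_eq_mul,
    Finset.card_univ, ← Nat.card_eq_fintype_card]
  congr 1
  exact Nat.card_congr ⟨fun φ => φ0.symm.trans φ, fun ψ => φ0.trans ψ, fun φ => by ext; simp,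
    fun ψ => by ext; simp⟩

lemma core_fiber (K : Submodule R W) (e : (W ⧸ K) ≃ₗ[R] M) :
    Nat.card {s : W →ₗ[R] M // Function.Surjective s ∧ LinearMap.ker s = K} =
      Nat.card (M ≃ₗ[R] M) := by
  refine (Nat.card_congr (Equiv.ofBijective (fun g : M ≃ₗ[R] M =>
    (⟨(e.trans g).toLinearMap ∘ₗ K.mkQ, (e.trans g).surjective.comp K.mkQ_surjective, ?_⟩ :
    {s : W →ₗ[R] M // Function.Surjective s ∧ LinearMap.ker s = K})) ?_)).symm
  · rw [LinearEquiv.ker_comp, Submodule.ker_mkQ]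
  · constructor
    · intro g g' h
      ext m
      obtain ⟨a, rfl⟩ := e.surjective m
      obtain ⟨w, rfl⟩ := K.mkQ_surjective a
      exact LinearMap.congr_fun (congrArg Subtype.val h) w
    · rintro ⟨s, hs, rfl⟩
      refine ⟨e.symm.trans (s.quotKerEquivOfSurjective hs), ?_⟩
      apply Subtype.ext
      ext w
      simp

lemma core_main {r : ℕ} {J : Submodule R (Fin r → R)} (hxx : x * x = 0) (hpx : P * x = 0)
    (hJ1 : xS x (Fin r → R) ≤ J) (hJ2 : ∀ w ∈ J, x • w = 0) [Finite ((Fin r → R) ⧸ J)]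
    [Finite (xS x (Fin r → R))]
    (hX : Nat.card {K : Submodule R (Fin r → R) // IsX x J K} = Nat.card (xS x (Fin r → R)) ^ r)
    (κ : Type) (Mod : κ → ModuleCat.{0} R) (hfin : ∀ i, Finite (Mod i))
    (hgood : ∀ i, GoodA P x (Mod i))
    (hφ : ∀ i, Nonempty ((Mod i ⧸ xS x (Mod i)) ≃ₗ[R] ((Fin r → R) ⧸ J)))
    (hirr : ∀ i j, Nonempty ((Mod i : Type) ≃ₗ[R] Mod j) → i = j)
    (hcomp : ∀ K : Submodule R (Fin r → R), IsX x J K →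
      ∃ i, Nonempty (((Fin r → R) ⧸ K) ≃ₗ[R] Mod i)) :
    Finite κ ∧ HasSum (fun i => ((Nat.card (Mod i ≃ₗ[R] Mod i) : ℕ) : ℝ)⁻¹)
      ((Nat.card (((Fin r → R) ⧸ J) ≃ₗ[R] ((Fin r → R) ⧸ J)) : ℕ) : ℝ)⁻¹ := by
  classical
  have hxpos : 0 < Nat.card (xS x (Fin r → R)) ^ r := pow_pos Nat.card_pos _
  have hXfin : Finite {K : Submodule R (Fin r → R) // IsX x J K} :=
    Nat.finite_of_card_ne_zero (by rw [hX]; exact hxpos.ne')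
  have : Finite (((Fin r → R) ⧸ J) ≃ₗ[R] ((Fin r → R) ⧸ J)) :=
    Finite.of_injective (fun φ => (φ : _ → _)) DFunLike.coe_injective
  have hApos : 0 < Nat.card (((Fin r → R) ⧸ J) ≃ₗ[R] ((Fin r → R) ⧸ J)) := Nat.card_pos
  choose τ hτ using fun K : {K : Submodule R (Fin r → R) // IsX x J K} => hcomp K.1 K.2
  have hcount : ∀ i, Nat.card {K // τ K = i} * Nat.card (Mod i ≃ₗ[R] Mod i) =
      Nat.card (((Fin r → R) ⧸ J) ≃ₗ[R] ((Fin r → R) ⧸ J)) *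
        Nat.card (xS x (Fin r → R)) ^ r := by
    intro i
    have := hfin i
    have hMf : Finite ((Fin r → R) →ₗ[R] Mod i) :=
      Finite.of_equiv _ ((Pi.basisFun R (Fin r)).constr R).toEquiv
    rw [← core_cardS (M := Mod i) hxx hpx hJ1 hJ2 (hgood i) (hφ i)]
    let T := Σ K : {K // τ K = i}, {s : (Fin r → R) →ₗ[R] Mod i //
      Function.Surjective s ∧ LinearMap.ker s = K.1.1}
    let F : T → {s : (Fin r → R) →ₗ[R] Mod i //
        Function.Surjective s ∧ IsX x J (LinearMap.ker s)} :=
      fun t => ⟨t.2.1, t.2.2.1, by rw [t.2.2.2]; exact t.1.1.2⟩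
    have hF : Function.Bijective F := by
      constructor
      · rintro ⟨⟨⟨K, hK⟩, hi⟩, s, hs, hk⟩ ⟨⟨⟨K', hK'⟩, hi'⟩, s', hs', hk'⟩ h
        have h1 : s = s' := congrArg Subtype.val h
        subst h1
        change LinearMap.ker s = K at hk
        change LinearMap.ker s = K' at hk'
        subst hk
        subst hk'
        rfl
      · rintro ⟨s, hs, hsX⟩
        have hi : τ ⟨_, hsX⟩ = i := by
          apply hirr
          obtain ⟨e⟩ := hτ ⟨_, hsX⟩
          exact ⟨e.symm.trans (s.quotKerEquivOfSurjective hs)⟩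
        exact ⟨⟨⟨⟨_, hsX⟩, hi⟩, s, hs, rfl⟩, rfl⟩
    rw [← Nat.card_congr (Equiv.ofBijective F hF)]
    have : Fintype {K // τ K = i} := Fintype.ofFinite _
    have hc : ∀ K : {K // τ K = i}, Nat.card {s : (Fin r → R) →ₗ[R] Mod i //
      Function.Surjective s ∧ LinearMap.ker s = K.1.1} = Nat.card (Mod i ≃ₗ[R] Mod i) := by
      rintro ⟨K, rfl⟩
      obtain ⟨e⟩ := hτ K
      exact core_fiber _ e
    rw [Nat.card_sigma, Finset.sum_congr rfl (fun φ _ => hc φ), Finset.sum_const, smul_eq_mul,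
      Finset.card_univ, ← Nat.card_eq_fintype_card]
  have hsurj : Function.Surjective τ := by
    intro i
    have h : 0 < Nat.card {K // τ K = i} := by
      rcases Nat.eq_zero_or_pos (Nat.card {K // τ K = i}) with h | h
      · have := hcount i
        rw [h, zero_mul] at this
        have := Nat.mul_pos hApos hxpos
        omega
      · exact h
    obtain ⟨⟨K, hK⟩⟩ := (Nat.card_pos_iff.1 h).1
    exact ⟨K, hK⟩
  have hκ : Finite κ := Finite.of_surjective τ hsurj
  refine ⟨hκ, ?_⟩
  have : Fintype κ := Fintype.ofFinite _
  have hsum : ∑ i, Nat.card {K // τ K = i} = Nat.card (xS x (Fin r → R)) ^ r := by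
    rw [← hX, ← Nat.card_sigma]
    exact Nat.card_congr (Equiv.sigmaFiberEquiv τ)
  have hterm : ∀ i, ((Nat.card (Mod i ≃ₗ[R] Mod i) : ℕ) : ℝ)⁻¹ = (Nat.card {K // τ K = i} : ℝ) *
      ((Nat.card (((Fin r → R) ⧸ J) ≃ₗ[R] ((Fin r → R) ⧸ J)) : ℝ) *
        (Nat.card (xS x (Fin r → R)) : ℝ) ^ r)⁻¹ := by
    intro i
    have h := hcount i
    have h0 : 0 < Nat.card (Mod i ≃ₗ[R] Mod i) := by
      have := hfin i
      have : Finite (Mod i ≃ₗ[R] Mod i) :=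
        Finite.of_injective (fun φ => (φ : _ → _)) DFunLike.coe_injective
      exact Nat.card_pos
    have h' : (Nat.card {K // τ K = i} : ℝ) * (Nat.card (Mod i ≃ₗ[R] Mod i) : ℝ) =
      (Nat.card (((Fin r → R) ⧸ J) ≃ₗ[R] ((Fin r → R) ⧸ J)) : ℝ) *
        (Nat.card (xS x (Fin r → R)) : ℝ) ^ r := by exact_mod_cast h
    rw [← h']
    have h1 : (Nat.card {K // τ K = i} : ℝ) ≠ 0 := by
      intro hz
      rw [hz, zero_mul] at h'
      have : (0 : ℝ) < (Nat.card (((Fin r → R) ⧸ J) ≃ₗ[R] ((Fin r → R) ⧸ J)) : ℝ) *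
        (Nat.card (xS x (Fin r → R)) : ℝ) ^ r := by exact_mod_cast Nat.mul_pos hApos hxpos
      exact this.ne h'
    rw [mul_inv, ← mul_assoc, mul_inv_cancel₀ h1, one_mul]
  simp_rw [hterm]
  convert hasSum_fintype _ using 1
  rw [← Finset.sum_mul]
  have hsum' : ∑ i, (Nat.card {K // τ K = i} : ℝ) = (Nat.card (xS x (Fin r → R)) : ℝ) ^ r := by
    exact_mod_cast hsum
  rw [hsum', mul_inv, mul_comm, mul_assoc, inv_mul_cancel₀, mul_one]
  exact_mod_cast hxpos.ne'

end CorePart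

section FinalPart
variable (p : ℕ) [Fact p.Prime]

lemma struct_A (A : Type) [AddCommGroup A] [Finite A] (hA : ∃ k : ℕ, Nat.card A = p ^ k) :
    ∃ (r : ℕ) (a : Fin r → ℕ), (∀ i, 1 ≤ a i) ∧
      Nonempty (A ≃+ ((i : Fin r) → ZMod (p ^ a i))) := by
  classical
  obtain ⟨ι, hι, n, hn, ⟨e⟩⟩ := AddCommGroup.equiv_directSum_zmod_of_finite' A
  obtain ⟨k, hk⟩ := hA
  have e1 : A ≃+ ((i : ι) → ZMod (n i)) := e.trans (DirectSum.addEquivProd _)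
  have hcard : ∏ i, n i = p ^ k := by
    rw [← hk, Nat.card_congr e1.toEquiv, Nat.card_pi]
    simp
  have hpow : ∀ i, ∃ a, 1 ≤ a ∧ n i = p ^ a := by
    intro i
    obtain ⟨a, -, ha⟩ := (Nat.dvd_prime_pow Fact.out).1
      (hcard ▸ Finset.dvd_prod_of_mem n (Finset.mem_univ i))
    refine ⟨a, ?_, ha⟩
    rcases Nat.eq_zero_or_pos a with h | h
    · have := hn i
      rw [ha, h] at this
      simp at this
    · exact h
  choose a ha1 ha using hpow
  obtain rfl : n = fun i => p ^ a i := funext ha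
  refine ⟨Fintype.card ι, fun i => a ((Fintype.equivFin ι).symm i), fun i => ha1 _, ⟨e1.trans ?_⟩⟩
  exact
    { toFun := fun f i => f ((Fintype.equivFin ι).symm i)
      invFun := (Equiv.piCongrLeft (fun i => ZMod (p ^ a i)) (Fintype.equivFin ι).symm)
      left_inv := fun f => by
        apply (Equiv.piCongrLeft (fun i => ZMod (p ^ a i)) (Fintype.equivFin ι).symm).symm.injective
        rw [Equiv.symm_apply_apply]; rfl
      right_inv := fun f => by
        funext i
        exact Equiv.piCongrLeft_apply_apply (fun i => ZMod (p ^ a i)) _ f i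
      map_add' := fun f g => rfl }

variable {r : ℕ} (a : Fin r → ℕ)

/-- The additive map `W → ∏ ZMod (p ^ a i)`. -/
noncomputable def jMap : (Fin r → Rpx p) →+ ((i : Fin r) → ZMod (p ^ a i)) where
  toFun w i := PadicInt.toZModPow (a i) (rho p (w i))
  map_zero' := by ext i; simp
  map_add' u v := by ext i; simp

noncomputable def jS : Submodule (Rpx p) (Fin r → Rpx p) where
  carrier := {w | ∀ i, PadicInt.toZModPow (a i) (rho p (w i)) = 0}
  add_mem' := by
    intro u v hu hv i
    simp [hu i, hv i]
  zero_mem' := by intro i; simp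
  smul_mem' := by
    intro c u hu i
    simp [hu i]

lemma jS_rep {w : Fin r → Rpx p} (hw : w ∈ jS p a) (i : Fin r) :
    ∃ c d, w i = (p : Rpx p) ^ a i * c + xElt p * d := by
  have h : rho p (w i) ∈ RingHom.ker (PadicInt.toZModPow (p := p) (a i)) := hw i
  rw [PadicInt.ker_toZModPow, Ideal.mem_span_singleton] at h
  obtain ⟨b, hb⟩ := h
  have h0 : rho p (w i - (p : Rpx p) ^ a i * algebraMap _ _ b) = 0 := by
    rw [map_sub, map_mul, rho_alg, map_pow, map_natCast, hb, sub_self]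
  obtain ⟨d, hd⟩ := rho_eq_zero p h0
  exact ⟨algebraMap _ _ b, d, by rw [← hd]; ring⟩

lemma jS_mem {w : Fin r → Rpx p} (hw : ∀ i, ∃ c d, w i = (p : Rpx p) ^ a i * c + xElt p * d) :
    w ∈ jS p a := by
  intro i
  obtain ⟨c, d, h⟩ := hw i
  rw [h, map_add, map_mul, map_mul, rho_x, zero_mul, add_zero, map_pow, map_natCast, map_mul,
    map_pow, map_natCast]
  have : ((p : ZMod (p ^ a i))) ^ a i = 0 := by
    rw [← Nat.cast_pow]; exact ZMod.natCast_self _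
  rw [this, zero_mul]

lemma jMap_surj : Function.Surjective (jMap p a) := by
  intro f
  refine ⟨fun i => ((f i).val : Rpx p), ?_⟩
  ext i
  have : NeZero (p ^ a i) := ⟨pow_ne_zero _ (Fact.out : p.Prime).ne_zero⟩
  change PadicInt.toZModPow (a i) (rho p ((f i).val : Rpx p)) = f i
  rw [map_natCast, map_natCast, ZMod.natCast_zmod_val]

lemma jQuot : Nonempty (((Fin r → Rpx p) ⧸ jS p a) ≃+ ((i : Fin r) → ZMod (p ^ a i))) := by
  have h : (jS p a).toAddSubgroup = (jMap p a).ker := by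
    ext w
    rw [AddMonoidHom.mem_ker, funext_iff]
    rfl
  exact ⟨(QuotientAddGroup.quotientAddEquivOfEq h).trans
    (QuotientAddGroup.quotientKerEquivOfSurjective _ (jMap_surj p a))⟩

lemma jS_hJ1 : xS (xElt p) (Fin r → Rpx p) ≤ jS p a := by
  rintro _ ⟨w, rfl⟩
  exact jS_mem p a fun i => ⟨0, w i, by simp⟩

lemma jS_hJ2 (ha : ∀ i, 1 ≤ a i) : ∀ w ∈ jS p a, xElt p • w = 0 := by
  intro w hw
  ext i
  obtain ⟨c, d, h⟩ := jS_rep p a hw i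
  obtain ⟨b, hb⟩ := Nat.exists_eq_add_of_le' (ha i)
  rw [Pi.smul_apply, smul_eq_mul, Pi.zero_apply, x_mul_eq_zero]
  exact ⟨(p : Rpx p) ^ b * c, d, by rw [h, hb]; ring⟩

lemma good_W : GoodA (p : Rpx p) (xElt p) (Fin r → Rpx p) := by
  intro m hm
  have h : ∀ i, ∃ u v, m i = p * u + xElt p * v := fun i =>
    (x_mul_eq_zero p).1 (congrFun hm i)
  choose u v huv using h
  exact ⟨u, v, funext huv⟩

lemma finite_xW : Finite (xS (xElt p) (Fin r → Rpx p)) := by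
  have hp : NeZero p := ⟨(Fact.out : p.Prime).ne_zero⟩
  refine Finite.of_surjective (fun z : Fin r → ZMod p =>
    (⟨xElt p • fun i => ((z i).val : Rpx p), _, rfl⟩ : xS (xElt p) (Fin r → Rpx p))) ?_
  rintro ⟨_, w, rfl⟩
  refine ⟨fun i => zmap p (w i), Subtype.ext ?_⟩
  ext i
  change xElt p * _ = xElt p * _
  rw [← sub_eq_zero, ← mul_sub, x_mul_eq_zero, ← zmap_zero]
  simp

/-- generator map. -/
noncomputable def gen (u : Fin r → xS (xElt p) (Fin r → Rpx p)) :
    (Fin r → Rpx p) →ₗ[Rpx p] (Fin r → Rpx p) :=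
  (Pi.basisFun (Rpx p) (Fin r)).constr (Rpx p)
    (fun i => Pi.single i ((p : Rpx p) ^ a i) + (u i : Fin r → Rpx p))

lemma gen_apply (u : Fin r → xS (xElt p) (Fin r → Rpx p)) (c : Fin r → Rpx p) :
    gen p a u c = (fun i => (p : Rpx p) ^ a i * c i) +
      ∑ i, c i • (u i : Fin r → Rpx p) := by
  rw [gen, Module.Basis.constr_apply_fintype]
  simp only [smul_add, Finset.sum_add_distrib]
  congr 1
  ext i
  simp [Finset.sum_apply, Pi.single_apply, mul_comm]

lemma gen_single (u : Fin r → xS (xElt p) (Fin r → Rpx p)) (i : Fin r) :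
    gen p a u (Pi.single i 1) = Pi.single i ((p : Rpx p) ^ a i) + (u i : Fin r → Rpx p) := by
  have := (Pi.basisFun (Rpx p) (Fin r)).constr_basis (Rpx p)
    (fun i => Pi.single i ((p : Rpx p) ^ a i) + (u i : Fin r → Rpx p)) i
  rwa [Pi.basisFun_apply] at this

lemma single_mem (i : Fin r) : Pi.single i ((p : Rpx p) ^ a i) ∈ jS p a := by
  refine jS_mem p a fun j => ?_
  by_cases h : j = i
  · subst h
    exact ⟨1, 0, by simp⟩
  · exact ⟨0, 0, by simp [h]⟩

lemma sum_mem_xS (u : Fin r → xS (xElt p) (Fin r → Rpx p)) (c : Fin r → Rpx p) :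
    ∑ i, c i • (u i : Fin r → Rpx p) ∈ xS (xElt p) (Fin r → Rpx p) :=
  Submodule.sum_mem _ fun i _ => Submodule.smul_mem _ _ (u i).2

lemma rho_xS {w : Fin r → Rpx p} (hw : w ∈ xS (xElt p) (Fin r → Rpx p)) (i : Fin r) :
    rho p (w i) = 0 := by
  obtain ⟨v, rfl⟩ := hw
  simp [rho_x]

lemma gen_isX (ha : ∀ i, 1 ≤ a i) (u : Fin r → xS (xElt p) (Fin r → Rpx p)) :
    IsX (xElt p) (jS p a) (LinearMap.range (gen p a u)) := by
  have hle : LinearMap.range (gen p a u) ≤ jS p a := by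
    rintro _ ⟨c, rfl⟩
    rw [gen_apply]
    refine Submodule.add_mem _ (jS_mem p a fun i => ⟨c i, 0, by simp⟩)
      (jS_hJ1 p a (sum_mem_xS p u c))
  refine ⟨?_, le_antisymm (sup_le hle (jS_hJ1 p a)) ?_⟩
  · rw [eq_bot_iff]
    rintro _ ⟨⟨c, rfl⟩, h⟩
    have hc : ∀ i, ∃ d, c i = xElt p * d := by
      intro i
      apply rho_eq_zero
      have h1 := rho_xS p h i
      rw [gen_apply, Pi.add_apply, map_add, rho_xS p (sum_mem_xS p u c) i, add_zero, map_mul,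
        map_pow, map_natCast] at h1
      refine (mul_eq_zero.1 h1).resolve_left (pow_ne_zero _ ?_)
      exact_mod_cast (Fact.out : p.Prime).ne_zero
    choose d hd using hc
    have : c = xElt p • d := funext hd
    rw [Submodule.mem_bot, this, map_smul]
    exact jS_hJ2 p a ha _ (hle ⟨d, rfl⟩)
  · intro w hw
    choose c d hcd using jS_rep p a hw
    refine Submodule.mem_sup.2 ⟨gen p a u c, ⟨c, rfl⟩, xElt p • d -
      ∑ i, c i • (u i : Fin r → Rpx p), Submodule.sub_mem _ ⟨d, rfl⟩ (sum_mem_xS p u c), ?_⟩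
    rw [gen_apply]
    have : w = (fun i => (p : Rpx p) ^ a i * c i) + xElt p • d := funext hcd
    rw [this]; abel

lemma card_X (ha : ∀ i, 1 ≤ a i) :
    Nat.card {K : Submodule (Rpx p) (Fin r → Rpx p) // IsX (xElt p) (jS p a) K} =
      Nat.card (xS (xElt p) (Fin r → Rpx p)) ^ r := by
  have : Nat.card (xS (xElt p) (Fin r → Rpx p)) ^ r =
      Nat.card (Fin r → xS (xElt p) (Fin r → Rpx p)) := by
    rw [Nat.card_fun]; simp
  rw [this]
  refine (Nat.card_congr (Equiv.ofBijective (fun u =>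
    (⟨LinearMap.range (gen p a u), gen_isX p a ha u⟩ :
      {K : Submodule (Rpx p) (Fin r → Rpx p) // IsX (xElt p) (jS p a) K})) ⟨?_, ?_⟩)).symm
  · intro u u' h
    have h : LinearMap.range (gen p a u) = LinearMap.range (gen p a u') := congrArg Subtype.val h
    funext i
    apply Subtype.ext
    have h1 : gen p a u (Pi.single i 1) ∈ LinearMap.range (gen p a u) := ⟨_, rfl⟩
    have h2 : gen p a u' (Pi.single i 1) ∈ LinearMap.range (gen p a u) := h ▸ ⟨_, rfl⟩
    have h3 := Submodule.sub_mem _ h1 h2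
    rw [gen_single, gen_single, add_sub_add_left_eq_sub] at h3
    have h4 : (u i : Fin r → Rpx p) - u' i ∈
        LinearMap.range (gen p a u) ⊓ xS (xElt p) (Fin r → Rpx p) :=
      ⟨h3, Submodule.sub_mem _ (u i).2 (u' i).2⟩
    rw [(gen_isX p a ha u).1, Submodule.mem_bot] at h4
    exact sub_eq_zero.1 h4
  · rintro ⟨K, hK⟩
    have h : ∀ i, ∃ v : xS (xElt p) (Fin r → Rpx p),
        Pi.single i ((p : Rpx p) ^ a i) + (v : Fin r → Rpx p) ∈ K := by
      intro i
      have := single_mem p a i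
      rw [← hK.2] at this
      obtain ⟨k, hk, v, hv, hkv⟩ := Submodule.mem_sup.1 this
      refine ⟨⟨-v, Submodule.neg_mem _ hv⟩, ?_⟩
      rw [← hkv]
      simpa using hk
    choose u hu using h
    refine ⟨u, Subtype.ext ?_⟩
    have hle : LinearMap.range (gen p a u) ≤ K := by
      rintro _ ⟨c, rfl⟩
      rw [gen, Module.Basis.constr_apply_fintype]
      exact Submodule.sum_mem _ fun i _ => Submodule.smul_mem _ _ (hu i)
    exact eq_of_le_of_inf_le_of_sup_le hle
      (by rw [hK.1, (gen_isX p a ha u).1]) (by rw [hK.2, (gen_isX p a ha u).2])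

lemma add_lin {M N : Type} [AddCommGroup M] [Module (Rpx p) M] [AddCommGroup N] [Module (Rpx p) N]
    [Finite M] [Finite N] (hM : ∀ m : M, xElt p • m = 0) (hN : ∀ m : N, xElt p • m = 0)
    (f : M →+ N) (c : Rpx p) (m : M) : f (c • m) = c • f m := by
  obtain ⟨b, d, rfl⟩ := rpx_rep p c
  obtain ⟨e, he⟩ := card_pow p M
  obtain ⟨e', he'⟩ := card_pow p N
  have kM : ∀ m : M, (p : Rpx p) ^ (e + e') • m = 0 := by
    intro m
    rw [← Nat.cast_pow, Nat.cast_smul_eq_nsmul, pow_add, mul_comm, mul_smul, ← he]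
    rw [show Nat.card M • m = 0 from card_nsmul_eq_zero', smul_zero]
  have kN : ∀ m : N, (p : Rpx p) ^ (e + e') • m = 0 := by
    intro m
    rw [← Nat.cast_pow, Nat.cast_smul_eq_nsmul, pow_add, mul_smul, ← he']
    rw [show Nat.card N • m = 0 from card_nsmul_eq_zero', smul_zero]
  have hb := PadicInt.appr_spec (e + e') b
  rw [Ideal.mem_span_singleton] at hb
  obtain ⟨t, ht⟩ := hb
  have hb' : algebraMap ℤ_[p] (Rpx p) b = algebraMap _ _ t * (p : Rpx p) ^ (e + e') +
      ((PadicInt.appr b (e + e') : ℕ) : Rpx p) := by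
    conv_lhs => rw [eq_add_of_sub_eq ht]
    rw [map_add, map_mul, map_pow, map_natCast, map_natCast, mul_comm]
  rw [hb']
  simp only [add_smul, mul_smul, hM, hN, kM, kN, smul_zero, zero_add, add_zero,
    Nat.cast_smul_eq_nsmul, map_nsmul]

/-- additive equivalences are linear. -/
noncomputable def addLin {M N : Type} [AddCommGroup M] [Module (Rpx p) M] [AddCommGroup N]
    [Module (Rpx p) N] [Finite M] [Finite N] (hM : ∀ m : M, xElt p • m = 0)
    (hN : ∀ m : N, xElt p • m = 0) (f : M ≃+ N) : M ≃ₗ[Rpx p] N :=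
  f.toLinearEquiv (add_lin p hM hN f.toAddMonoidHom)

lemma addLin_apply {M N : Type} [AddCommGroup M] [Module (Rpx p) M] [AddCommGroup N]
    [Module (Rpx p) N] [Finite M] [Finite N] (hM : ∀ m : M, xElt p • m = 0)
    (hN : ∀ m : N, xElt p • m = 0) (f : M ≃+ N) (m : M) : addLin p hM hN f m = f m := rfl

lemma addLin_card {A : Type} [AddCommGroup A] {N : Type} [AddCommGroup N]
    [Module (Rpx p) N] [Finite N] (hN : ∀ m : N, xElt p • m = 0) (e : A ≃+ N) :
    Nat.card (A ≃+ A) = Nat.card (N ≃ₗ[Rpx p] N) := by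
  refine Nat.card_congr ⟨fun g => addLin p hN hN ((e.symm.trans g).trans e),
      fun g => (e.trans g.toAddEquiv).trans e.symm, fun g => ?_, fun g => ?_⟩
  · ext b
    simp [addLin_apply]
  · apply LinearEquiv.ext
    intro b
    simp [addLin_apply]

lemma mod_x (M : Type) [AddCommGroup M] [Module (Rpx p) M] (m : M ⧸ xS (xElt p) M) :
    xElt p • m = 0 := by
  obtain ⟨w, rfl⟩ := (xS (xElt p) M).mkQ_surjective m
  exact (Submodule.Quotient.mk_eq_zero _).2 ⟨w, rfl⟩

lemma mod_j (m : (Fin r → Rpx p) ⧸ jS p a) : xElt p • m = 0 := by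
  obtain ⟨w, rfl⟩ := (jS p a).mkQ_surjective m
  exact (Submodule.Quotient.mk_eq_zero _).2 (jS_hJ1 p a ⟨w, rfl⟩)

lemma good_equiv {M N : Type} [AddCommGroup M] [Module (Rpx p) M] [AddCommGroup N]
    [Module (Rpx p) N] (g : M ≃ₗ[Rpx p] N) (hM : GoodA (p : Rpx p) (xElt p) M) :
    GoodA (p : Rpx p) (xElt p) N := by
  intro m hm
  obtain ⟨u, v, huv⟩ := hM (g.symm m) (by rw [← map_smul, hm, map_zero])
  refine ⟨g u, g v, ?_⟩
  rw [← map_smul, ← map_smul, ← map_add, ← huv, g.apply_symm_apply]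

lemma quot_equiv {M N : Type} [AddCommGroup M] [Module (Rpx p) M] [AddCommGroup N]
    [Module (Rpx p) N] (g : M ≃ₗ[Rpx p] N) :
    Nonempty ((M ⧸ xS (xElt p) M) ≃ₗ[Rpx p] (N ⧸ xS (xElt p) N)) :=
  ⟨Submodule.Quotient.equiv _ _ g (xS_map (s := g.toLinearMap) g.surjective).symm⟩

lemma quot_lin {M : Type} [AddCommGroup M] [Module (Rpx p) M] [Finite M]
    {N : Type} [AddCommGroup N] [Module (Rpx p) N] [Finite N] (hN : ∀ m : N, xElt p • m = 0)
    (f : (M ⧸ xS (xElt p) M) ≃+ N) : Nonempty ((M ⧸ xS (xElt p) M) ≃ₗ[Rpx p] N) := by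
  have hfq : Finite (M ⧸ xS (xElt p) M) :=
    Finite.of_surjective _ (xS (xElt p) M).mkQ_surjective
  exact ⟨addLin p (mod_x p M) hN f⟩

end FinalPart


theorem statement14 (p : ℕ) [Fact p.Prime] [IsLocalRing (Rpx p)]
    -- `Mod : ι → ModuleCat (Rpx p)` is a complete irredundant family of representatives
    -- of the isomorphism classes of all finite `R`-modules:
    (ι : Type) (Mod : ι → ModuleCat.{0} (Rpx p))
    (hfin : ∀ i, Finite (Mod i))
    (hcomplete : ∀ (M : Type) [AddCommGroup M] [Module (Rpx p) M], Finite M →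
      ∃ i, Nonempty (M ≃ₗ[Rpx p] Mod i))
    (hirr : ∀ i j, Nonempty ((Mod i : Type) ≃ₗ[Rpx p] Mod j) → i = j)
    -- `A` is a finite abelian `p`-group:
    (A : Type) [AddCommGroup A] [Finite A] (hA : ∃ k : ℕ, Nat.card A = p ^ k) :
    Finite {i : ι // DZero (Rpx p) (Mod i) ∧
        Nonempty (((Mod i : Type) ⧸
          LinearMap.range (LinearMap.lsmul (Rpx p) (Mod i) (xElt p))) ≃+ A)} ∧
    HasSum
      (fun i : {i : ι // DZero (Rpx p) (Mod i) ∧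
          Nonempty (((Mod i : Type) ⧸
            LinearMap.range (LinearMap.lsmul (Rpx p) (Mod i) (xElt p))) ≃+ A)} =>
        ((numAut (Rpx p) (Mod i.1) : ℝ))⁻¹)
      ((Nat.card (A ≃+ A) : ℝ))⁻¹ := by
  obtain ⟨r, a, ha, ⟨eA⟩⟩ := struct_A p A hA
  obtain ⟨eJ⟩ := jQuot p a
  have e : A ≃+ ((Fin r → Rpx p) ⧸ jS p a) := eA.trans eJ.symm
  have hf1 : Finite ((Fin r → Rpx p) ⧸ jS p a) := Finite.of_equiv _ e.toEquiv
  have hf2 : Finite (xS (xElt p) (Fin r → Rpx p)) := finite_xW p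
  rw [addLin_card p (mod_j p a) e]
  have hG : ∀ i : {i : ι // DZero (Rpx p) (Mod i) ∧
        Nonempty (((Mod i : Type) ⧸
          LinearMap.range (LinearMap.lsmul (Rpx p) (Mod i) (xElt p))) ≃+ A)},
      GoodA (p : Rpx p) (xElt p) (Mod i.1) := by
    intro i
    have := hfin i.1
    exact (dzero_iff p (Mod i.1)).1 i.2.1
  have hQ : ∀ i : {i : ι // DZero (Rpx p) (Mod i) ∧
        Nonempty (((Mod i : Type) ⧸
          LinearMap.range (LinearMap.lsmul (Rpx p) (Mod i) (xElt p))) ≃+ A)},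
      Nonempty ((Mod i.1 ⧸ xS (xElt p) (Mod i.1)) ≃ₗ[Rpx p] ((Fin r → Rpx p) ⧸ jS p a)) := by
    intro i
    have := hfin i.1
    obtain ⟨f⟩ := i.2.2
    exact quot_lin p (mod_j p a) (f.trans e)
  have hC : ∀ K : Submodule (Rpx p) (Fin r → Rpx p), IsX (xElt p) (jS p a) K →
      ∃ i : {i : ι // DZero (Rpx p) (Mod i) ∧
        Nonempty (((Mod i : Type) ⧸
          LinearMap.range (LinearMap.lsmul (Rpx p) (Mod i) (xElt p))) ≃+ A)},
      Nonempty (((Fin r → Rpx p) ⧸ K) ≃ₗ[Rpx p] Mod i.1) := by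
    intro K hK
    have hfK := core_finite hK
    obtain ⟨i, ⟨g⟩⟩ := hcomplete _ hfK
    have := hfin i
    obtain ⟨q⟩ := core_quot hK
    have hg := good_equiv p g (core_good hK (good_W p))
    obtain ⟨hq⟩ := quot_equiv p g
    exact ⟨⟨i, (dzero_iff p (Mod i)).2 hg,
      ⟨(hq.symm.trans q).toAddEquiv.trans e.symm⟩⟩, ⟨g⟩⟩
  have hI : ∀ i j : {i : ι // DZero (Rpx p) (Mod i) ∧
        Nonempty (((Mod i : Type) ⧸
          LinearMap.range (LinearMap.lsmul (Rpx p) (Mod i) (xElt p))) ≃+ A)},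
      Nonempty ((Mod i.1 : Type) ≃ₗ[Rpx p] Mod j.1) → i = j :=
    fun i j h => Subtype.ext (hirr _ _ h)
  have h1 := jS_hJ1 p a
  have h2 := jS_hJ2 p a ha
  have h3 := card_X p a ha
  have h4 := rpx_xx p
  have h5 := rpx_px p
  have H := core_main (P := (p : Rpx p)) h4 h5 h1 h2 h3 _
    (fun i : {i : ι // DZero (Rpx p) (Mod i) ∧
        Nonempty (((Mod i : Type) ⧸
          LinearMap.range (LinearMap.lsmul (Rpx p) (Mod i) (xElt p))) ≃+ A)} => Mod i.1)
    (fun i => hfin _) hG hQ hI hC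
  exact H
end

section
/- There exists g_0 (depending on H, F_H and ω_H) such that for every g ≥ g_0, the number of pairs (T, F), where T : V → H is a surjective group homomorphism with (∧²T)(ω) = ω_H and F ∈ GSp^{(q)}(V, ω) satisfies T∘F = F_H∘T, equals #GSp^{(q)}(V, ω); equivalently, the average over F ∈ GSp^{(q)}(V, ω) of the number of surjections T : V → H with T∘F = F_H∘T and (∧²T)(ω) = ω_H is exactly 1. -/
/- STATEMENT 15: There exists g₀ (depending on H, F_H, ω_H) such that for every g ≥ g₀,
   the number of pairs (T, F), where T : V → H is a surjective group homomorphism with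
   (∧²T)(ω) = ω_H and F ∈ GSp^{(q)}(V, ω) satisfies T∘F = F_H∘T, equals
   #GSp^{(q)}(V, ω).

   Here V = (ℤ/ℓⁿℤ)^{2g} (realized as functions Fin g ⊕ Fin g → ZMod (ℓ^n)), with
   standard symplectic element ω = Σᵢ eᵢ ∧ fᵢ of ∧²V.  Since all groups in sight are
   killed by ℓⁿ, second exterior powers are taken over ℤ, and are realized inside the
   exterior algebra (∧²M is the degree-2 submodule `⋀[ℤ]^2 M` of `ExteriorAlgebra ℤ M`,
   with e ∧ f = ι(e) * ι(f), and ∧²T the restriction of the induced algebra map). -/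

open ExteriorAlgebra

/-- `V = (ℤ/ℓⁿℤ)^{2g}`. -/
abbrev Vsp (ℓ n g : ℕ) : Type := (Fin g ⊕ Fin g) → ZMod (ℓ ^ n)

/-- The standard symplectic element `ω = Σᵢ eᵢ ∧ fᵢ ∈ ∧² V`. -/
noncomputable def omegaStd (ℓ n g : ℕ) : ExteriorAlgebra ℤ (Vsp ℓ n g) :=
  ∑ i : Fin g,
    ι ℤ (Pi.single (Sum.inl i) (1 : ZMod (ℓ ^ n))) *
      ι ℤ (Pi.single (Sum.inr i) (1 : ZMod (ℓ ^ n)))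


section comb
variable {H : Type} [AddCommGroup H]

inductive Mv : Multiset (H × H) → Multiset (H × H) → Prop
  | refl (M) : Mv M M
  | symm {M N} : Mv M N → Mv N M
  | trans {M N P} : Mv M N → Mv N P → Mv M P
  | s1 (a b : H) (M) : Mv ((a, b) ::ₘ M) ((a, b + a) ::ₘ M)
  | s2 (a b : H) (M) : Mv ((a, b) ::ₘ M) ((b, -a) ::ₘ M)
  | s3 (a b c d : H) (M) : Mv ((a, b) ::ₘ (c, d) ::ₘ M) ((a + c, b) ::ₘ (c, d - b) ::ₘ M)

noncomputable def QM (M : Multiset (H × H)) : ExteriorAlgebra ℤ H :=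
  (M.map (fun p => ι ℤ p.1 * ι ℤ p.2)).sum

def FullM (M : Multiset (H × H)) : Prop :=
  ∀ G : AddSubgroup H, (∀ p ∈ M, p.1 ∈ G ∧ p.2 ∈ G) → G = ⊤

theorem Mv.card {M N : Multiset (H × H)} (h : Mv M N) : M.card = N.card := by
  induction h <;> simp_all

theorem Mv.q {M N : Multiset (H × H)} (h : Mv M N) : QM M = QM N := by
  induction h with
  | refl => rfl
  | symm _ ih => exact ih.symm
  | trans _ _ h1 h2 => exact h1.trans h2
  | s1 a b M => simp [QM, mul_add]
  | s2 a b M =>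
    have h : ι ℤ a * ι ℤ b + ι ℤ b * ι ℤ a = 0 := ι_add_mul_swap a b
    simp [QM, eq_neg_of_add_eq_zero_left h]
  | s3 a b c d M =>
    simp [QM, mul_sub, add_mul]; abel

theorem Mv.mem {M N : Multiset (H × H)} (h : Mv M N) (G : AddSubgroup H) :
    (∀ p ∈ M, p.1 ∈ G ∧ p.2 ∈ G) ↔ (∀ p ∈ N, p.1 ∈ G ∧ p.2 ∈ G) := by
  induction h with
  | refl => rfl
  | symm _ ih => exact ih.symm
  | trans _ _ h1 h2 => exact h1.trans h2
  | s1 a b M =>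
    simp only [Multiset.forall_mem_cons]
    constructor
    · rintro ⟨⟨h1, h2⟩, h3⟩; exact ⟨⟨h1, G.add_mem h2 h1⟩, h3⟩
    · rintro ⟨⟨h1, h2⟩, h3⟩; exact ⟨⟨h1, (G.add_mem_cancel_right h1).1 h2⟩, h3⟩
  | s2 a b M =>
    simp only [Multiset.forall_mem_cons, neg_mem_iff]; tauto
  | s3 a b c d M =>
    simp only [Multiset.forall_mem_cons]
    constructor
    · rintro ⟨⟨h1, h2⟩, ⟨h3, h4⟩, h5⟩; exact ⟨⟨G.add_mem h1 h3, h2⟩, ⟨h3, G.sub_mem h4 h2⟩, h5⟩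
    · rintro ⟨⟨h1, h2⟩, ⟨h3, h4⟩, h5⟩
      refine ⟨⟨(G.add_mem_cancel_right h3).1 h1, h2⟩, ⟨h3, ?_⟩, h5⟩
      have := G.add_mem h4 h2
      simpa using this

theorem Mv.full {M N : Multiset (H × H)} (h : Mv M N) (hM : FullM M) : FullM N :=
  fun G hG => hM G ((h.mem G).2 hG)

theorem Mv.addR {M N : Multiset (H × H)} (h : Mv M N) (P : Multiset (H × H)) :
    Mv (M + P) (N + P) := by
  induction h with
  | refl => exact .refl _
  | symm _ ih => exact ih.symm
  | trans _ _ h1 h2 => exact h1.trans h2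
  | s1 a b M => simpa using Mv.s1 a b (M + P)
  | s2 a b M => simpa using Mv.s2 a b (M + P)
  | s3 a b c d M => simpa using Mv.s3 a b c d (M + P)

theorem Mv.addL {M N : Multiset (H × H)} (h : Mv M N) (P : Multiset (H × H)) :
    Mv (P + M) (P + N) := by
  rw [add_comm P, add_comm P]; exact h.addR P

theorem Mv.consL {M N : Multiset (H × H)} (h : Mv M N) (p : H × H) :
    Mv (p ::ₘ M) (p ::ₘ N) := by
  simpa using h.addL {p}

/-- with a full remainder, `(x,0)` may be changed to `(y,0)` -/
theorem Mv.fillAux (M : Multiset (H × H)) (hM : FullM M) (y : H) :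
    ∀ x, Mv ((x, 0) ::ₘ M) ((x + y, 0) ::ₘ M) := by
  let G : AddSubgroup H :=
    { carrier := {y | ∀ x, Mv ((x, 0) ::ₘ M) ((x + y, 0) ::ₘ M)}
      zero_mem' := by intro x; simpa using Mv.refl _
      add_mem' := by
        intro a b ha hb x
        rw [← add_assoc]; exact (ha x).trans (hb _)
      neg_mem' := by
        intro a ha x
        have := ha (x + -a)
        simpa using this.symm }
  have hG : G = ⊤ := by
    apply hM
    rintro ⟨c, d⟩ hp
    obtain ⟨M', rfl⟩ := Multiset.exists_cons_of_mem hp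
    have key : ∀ (c d x : H), Mv ((x, 0) ::ₘ (c, d) ::ₘ M') ((x + c, 0) ::ₘ (c, d) ::ₘ M') := by
      intro c d x
      simpa using Mv.s3 x 0 c d M'
    refine ⟨fun x => key c d x, fun x => ?_⟩
    have h2 := Mv.s2 c d M'
    exact ((h2.consL _).trans (key d (-c) x)).trans (h2.symm.consL _)
  have : y ∈ G := by rw [hG]; trivial
  exact this

theorem Mv.fill {M : Multiset (H × H)} (hM : FullM M) (x y : H) :
    Mv ((x, 0) ::ₘ M) ((y, 0) ::ₘ M) := by
  simpa using Mv.fillAux M hM (y - x) x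

theorem FullM.mono {M N : Multiset (H × H)} (hM : FullM M) (h : M ≤ N) : FullM N :=
  fun G hG => hM G (fun p hp => hG p (Multiset.mem_of_le h hp))

theorem FullM.of_zero {M : Multiset (H × H)} (k : ℕ)
    (h : FullM (Multiset.replicate k (0, 0) + M)) : FullM M := by
  intro G hG
  apply h
  intro p hp
  rcases Multiset.mem_add.1 hp with h | h
  · rw [Multiset.eq_of_mem_replicate h]; exact ⟨G.zero_mem, G.zero_mem⟩
  · exact hG p h

theorem Mv.fills {M : Multiset (H × H)} (hM : FullM M) (L : Multiset H) :
    Mv (Multiset.replicate L.card (0, 0) + M) (L.map (fun h => (h, 0)) + M) := by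
  induction L using Multiset.induction_on with
  | empty => simpa using Mv.refl _
  | cons a L ih =>
    simp only [Multiset.card_cons, Multiset.replicate_succ, Multiset.map_cons, Multiset.cons_add]
    refine (ih.consL _).trans (Mv.fill (hM.mono (Multiset.le_add_left _ _)) 0 a)

variable [Fintype H] [DecidableEq H]

def UM (x : H → H) : Multiset (H × H) := (Finset.univ : Finset H).val.map (fun h => (h, x h))

theorem UM_full (x : H → H) : FullM (UM x) := by
  intro G hG
  rw [eq_top_iff]
  intro h _
  exact (hG (h, x h) (Multiset.mem_map.2 ⟨h, by simp, rfl⟩)).1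

theorem UM_split (a : H) : ∃ R : (H → H) → Multiset (H × H),
    (∀ x, UM x = (a, x a) ::ₘ R x) ∧ ∀ x y, R (x + Pi.single a y) = R x := by
  refine ⟨fun x => ((Finset.univ : Finset H).erase a).val.map (fun h => (h, x h)), ?_, ?_⟩
  · intro x
    have : (Finset.univ : Finset H).val = a ::ₘ ((Finset.univ : Finset H).erase a).val := by
      rw [Finset.erase_val, Multiset.cons_erase]; simp
    rw [UM, this, Multiset.map_cons]
  · intro x y
    apply Multiset.map_congr rfl
    intro h hh
    have : h ≠ a := by
      have : h ∈ (Finset.univ : Finset H).erase a := hh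
      exact (Finset.mem_erase.1 this).1
    simp [this]

theorem UM_single (a y : H) (x : H → H) : ∃ R, UM x = (a, x a) ::ₘ R ∧
    UM (x + Pi.single a y) = (a, x a + y) ::ₘ R := by
  obtain ⟨R, h1, h2⟩ := UM_split a
  exact ⟨R x, h1 x, by rw [h1, h2]; simp⟩

theorem Mv.d2' (x : H → H) (h h' y : H) (Z : Multiset (H × H)) :
    Mv ((h + h', y) ::ₘ (UM x + Z)) ((h, y) ::ₘ (UM (x + Pi.single h' y) + Z)) := by
  obtain ⟨R, h1, h2⟩ := UM_single h' y x
  rw [h1, h2]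
  have := Mv.s3 h y h' (x h' + y) (R + Z)
  simpa using this.symm

theorem Mv.d2 (x : H → H) (a y : H) (Z : Multiset (H × H)) :
    Mv ((a, y) ::ₘ (UM x + Z)) ((0, 0) ::ₘ (UM (x + Pi.single a y) + Z)) := by
  have h1 := Mv.d2' x 0 a y Z
  rw [zero_add] at h1
  have h2 := Mv.s2 0 y (UM (x + Pi.single a y) + Z)
  rw [neg_zero] at h2
  exact (h1.trans h2).trans (Mv.fill ((UM_full _).mono (Multiset.le_add_right _ _)) _ _)

def NS (H : Type) [AddCommGroup H] [DecidableEq H] : AddSubgroup (H → H) :=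
  AddSubgroup.closure ({r | ∃ h, r = Pi.single h h} ∪
    {r | ∃ h h' y, r = Pi.single h y + Pi.single h' y - Pi.single (h + h') y})

theorem Mv.d3 (Z : Multiset (H × H)) (r : H → H) (hr : r ∈ NS H) :
    ∀ x, Mv ((0, 0) ::ₘ (UM x + Z)) ((0, 0) ::ₘ (UM (x + r) + Z)) := by
  induction hr using AddSubgroup.closure_induction with
  | mem r hr =>
    intro x
    rcases hr with ⟨h, rfl⟩ | ⟨h, h', y, rfl⟩
    · obtain ⟨R, h1, h2⟩ := UM_single h h x
      rw [h1, h2]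
      have := Mv.s1 h (x h) (R + Z)
      simpa using this.consL (0, 0)
    · have e : x = (x - Pi.single (h + h') y) + Pi.single (h + h') y := by simp
      set x' := x - Pi.single (h + h') y
      have e2 : x + (Pi.single h y + Pi.single h' y - Pi.single (h + h') y) =
        x' + Pi.single h' y + Pi.single h y := by rw [e]; abel
      rw [e2, e]
      exact (Mv.d2 x' (h + h') y Z).symm.trans ((Mv.d2' x' h h' y Z).trans (Mv.d2 _ h y Z))
  | zero => intro x; simpa using Mv.refl _
  | add a b _ _ ha hb => intro x; rw [← add_assoc]; exact (ha x).trans (hb _)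
  | neg a _ ha => intro x; simpa using (ha (x + -a)).symm

theorem Mv.absorb (M : Multiset (H × H)) : ∀ x : H → H, ∃ x', 
    Mv (UM x + M) (UM x' + Multiset.replicate M.card (0, 0)) := by
  induction M using Multiset.induction_on with
  | empty => intro x; exact ⟨x, by simpa using Mv.refl _⟩
  | cons p M ih =>
    intro x
    obtain ⟨x', h⟩ := ih (x + Pi.single p.1 p.2)
    refine ⟨x', ?_⟩
    have h1 := Mv.d2 x p.1 p.2 M
    simp only [Multiset.card_cons, Multiset.replicate_succ, Multiset.add_cons]
    exact h1.trans (h.consL _)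

theorem Mv.pigeon (M : Multiset (H × H)) (hM : 2 * Fintype.card (H × H) < M.card) :
    ∃ M', Mv M ((0, 0) ::ₘ M') := by
  have : ∃ p : H × H, 3 ≤ M.count p := by
    by_contra! hc
    have h1 : M.card = ∑ p : H × H, M.count p := by
      rw [Multiset.sum_count_eq_card (s := Finset.univ) (by simp)]
    have h2 : ∑ p : H × H, M.count p ≤ ∑ _p : H × H, 2 :=
      Finset.sum_le_sum fun p _ => Nat.le_of_lt_succ (hc p)
    simp at h2 h1 hM
    omega
  obtain ⟨⟨a, b⟩, hp⟩ := this
  obtain ⟨R, rfl⟩ := Multiset.le_iff_exists_add.1 (Multiset.le_count_iff_replicate_le.1 hp)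
  have e : Multiset.replicate 3 (a, b) + R = (a, b) ::ₘ (a, b) ::ₘ (a, b) ::ₘ R := by
    simp [Multiset.replicate_succ]
  rw [e]
  have h1 := Mv.s3 a b a b ((a, b) ::ₘ R)
  rw [sub_self, Multiset.cons_swap (a, 0)] at h1
  have h2 := Mv.s3 (a + a) b a b ((a, 0) ::ₘ R)
  rw [sub_self] at h2
  have h3 := (Mv.s3 0 0 a 0 R).symm
  rw [sub_self, zero_add] at h3
  have h4 := h1.trans (h2.trans (h3.consL (a + a + a, b)))
  rw [Multiset.cons_swap (a + a + a, b)] at h4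
  exact ⟨_, h4⟩

theorem Mv.pigeons (k : ℕ) : ∀ (M : Multiset (H × H)),
    2 * Fintype.card (H × H) + k ≤ M.card →
    ∃ M', Mv M (Multiset.replicate k (0, 0) + M') := by
  induction k with
  | zero => intro M _; exact ⟨M, by simpa using Mv.refl _⟩
  | succ k ih =>
    intro M hM
    obtain ⟨M1, h1⟩ := Mv.pigeon M (by omega)
    have hc := h1.card
    rw [Multiset.card_cons] at hc
    obtain ⟨M2, h2⟩ := ih M1 (by omega)
    exact ⟨M2, by rw [Multiset.replicate_succ, Multiset.cons_add]; exact h1.trans (h2.consL _)⟩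

theorem Mv.normal (M : Multiset (H × H)) (hM : FullM M)
    (hc : 2 * Fintype.card (H × H) + (Fintype.card H + 1) ≤ M.card) :
    ∃ x : H → H, ∃ k, Mv M ((0, 0) ::ₘ (UM x + Multiset.replicate k (0, 0))) := by
  obtain ⟨M1, h1⟩ := Mv.pigeons _ M hc
  have f1 := FullM.of_zero _ (h1.full hM)
  have h2 := Mv.fills f1 (Finset.univ : Finset H).val
  obtain ⟨x, h3⟩ := Mv.absorb M1 (fun _ => (0 : H))
  refine ⟨x, M1.card, h1.trans ?_⟩
  rw [Multiset.replicate_succ, Multiset.cons_add]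
  exact (h2.trans h3).consL _

theorem QM_UM_mem (x : H → H) (k : ℕ) (L : ExteriorAlgebra ℤ H →ₗ[ℤ] (H → H) ⧸ NS H)
    (hL : ∀ a b, L (ι ℤ a * ι ℤ b) = QuotientAddGroup.mk (Pi.single a b)) :
    L (QM ((0, 0) ::ₘ (UM x + Multiset.replicate k (0, 0)))) = QuotientAddGroup.mk x := by
  have : QM ((0, 0) ::ₘ (UM x + Multiset.replicate k (0, 0))) =
      ∑ h : H, ι ℤ h * ι ℤ (x h) := by
    simp [QM, UM]
  rw [this, map_sum]
  simp only [hL]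
  conv_rhs => rw [← Finset.univ_sum_single x]
  exact (map_sum (QuotientAddGroup.mk' (NS H)) _ _).symm

theorem exists_L : ∃ L : ExteriorAlgebra ℤ H →ₗ[ℤ] (H → H) ⧸ NS H,
    ∀ a b, L (ι ℤ a * ι ℤ b) = QuotientAddGroup.mk (Pi.single a b) := by
  let π := QuotientAddGroup.mk' (NS H)
  have hadd : ∀ h h' y, π (Pi.single (h + h') y) = π (Pi.single h y) + π (Pi.single h' y) := by
    intro h h' y
    rw [← map_add]
    refine QuotientAddGroup.eq.2 (AddSubgroup.subset_closure (Or.inr ⟨h, h', y, ?_⟩))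
    abel
  have halt : ∀ h, π (Pi.single h h) = 0 := fun h =>
    (QuotientAddGroup.eq_zero_iff _).2 (AddSubgroup.subset_closure (Or.inl ⟨h, rfl⟩))
  let B : H →+ H →+ (H → H) ⧸ NS H := AddMonoidHom.mk'
    (fun a => π.comp (AddMonoidHom.single (fun _ : H => H) a)) (by
      intro a b; ext y; exact hadd a b y)
  have hB : ∀ a b, B a b = π (Pi.single a b) := fun a b => rfl
  let A : H [⋀^Fin 2]→ₗ[ℤ] ((H → H) ⧸ NS H) :=
    { toFun := fun v => B (v 0) (v 1)
      map_update_add' := by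
        intro _ v i x y
        fin_cases i <;> simp [Function.update]
      map_update_smul' := by
        intro _ v i x y
        fin_cases i <;> simp [Function.update]
      map_eq_zero_of_eq' := by
        intro v i j hv hij
        have : v 0 = v 1 := by
          fin_cases i <;> fin_cases j <;> simp_all
        simp only [this, hB, halt] }
  refine ⟨liftAlternating (R := ℤ) (Function.update 0 2 A), fun a b => ?_⟩
  have h := liftAlternating_apply_ιMulti (R := ℤ) (Function.update 0 2 A) ![a, b]
  rw [ιMulti_apply] at h
  simp [List.ofFn_succ] at h
  rw [h]
  rfl

theorem Mv.main (M N : Multiset (H × H)) (hM : FullM M) (hN : FullM N)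
    (hc : 2 * Fintype.card (H × H) + (Fintype.card H + 1) ≤ M.card)
    (hcc : M.card = N.card) (hq : QM M = QM N) : Mv M N := by
  obtain ⟨x, k, h1⟩ := Mv.normal M hM hc
  obtain ⟨y, k', h2⟩ := Mv.normal N hN (hcc ▸ hc)
  have e1 := h1.card
  have e2 := h2.card
  simp [UM] at e1 e2
  obtain rfl : k = k' := by omega
  obtain ⟨L, hL⟩ := exists_L (H := H)
  have q1 := QM_UM_mem x k L hL
  have q2 := QM_UM_mem y k L hL
  rw [← h1.q, hq, h2.q, q2] at q1
  have hm := QuotientAddGroup.eq.1 q1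
  have h3 := Mv.d3 (Multiset.replicate k (0, 0)) _ hm y
  rw [add_neg_cancel_left] at h3
  exact h1.trans (h3.symm.trans h2.symm)

end comb

section symp
variable {m g : ℕ}

abbrev VV (m g : ℕ) : Type := (Fin g ⊕ Fin g) → ZMod m

noncomputable def omV (m g : ℕ) : ExteriorAlgebra ℤ (VV m g) :=
  ∑ i : Fin g,
    ι ℤ (Pi.single (Sum.inl i) (1 : ZMod m)) * ι ℤ (Pi.single (Sum.inr i) (1 : ZMod m))

def stdT (m g : ℕ) : Fin g → VV m g × VV m g :=
  fun i => (Pi.single (Sum.inl i) 1, Pi.single (Sum.inr i) 1)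

def tup {X : Type} [AddCommGroup X] (T : VV m g →+ X) : Fin g → X × X :=
  fun i => (T (stdT m g i).1, T (stdT m g i).2)

theorem map_om {X : Type} [AddCommGroup X] (T : VV m g →+ X) :
    ExteriorAlgebra.map T.toIntLinearMap (omV m g) = QM (Finset.univ.val.map (tup T)) := by
  rw [QM, Multiset.map_map]
  change _ = ∑ i : Fin g, _
  simp [omV, tup, stdT]

theorem tup_inj {X : Type} [AddCommGroup X] (T T' : VV m g →+ X) (h : tup T = tup T') :
    T = T' := by
  apply AddMonoidHom.functions_ext
  intro i c
  obtain ⟨k, rfl⟩ := ZMod.intCast_surjective c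
  have e : (Pi.single i (k : ZMod m) : VV m g) = k • Pi.single i 1 := by
    rw [← Pi.single_smul]; simp
  rw [e, map_zsmul, map_zsmul]
  congr 1
  rcases i with i | i
  · exact congrArg Prod.fst (congrFun h i)
  · exact congrArg Prod.snd (congrFun h i)

theorem tup_surj_aux {X : Type} [AddCommGroup X] [Module (ZMod m) X] (p : Fin g → X × X) :
    ∃ T : VV m g →+ X, tup T = p := by
  let L : (Fin g ⊕ Fin g → ZMod m) →ₗ[ZMod m] X :=
    (Pi.basisFun (ZMod m) (Fin g ⊕ Fin g)).constr (ZMod m)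
      (Sum.elim (fun i => (p i).1) (fun i => (p i).2))
  have h : ∀ j : Fin g ⊕ Fin g, L (Pi.single j 1) =
      (Sum.elim (fun i => (p i).1) (fun i => (p i).2)) j := by
    intro j
    rw [← Pi.basisFun_apply, Module.Basis.constr_basis]
  refine ⟨L.toAddMonoidHom, ?_⟩
  funext i
  exact Prod.ext (h (Sum.inl i)) (h (Sum.inr i))

theorem tup_surj {X : Type} [AddCommGroup X] (hX : ∀ x : X, m • x = 0) (p : Fin g → X × X) :
    ∃ T : VV m g →+ X, tup T = p :=
  @tup_surj_aux m g X _ (AddCommGroup.zmodModule hX) p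

theorem VV_tor (v : VV m g) : m • v = 0 := by
  funext i; simp

theorem surj_full {X : Type} [AddCommGroup X] (T : VV m g →+ X) :
    Function.Surjective T ↔ FullM (Finset.univ.val.map (tup T)) := by
  have key : ∀ G : AddSubgroup X, (∀ p ∈ Finset.univ.val.map (tup T), p.1 ∈ G ∧ p.2 ∈ G) →
      ∀ v, T v ∈ G := by
    intro G hG v
    have h1 : ∀ j, T (Pi.single j 1) ∈ G := by
      rintro (i | i)
      · exact (hG (tup T i) (Multiset.mem_map.2 ⟨i, by simp, rfl⟩)).1
      · exact (hG (tup T i) (Multiset.mem_map.2 ⟨i, by simp, rfl⟩)).2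
    rw [← Finset.univ_sum_single v, map_sum]
    refine sum_mem fun j _ => ?_
    obtain ⟨k, hk⟩ := ZMod.intCast_surjective (v j)
    have e : (Pi.single j (v j) : VV m g) = k • Pi.single j 1 := by
      rw [← Pi.single_smul, ← hk]; simp
    rw [e, map_zsmul]
    exact G.zsmul_mem (h1 j) k
  constructor
  · intro hs G hG
    rw [eq_top_iff]
    intro x _
    obtain ⟨v, rfl⟩ := hs x
    exact key G hG v
  · intro hf
    have : T.range = ⊤ := by
      apply hf
      intro p hp
      obtain ⟨i, _, rfl⟩ := Multiset.mem_map.1 hp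
      exact ⟨⟨_, rfl⟩, ⟨_, rfl⟩⟩
    exact AddMonoidHom.range_eq_top.1 this

/-- the symplectic group, as a predicate -/
def SpP (σ : VV m g ≃+ VV m g) : Prop :=
  ExteriorAlgebra.map σ.toAddMonoidHom.toIntLinearMap (omV m g) = omV m g

theorem map_comp_ap {X Y Z : Type} [AddCommGroup X] [AddCommGroup Y] [AddCommGroup Z]
    (f : X →+ Y) (h : Y →+ Z) (w : ExteriorAlgebra ℤ X) :
    ExteriorAlgebra.map (h.comp f).toIntLinearMap w =
      ExteriorAlgebra.map h.toIntLinearMap (ExteriorAlgebra.map f.toIntLinearMap w) := by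
  have := ExteriorAlgebra.map_comp_map f.toIntLinearMap h.toIntLinearMap
  exact (DFunLike.congr_fun this w).symm

theorem map_id_ap {X : Type} [AddCommGroup X] (w : ExteriorAlgebra ℤ X) :
    ExteriorAlgebra.map (AddMonoidHom.id X).toIntLinearMap w = w := by
  have := ExteriorAlgebra.map_id (R := ℤ) (M := X)
  exact (DFunLike.congr_fun this w)

theorem map_symm_ap {X Y : Type} [AddCommGroup X] [AddCommGroup Y] (e : X ≃+ Y)
    (w : ExteriorAlgebra ℤ X) :
    ExteriorAlgebra.map e.symm.toAddMonoidHom.toIntLinearMap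
      (ExteriorAlgebra.map e.toAddMonoidHom.toIntLinearMap w) = w := by
  rw [← map_comp_ap]
  have : e.symm.toAddMonoidHom.comp e.toAddMonoidHom = AddMonoidHom.id X := by ext x; simp
  rw [this, map_id_ap]

theorem SpP.symm {σ : VV m g ≃+ VV m g} (h : SpP σ) : SpP σ.symm := by
  have := map_symm_ap σ (omV m g)
  rw [show _ = _ from h] at this
  exact this

theorem SpP.trans {σ τ : VV m g ≃+ VV m g} (h : SpP σ) (h' : SpP τ) : SpP (σ.trans τ) := by
  have := map_comp_ap σ.toAddMonoidHom τ.toAddMonoidHom (omV m g)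
  rw [show _ = _ from h, show _ = _ from h'] at this
  exact this

def EqT {X : Type} [AddCommGroup X] (m : ℕ) (p p' : Fin g → X × X) : Prop :=
  ∃ σ : VV m g ≃+ VV m g, SpP σ ∧
    ∀ T : VV m g →+ X, tup T = p → tup (T.comp σ.toAddMonoidHom) = p'

theorem EqT.symm {X : Type} [AddCommGroup X] (hX : ∀ x : X, m • x = 0) {p p' : Fin g → X × X}
    (h : EqT m p p') : EqT m p' p := by
  obtain ⟨σ, h1, h2⟩ := h
  refine ⟨σ.symm, h1.symm, fun T hT => ?_⟩
  obtain ⟨T1, h3⟩ := tup_surj hX p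
  have := tup_inj _ _ ((h2 T1 h3).trans hT.symm)
  rw [← this, ← h3]
  congr 1
  ext v; simp

theorem EqT.trans {X : Type} [AddCommGroup X] {p p' p'' : Fin g → X × X}
    (h : EqT m p p') (h' : EqT m p' p'') : EqT m p p'' := by
  obtain ⟨σ, h1, h2⟩ := h
  obtain ⟨τ, h3, h4⟩ := h'
  exact ⟨τ.trans σ, h3.trans h1, fun T hT => h4 _ (h2 T hT)⟩

theorem tup_comp {X Y : Type} [AddCommGroup X] [AddCommGroup Y] (T : VV m g →+ X) (f : X →+ Y) :
    tup (f.comp T) = Prod.map f f ∘ tup T := rfl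

theorem tup_id : tup (AddMonoidHom.id (VV m g)) = stdT m g := rfl

/-- natural operations on tuples give symplectic equivalences -/
theorem EqT.of_move (μ ν : ∀ (X : Type) [AddCommGroup X], (Fin g → X × X) → (Fin g → X × X))
    (hμ : ∀ (X Y : Type) [AddCommGroup X] [AddCommGroup Y] (f : X →+ Y) (p : Fin g → X × X),
      μ Y (Prod.map f f ∘ p) = Prod.map f f ∘ μ X p)
    (hν : ∀ (X Y : Type) [AddCommGroup X] [AddCommGroup Y] (f : X →+ Y) (p : Fin g → X × X),
      ν Y (Prod.map f f ∘ p) = Prod.map f f ∘ ν X p)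
    (h1 : ∀ (X : Type) [AddCommGroup X] (p : Fin g → X × X), μ X (ν X p) = p)
    (h2 : ∀ (X : Type) [AddCommGroup X] (p : Fin g → X × X), ν X (μ X p) = p)
    (hq : ∀ (X : Type) [AddCommGroup X] (p : Fin g → X × X),
      QM (Finset.univ.val.map (μ X p)) = QM (Finset.univ.val.map p))
    (X : Type) [AddCommGroup X] (p : Fin g → X × X) : EqT m p (μ X p) := by
  obtain ⟨S, hS⟩ := tup_surj (m := m) (g := g) VV_tor (μ _ (stdT m g))
  obtain ⟨S', hS'⟩ := tup_surj (m := m) (g := g) VV_tor (ν _ (stdT m g))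
  have e1 : S.comp S' = AddMonoidHom.id _ := by
    apply tup_inj
    rw [tup_comp, hS', ← hν, ← tup_id, ← tup_comp, AddMonoidHom.comp_id, hS, h2, tup_id]
  have e2 : S'.comp S = AddMonoidHom.id _ := by
    apply tup_inj
    rw [tup_comp, hS, ← hμ, ← tup_id, ← tup_comp, AddMonoidHom.comp_id, hS', h1, tup_id]
  refine ⟨AddMonoidHom.toAddEquiv S S' e2 e1, ?_, fun T hT => ?_⟩
  · have := map_om S
    rw [hS, hq, ← tup_id, ← map_om, map_id_ap] at this
    exact this
  · have : tup (T.comp S) = μ X p := by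
      rw [tup_comp, hS, ← hμ, ← tup_id, ← tup_comp, AddMonoidHom.comp_id, hT]
    exact this

theorem EqT.perm {X : Type} [AddCommGroup X] (p : Fin g → X × X) (π : Equiv.Perm (Fin g)) :
    EqT m p (p ∘ π) := by
  refine EqT.of_move (fun X _ p => p ∘ π) (fun X _ p => p ∘ π.symm) ?_ ?_ ?_ ?_ ?_ X p
  · intros; rfl
  · intros; rfl
  · intros; funext i; simp
  · intros; funext i; simp
  · intro X _ p
    have : (Finset.univ.val.map (p ∘ π)) = Finset.univ.val.map p := by
      rw [← Multiset.map_map, Multiset.map_univ_val_equiv]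
    rw [this]

theorem EqT.of_map_eq {X : Type} [AddCommGroup X] (p p' : Fin g → X × X)
    (h : Finset.univ.val.map p = Finset.univ.val.map p') : EqT m p p' := by
  obtain ⟨π, hπ⟩ : ∃ π : Equiv.Perm (Fin g), p ∘ π = p' := by
    classical
    have hc : ∀ y, Nonempty ({i // p' i = y} ≃ {i // p i = y}) := by
      intro y
      have h1 := congrArg (Multiset.count y) h
      rw [Multiset.count_map, Multiset.count_map] at h1
      refine ⟨Fintype.equivOfCardEq ?_⟩
      rw [Fintype.card_subtype, Fintype.card_subtype, Finset.card_def, Finset.card_def,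
        Finset.filter_val, Finset.filter_val]
      simp only [eq_comm (b := y)]
      exact h1.symm
    let e := ((Equiv.sigmaFiberEquiv p').symm.trans
      (Equiv.sigmaCongrRight fun y => (hc y).some)).trans (Equiv.sigmaFiberEquiv p)
    refine ⟨e, ?_⟩
    funext i
    exact ((hc (p' i)).some ⟨i, rfl⟩).2
  rw [← hπ]
  exact EqT.perm p π

/-- multiset of an updated tuple -/
theorem map_update1 {Y : Type} (p : Fin g → Y) (i : Fin g) : ∃ R : Multiset Y,
    Finset.univ.val.map p = p i ::ₘ R ∧
    ∀ z, Finset.univ.val.map (Function.update p i z) = z ::ₘ R := by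
  have e : (Finset.univ : Finset (Fin g)).val = i ::ₘ (Finset.univ.erase i).val := by
    rw [Finset.erase_val, Multiset.cons_erase]; simp
  refine ⟨(Finset.univ.erase i).val.map p, by conv_lhs => rw [e, Multiset.map_cons], fun z => ?_⟩
  rw [e, Multiset.map_cons, Function.update_self]
  congr 1
  apply Multiset.map_congr rfl
  intro x hx
  have : x ∈ (Finset.univ : Finset (Fin g)).erase i := hx
  rw [Function.update_of_ne (Finset.mem_erase.1 this).1]

theorem map_update2 {Y : Type} (p : Fin g → Y) (i j : Fin g) (hij : i ≠ j) : ∃ R : Multiset Y,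
    Finset.univ.val.map p = p i ::ₘ p j ::ₘ R ∧
    ∀ z w, Finset.univ.val.map (Function.update (Function.update p i z) j w) = z ::ₘ w ::ₘ R := by
  have e : (Finset.univ : Finset (Fin g)).val =
      i ::ₘ j ::ₘ ((Finset.univ.erase i).erase j).val := by
    rw [Finset.erase_val, Multiset.cons_erase, Finset.erase_val, Multiset.cons_erase]
    · simp
    · exact (Finset.mem_erase.2 ⟨hij.symm, Finset.mem_univ j⟩ : j ∈ Finset.univ.erase i)
  refine ⟨((Finset.univ.erase i).erase j).val.map p,
    by conv_lhs => rw [e, Multiset.map_cons, Multiset.map_cons], fun z w => ?_⟩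
  rw [e, Multiset.map_cons, Multiset.map_cons, Function.update_self,
    Function.update_of_ne hij, Function.update_self]
  congr 2
  apply Multiset.map_congr rfl
  intro x hx
  have : x ∈ ((Finset.univ : Finset (Fin g)).erase i).erase j := hx
  simp only [Finset.mem_erase] at this
  rw [Function.update_of_ne this.1, Function.update_of_ne this.2.1]

theorem EqT.move1 (φ ψ : ∀ (X : Type) [AddCommGroup X], X × X → X × X)
    (hφ : ∀ (X Y : Type) [AddCommGroup X] [AddCommGroup Y] (f : X →+ Y) (p : X × X),
      φ Y (Prod.map f f p) = Prod.map f f (φ X p))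
    (hψ : ∀ (X Y : Type) [AddCommGroup X] [AddCommGroup Y] (f : X →+ Y) (p : X × X),
      ψ Y (Prod.map f f p) = Prod.map f f (ψ X p))
    (h1 : ∀ (X : Type) [AddCommGroup X] (p : X × X), φ X (ψ X p) = p)
    (h2 : ∀ (X : Type) [AddCommGroup X] (p : X × X), ψ X (φ X p) = p)
    (hmv : ∀ (X : Type) [AddCommGroup X] (p : X × X) M, Mv (p ::ₘ M) (φ X p ::ₘ M))
    {X : Type} [AddCommGroup X] (z : X × X) (M : Multiset (X × X)) (p p' : Fin g → X × X)
    (hp : Finset.univ.val.map p = z ::ₘ M) (hp' : Finset.univ.val.map p' = φ X z ::ₘ M) :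
    EqT m p p' := by
  have : z ∈ Finset.univ.val.map p := by rw [hp]; simp
  obtain ⟨i, -, rfl⟩ := Multiset.mem_map.1 this
  have h := EqT.of_move (m := m) (g := g) (fun X _ p => Function.update p i (φ X (p i)))
    (fun X _ p => Function.update p i (ψ X (p i))) ?_ ?_ ?_ ?_ ?_ X p
  · refine h.trans (EqT.of_map_eq _ _ ?_)
    obtain ⟨R, hR, hR'⟩ := map_update1 p i
    rw [hR', hp']
    rw [hR, Multiset.cons_inj_right] at hp
    rw [hp]
  · intro X Y _ _ f p
    simp only [Function.comp_apply, hφ, Function.comp_update]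
  · intro X Y _ _ f p
    simp only [Function.comp_apply, hψ, Function.comp_update]
  · intro X _ p
    simp [h1]
  · intro X _ p
    simp [h2]
  · intro X _ p
    obtain ⟨R, hR, hR'⟩ := map_update1 p i
    rw [hR', hR]
    exact (hmv X (p i) R).q.symm

theorem EqT.move2 {X : Type} [AddCommGroup X] (a b c d : X) (M : Multiset (X × X))
    (p p' : Fin g → X × X)
    (hp : Finset.univ.val.map p = (a, b) ::ₘ (c, d) ::ₘ M)
    (hp' : Finset.univ.val.map p' = (a + c, b) ::ₘ (c, d - b) ::ₘ M) :
    EqT m p p' := by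
  have : (a, b) ∈ Finset.univ.val.map p := by rw [hp]; simp
  obtain ⟨i, -, hi⟩ := Multiset.mem_map.1 this
  obtain ⟨j, hij, hj⟩ : ∃ j, i ≠ j ∧ p j = (c, d) := by
    have e : (Finset.univ : Finset (Fin g)).val = i ::ₘ (Finset.univ.erase i).val := by
      rw [Finset.erase_val, Multiset.cons_erase]; simp
    rw [e, Multiset.map_cons, hi, Multiset.cons_inj_right] at hp
    have : (c, d) ∈ (Finset.univ.erase i).val.map p := by rw [hp]; simp
    obtain ⟨j, hj, hj'⟩ := Multiset.mem_map.1 this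
    have hj : j ∈ (Finset.univ : Finset (Fin g)).erase i := hj
    exact ⟨j, (Finset.mem_erase.1 hj).1.symm, hj'⟩
  have h := EqT.of_move (m := m) (g := g)
    (fun X _ p => Function.update (Function.update p i ((p i).1 + (p j).1, (p i).2)) j
      ((p j).1, (p j).2 - (p i).2))
    (fun X _ p => Function.update (Function.update p i ((p i).1 - (p j).1, (p i).2)) j
      ((p j).1, (p j).2 + (p i).2)) ?_ ?_ ?_ ?_ ?_ X p
  · refine h.trans (EqT.of_map_eq _ _ ?_)
    obtain ⟨R, hR, hR'⟩ := map_update2 p i j hij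
    rw [hR', hp', hi, hj]
    rw [hR, hi, hj, Multiset.cons_inj_right, Multiset.cons_inj_right] at hp
    rw [hp]
  · intro X Y _ _ f p
    simp only [Function.comp_apply, Function.comp_update, Prod.map, map_add, map_sub]
  · intro X Y _ _ f p
    simp only [Function.comp_apply, Function.comp_update, Prod.map, map_add, map_sub]
  · intro X _ p
    funext k
    by_cases hk : k = j
    · subst hk; simp [Function.update_of_ne hij]
    · by_cases hk' : k = i
      · subst hk'; simp [Function.update_of_ne hij]
      · simp [hk, hk']
  · intro X _ p
    funext k
    by_cases hk : k = j
    · subst hk; simp [Function.update_of_ne hij]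
    · by_cases hk' : k = i
      · subst hk'; simp [Function.update_of_ne hij]
      · simp [hk, hk']
  · intro X _ p
    obtain ⟨R, hR, hR'⟩ := map_update2 p i j hij
    rw [hR', hR]
    exact (Mv.s3 (p i).1 (p i).2 (p j).1 (p j).2 R).q.symm

theorem exists_tuple {Y : Type} (M : Multiset Y) (h : M.card = g) :
    ∃ p : Fin g → Y, Finset.univ.val.map p = M := by
  subst h
  induction M using Quotient.inductionOn with
  | h l => exact ⟨fun i => l.get i, by
      rw [Fin.univ_val_map]; exact congrArg _ (List.ofFn_get l)⟩

theorem EqT.of_Mv {X : Type} [AddCommGroup X] (hX : ∀ x : X, m • x = 0)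
    {M N : Multiset (X × X)} (h : Mv M N) : ∀ p p' : Fin g → X × X,
    Finset.univ.val.map p = M → Finset.univ.val.map p' = N → EqT m p p' := by
  induction h with
  | refl M => intro p p' h h'; exact EqT.of_map_eq _ _ (h.trans h'.symm)
  | symm _ ih => intro p p' h h'; exact (ih p' p h' h).symm hX
  | @trans M N P hMN _ h1 h2 =>
    intro p p' h h'
    obtain ⟨p'', h''⟩ := exists_tuple (g := g) N (by rw [← hMN.card, ← h]; simp)
    exact (h1 p p'' h h'').trans (h2 p'' p' h'' h')
  | s1 a b M =>
    intro p p' h h'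
    refine EqT.move1 (fun X _ z => (z.1, z.2 + z.1)) (fun X _ z => (z.1, z.2 - z.1))
      ?_ ?_ ?_ ?_ ?_ (a, b) M p p' h h'
    · intros; simp
    · intros; simp
    · intros; simp
    · intros; simp
    · intro X _ z M; exact Mv.s1 z.1 z.2 M
  | s2 a b M =>
    intro p p' h h'
    refine EqT.move1 (fun X _ z => (z.2, -z.1)) (fun X _ z => (-z.2, z.1))
      ?_ ?_ ?_ ?_ ?_ (a, b) M p p' h h'
    · intros; simp
    · intros; simp
    · intros; simp
    · intros; simp
    · intro X _ z M; exact Mv.s2 z.1 z.2 M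
  | s3 a b c d M =>
    intro p p' h h'
    exact EqT.move2 a b c d M p p' h h'

theorem exists_QM {H : Type} [AddCommGroup H] (w : ExteriorAlgebra ℤ H) (hw : w ∈ ⋀[ℤ]^2 H) :
    ∃ M : Multiset (H × H), QM M = w := by
  have hw' : w ∈ LinearMap.range (ι ℤ (M := H)) * LinearMap.range (ι ℤ (M := H)) := by
    rw [← pow_two]; exact hw
  induction hw' using Submodule.mul_induction_on' with
  | mem_mul_mem x hx y hy =>
    obtain ⟨a, rfl⟩ := hx
    obtain ⟨b, rfl⟩ := hy
    exact ⟨{(a, b)}, by simp [QM]⟩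
  | add x hx y hy h1 h2 =>
    obtain ⟨M, rfl⟩ := h1 (by rw [exteriorPower, pow_two]; exact hx)
    obtain ⟨N, rfl⟩ := h2 (by rw [exteriorPower, pow_two]; exact hy)
    exact ⟨M + N, by simp [QM]⟩

theorem main_count (m : ℕ) (q : ℤ) (H : Type) [AddCommGroup H] [Finite H]
    (hH : ∀ h : H, m • h = 0)
    (FH : H ≃+ H) (ωH : ExteriorAlgebra ℤ H) (hωH : ωH ∈ ⋀[ℤ]^2 H)
    (hF : ExteriorAlgebra.map FH.toAddMonoidHom.toIntLinearMap ωH = q • ωH) :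
    ∃ g₀ : ℕ, ∀ g : ℕ, g₀ ≤ g →
      Nat.card {TF : (VV m g →+ H) × (VV m g ≃+ VV m g) //
          Function.Surjective TF.1 ∧
          ExteriorAlgebra.map TF.1.toIntLinearMap (omV m g) = ωH ∧
          ExteriorAlgebra.map TF.2.toAddMonoidHom.toIntLinearMap (omV m g) = q • omV m g ∧
          ∀ v : VV m g, TF.1 (TF.2 v) = FH (TF.1 v)} =
      Nat.card {F : VV m g ≃+ VV m g //
          ExteriorAlgebra.map F.toAddMonoidHom.toIntLinearMap (omV m g) = q • omV m g} := by
  classical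
  letI := Fintype.ofFinite H
  obtain ⟨M0, hM0⟩ := exists_QM ωH hωH
  refine ⟨(2 * Fintype.card (H × H) + (Fintype.card H + 1)) + (M0.card + Fintype.card H),
    fun g hg => ?_⟩
  -- base point
  obtain ⟨p0, hp0⟩ := exists_tuple (g := g)
    (M0 + UM (fun _ => (0 : H)) + Multiset.replicate (g - (M0.card + Fintype.card H)) (0, 0))
    (by simp [UM]; omega)
  obtain ⟨T0, hT0⟩ := tup_surj hH p0
  have hT0s : Function.Surjective T0 := by
    rw [surj_full, hT0, hp0]
    exact (UM_full _).mono ((Multiset.le_add_left _ _).trans (Multiset.le_add_right _ _))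
  have hT0q : ExteriorAlgebra.map T0.toIntLinearMap (omV m g) = ωH := by
    rw [map_om, hT0, hp0, ← hM0]
    simp [QM, UM]
  -- transitivity
  have trans : ∀ T : VV m g →+ H, Function.Surjective T →
      ExteriorAlgebra.map T.toIntLinearMap (omV m g) = ωH →
      ∃ σ : VV m g ≃+ VV m g, SpP σ ∧ T0.comp σ.toAddMonoidHom = T := by
    intro T hs hq
    have hmv : Mv (Finset.univ.val.map (tup T0)) (Finset.univ.val.map (tup T)) := by
      refine Mv.main _ _ ((surj_full _).1 hT0s) ((surj_full _).1 hs) ?_ ?_ ?_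
      · simp only [Multiset.card_map, Finset.card_val, Finset.card_univ, Fintype.card_fin]
        omega
      · simp
      · rw [← map_om, ← map_om, hq, hT0q]
    obtain ⟨σ, h1, h2⟩ := EqT.of_Mv hH hmv (tup T0) (tup T) rfl rfl
    exact ⟨σ, h1, tup_inj _ _ (h2 T0 rfl)⟩
  choose! s hs1 hs2 using trans
  -- the bijection
  have hS : ∀ G : VV m g ≃+ VV m g,
      ExteriorAlgebra.map G.toAddMonoidHom.toIntLinearMap (omV m g) = q • omV m g →
      Function.Surjective (FH.symm.toAddMonoidHom.comp (T0.comp G.toAddMonoidHom)) ∧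
      ExteriorAlgebra.map
        (FH.symm.toAddMonoidHom.comp (T0.comp G.toAddMonoidHom)).toIntLinearMap
        (omV m g) = ωH := by
    intro G hG
    refine ⟨FH.symm.surjective.comp (hT0s.comp G.surjective), ?_⟩
    rw [map_comp_ap, map_comp_ap, hG, map_zsmul, hT0q, ← hF, map_symm_ap]
  refine Nat.card_congr (Equiv.ofBijective
    (fun x => ⟨x.1.2.trans (s x.1.1), ?_⟩) ⟨?_, ?_⟩)
  · obtain ⟨⟨T, F⟩, h1, h2, h3, h4⟩ := x
    have := map_comp_ap F.toAddMonoidHom (s T).toAddMonoidHom (omV m g)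
    rw [h3, map_zsmul, show _ = _ from hs1 T h1 h2] at this
    exact this
  · rintro ⟨⟨T, F⟩, h1, h2, h3, h4⟩ ⟨⟨T', F'⟩, h1', h2', h3', h4'⟩ heq
    have heq : F.trans (s T) = F'.trans (s T') := congrArg Subtype.val heq
    have e : ∀ v, FH (T v) = FH (T' v) := by
      intro v
      rw [← h4 v, ← h4' v]
      have a1 := DFunLike.congr_fun (hs2 T h1 h2) (F v)
      have a2 := DFunLike.congr_fun (hs2 T' h1' h2') (F' v)
      have a3 : s T (F v) = s T' (F' v) := DFunLike.congr_fun heq v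
      exact a1.symm.trans ((congrArg T0 a3).trans a2)
    obtain rfl : T = T' := DFunLike.ext _ _ fun v => FH.injective (e v)
    have : F = F' := by
      ext1 v
      exact (s T).injective (DFunLike.congr_fun heq v)
    subst this
    rfl
  · rintro ⟨G, hG⟩
    obtain ⟨h1, h2⟩ := hS G hG
    set T := FH.symm.toAddMonoidHom.comp (T0.comp G.toAddMonoidHom) with hT
    refine ⟨⟨⟨T, G.trans (s T).symm⟩, h1, h2, ?_, ?_⟩, ?_⟩
    · have := map_comp_ap G.toAddMonoidHom (s T).symm.toAddMonoidHom (omV m g)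
      rw [hG, map_zsmul, show _ = _ from (hs1 T h1 h2).symm] at this
      exact this
    · intro v
      have a1 := DFunLike.congr_fun (hs2 T h1 h2) ((s T).symm (G v))
      have a2 : T v = FH.symm (T0 (G v)) := rfl
      have a3 : T0 (s T ((s T).symm (G v))) = T ((s T).symm (G v)) := a1
      rw [AddEquiv.apply_symm_apply] at a3
      rw [a2, AddEquiv.apply_symm_apply]
      exact a3.symm
    · apply Subtype.ext
      ext1 v
      exact (s T).apply_symm_apply (G v)

end symp

theorem statement15 (ℓ n : ℕ) [Fact ℓ.Prime] (hn : 1 ≤ n) (q : ℤ)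
    (hq : IsUnit (q : ZMod ℓ))
    (H : Type) [AddCommGroup H] [Finite H] (hH : ∀ h : H, (ℓ ^ n : ℕ) • h = 0)
    (FH : H ≃+ H) (ωH : ExteriorAlgebra ℤ H) (hωH : ωH ∈ ⋀[ℤ]^2 H)
    (hFHωH : ExteriorAlgebra.map FH.toAddMonoidHom.toIntLinearMap ωH = q • ωH) :
    ∃ g₀ : ℕ, ∀ g : ℕ, g₀ ≤ g →
      Nat.card {TF : (Vsp ℓ n g →+ H) × (Vsp ℓ n g ≃+ Vsp ℓ n g) //
          Function.Surjective TF.1 ∧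
          ExteriorAlgebra.map TF.1.toIntLinearMap (omegaStd ℓ n g) = ωH ∧
          ExteriorAlgebra.map TF.2.toAddMonoidHom.toIntLinearMap (omegaStd ℓ n g) =
            q • omegaStd ℓ n g ∧
          ∀ v : Vsp ℓ n g, TF.1 (TF.2 v) = FH (TF.1 v)} =
      Nat.card {F : Vsp ℓ n g ≃+ Vsp ℓ n g //
          ExteriorAlgebra.map F.toAddMonoidHom.toIntLinearMap (omegaStd ℓ n g) =
            q • omegaStd ℓ n g} := by
  exact main_count (ℓ ^ n) q H hH FH ωH hωH hFHωH
end

section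
/- Suppose T_0 : V → H is a surjective group homomorphism with (∧²T_0)(ω) = ω_H. Then the set {F ∈ GSp^{(q)}(V, ω) : T_0∘F = F_H∘T_0} is nonempty, and its cardinality equals #{g ∈ Sp(V, ω) : T_0∘g = T_0}. -/
/- STATEMENT 16: Suppose T₀ : V → H is a surjective group homomorphism with
   (∧²T₀)(ω) = ω_H.  Then the set {F ∈ GSp^{(q)}(V, ω) : T₀∘F = F_H∘T₀} is nonempty, and
   its cardinality equals #{g ∈ Sp(V, ω) : T₀∘g = T₀}.

   The setup is as in the companion statement: V = (ℤ/ℓⁿℤ)^{2g} (realized as functions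
   Fin g ⊕ Fin g → ZMod (ℓ^n)) with standard symplectic element ω = Σᵢ eᵢ ∧ fᵢ of ∧²V;
   since all groups in sight are killed by ℓⁿ, second exterior powers are taken over ℤ
   and are realized inside the exterior algebra, with ∧² of a map being the restriction
   of the induced algebra map. -/

open ExteriorAlgebra

theorem w_step {F U W : Type} [Field F] [AddCommGroup U] [Module F U] [FiniteDimensional F U]
    [AddCommGroup W] [Module F W]
    (B : LinearMap.BilinForm F U) (hB : B.Nondegenerate) (hA : ∀ x, B x x = 0)
    (f f' : W →ₗ[F] U) (hf : Function.Injective f) (hf' : Function.Injective f')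
    (hiso : ∀ x y, B (f x) (f y) = B (f' x) (f' y)) (x : U) (hx : x ∉ LinearMap.range f) :
    ∃ h, h ∉ LinearMap.range f' ∧ ∀ w, B (f' w) h = B (f w) x := by
  have hskew : ∀ x y, B x y = - B y x := by
    intro x y
    have := hA (x + y)
    simp only [map_add, LinearMap.add_apply, hA, zero_add, add_zero] at this
    exact eq_neg_of_add_eq_zero_right this
  obtain ⟨p, hp⟩ := LinearMap.exists_leftInverse_of_injective f' (LinearMap.ker_eq_bot.2 hf')
  have hp' : ∀ w, p (f' w) = w := fun w => LinearMap.congr_fun hp w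
  obtain ⟨s, hs⟩ : ∃ s, ∀ w, B (f' w) s = B (f w) x := by
    refine ⟨-(B.toDual hB).symm ((B.flip x) ∘ₗ f ∘ₗ p), fun w => ?_⟩
    rw [hskew]
    have := LinearMap.BilinForm.apply_toDual_symm_apply (hB := hB) ((B.flip x) ∘ₗ f ∘ₗ p) (f' w)
    simp only [map_neg, LinearMap.neg_apply, neg_neg]
    rw [this]
    simp [hp']
  by_cases hs' : s ∈ LinearMap.range f'
  swap
  · exact ⟨s, hs', hs⟩
  by_cases hle : B.orthogonal (LinearMap.range f') ≤ LinearMap.range f'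
  · exfalso
    obtain ⟨w₀, rfl⟩ := hs'
    have h1 := LinearMap.BilinForm.finrank_orthogonal hB (LinearMap.range f')
    have h2 := LinearMap.BilinForm.finrank_orthogonal hB (LinearMap.range f)
    rw [LinearMap.finrank_range_of_inj hf'] at h1
    rw [LinearMap.finrank_range_of_inj hf] at h2
    have hc : (B.orthogonal (LinearMap.range f')).comap f' =
        (B.orthogonal (LinearMap.range f)).comap f := by
      ext w
      simp [LinearMap.BilinForm.mem_orthogonal_iff, hiso]
    have h3 : ((B.orthogonal (LinearMap.range f')).comap f').map f' =
        B.orthogonal (LinearMap.range f') := by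
      rw [Submodule.map_comap_eq, inf_eq_right.2 hle]
    have h4 : ((B.orthogonal (LinearMap.range f)).comap f).map f ≤
        B.orthogonal (LinearMap.range f) := Submodule.map_comap_le _ _
    have h5 : Module.finrank F (((B.orthogonal (LinearMap.range f)).comap f).map f) =
        Module.finrank F (B.orthogonal (LinearMap.range f)) := by
      rw [h2, ← h1, ← h3, ← hc]
      rw [← (Submodule.equivMapOfInjective f hf _).finrank_eq,
        ← (Submodule.equivMapOfInjective f' hf' _).finrank_eq]
    have h6 := Submodule.eq_of_le_of_finrank_eq h4 h5
    have h7 : x - f w₀ ∈ B.orthogonal (LinearMap.range f) := by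
      rw [LinearMap.BilinForm.mem_orthogonal_iff]
      rintro _ ⟨w, rfl⟩
      rw [map_sub, ← hs, hiso, sub_self]
    rw [← h6] at h7
    obtain ⟨w, -, hw⟩ := h7
    exact hx ⟨w + w₀, by rw [map_add, hw]; abel⟩
  · obtain ⟨z, hz, hz'⟩ := SetLike.not_le_iff_exists.1 hle
    refine ⟨s + z, fun h => hz' ?_, fun w => ?_⟩
    · simpa using Submodule.sub_mem _ h hs'
    · rw [LinearMap.BilinForm.mem_orthogonal_iff] at hz
      have : B (f' w) z = 0 := hz _ ⟨w, rfl⟩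
      rw [map_add, this, hs, add_zero]

theorem w_ext {F U : Type} [Field F] [AddCommGroup U] [Module F U] [FiniteDimensional F U]
    (B : LinearMap.BilinForm F U) (hB : B.Nondegenerate) (hA : ∀ x, B x x = 0) (m : ℕ) :
    ∀ (W : Type) [AddCommGroup W] [Module F W] 
    (f f' : W →ₗ[F] U) (_ : Function.Injective f) (_ : Function.Injective f')
    (_ : ∀ x y, B (f x) (f y) = B (f' x) (f' y))
    (_ : Module.finrank F (LinearMap.range f) + m = Module.finrank F U),
    ∃ Φ : U ≃ₗ[F] U, (∀ x y, B (Φ x) (Φ y) = B x y) ∧ ∀ w, Φ (f w) = f' w := by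
  have hskew : ∀ x y, B x y = - B y x := by
    intro x y
    have := hA (x + y)
    simp only [map_add, LinearMap.add_apply, hA, zero_add, add_zero] at this
    exact eq_neg_of_add_eq_zero_right this
  induction m with
  | zero =>
    intro W _ _ f f' hf hf' hiso hd
    have hr : LinearMap.range f = ⊤ := Submodule.eq_top_of_finrank_eq hd
    have hr' : LinearMap.range f' = ⊤ := by
      apply Submodule.eq_top_of_finrank_eq
      rw [LinearMap.finrank_range_of_inj hf', ← LinearMap.finrank_range_of_inj hf]; exact hd
    let e := LinearEquiv.ofBijective f ⟨hf, LinearMap.range_eq_top.1 hr⟩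
    let e' := LinearEquiv.ofBijective f' ⟨hf', LinearMap.range_eq_top.1 hr'⟩
    have he : ∀ w, e w = f w := fun w => rfl
    have he' : ∀ w, e' w = f' w := fun w => rfl
    refine ⟨e.symm.trans e', fun x y => ?_, fun w => ?_⟩
    · obtain ⟨x, rfl⟩ := e.surjective x
      obtain ⟨y, rfl⟩ := e.surjective y
      simp only [LinearEquiv.trans_apply, LinearEquiv.symm_apply_apply]
      rw [he, he, he', he', hiso]
    · rw [← he, ← he']; simp
  | succ m ih =>
    intro W _ _ f f' hf hf' hiso hd
    obtain ⟨x, hx⟩ : ∃ x, x ∉ LinearMap.range f := by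
      by_contra! h
      have : LinearMap.range f = ⊤ := by ext y; simpa using h y
      rw [this, finrank_top] at hd
      omega
    obtain ⟨h, hh, hh'⟩ := w_step B hB hA f f' hf hf' hiso x hx
    have key : ∀ (k : W →ₗ[F] U) (y : U), Function.Injective k → y ∉ LinearMap.range k →
        Function.Injective (k.coprod (LinearMap.toSpanSingleton F U y)) := by
      intro k y hk hy
      rw [injective_iff_map_eq_zero]
      rintro ⟨w, c⟩ h0
      simp only [LinearMap.coprod_apply, LinearMap.toSpanSingleton_apply] at h0
      have hc : c = 0 := by
        by_contra hc
        apply hy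
        refine ⟨-(c⁻¹ • w), ?_⟩
        rw [map_neg, map_smul, eq_neg_of_add_eq_zero_left h0, smul_neg, neg_neg, smul_smul,
          inv_mul_cancel₀ hc, one_smul]
      subst hc
      rw [zero_smul, add_zero] at h0
      rw [(injective_iff_map_eq_zero k).1 hk w h0]; rfl
    have hi := key f x hf hx
    have hi' := key f' h hf' hh
    have : Module.Finite F W := Module.Finite.of_injective f hf
    obtain ⟨Φ, h1, h2⟩ := ih (W × F) _ _ hi hi' (by
      rintro ⟨w, c⟩ ⟨w', c'⟩
      have e1 : B x (f w') = B h (f' w') := by rw [hskew, ← hh', ← hskew]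
      simp [hiso, hh', hA, e1]) (by
      rw [LinearMap.finrank_range_of_inj hi, Module.finrank_prod, Module.finrank_self,
        ← LinearMap.finrank_range_of_inj hf]; omega)
    refine ⟨Φ, h1, fun w => ?_⟩
    simpa using h2 (w, 0)


theorem ea_lift2 {A N : Type} [AddCommGroup A] [AddCommGroup N] (b : A →+ A →+ N)
    (hb : ∀ x, b x x = 0) :
    ∃ L : ExteriorAlgebra ℤ A →ₗ[ℤ] N, ∀ x y, L (ι ℤ x * ι ℤ y) = b x y := by
  let b2 : A [⋀^Fin 2]→ₗ[ℤ] N :=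
    { toFun := fun v => b (v 0) (v 1)
      map_update_add' := by
        intro inst m i x y
        rw [Subsingleton.elim inst (instDecidableEqFin 2)]
        fin_cases i <;> simp
      map_update_smul' := by
        intro inst m i c x
        rw [Subsingleton.elim inst (instDecidableEqFin 2)]
        fin_cases i <;> simp
      map_eq_zero_of_eq' := by
        intro v i j h hij
        have : v 0 = v 1 := by
          fin_cases i <;> fin_cases j <;> simp_all
        rw [this, hb] }
  let fam : (i : ℕ) → A [⋀^Fin i]→ₗ[ℤ] N := fun i =>
    match i with
    | 2 => b2
    | _ => 0
  refine ⟨liftAlternating fam, fun x y => ?_⟩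
  have := liftAlternating_apply_ιMulti fam (n := 2) ![x, y]
  rw [ιMulti_apply] at this
  have h2 : fam 2 ![x, y] = b x y := rfl
  rw [h2] at this
  simpa using this

/-- wedge span -/
def kw {A : Type} [AddCommGroup A] (K : AddSubgroup A) : Submodule ℤ (ExteriorAlgebra ℤ A) :=
  Submodule.span ℤ {z | ∃ k ∈ K, ∃ v, z = ι ℤ k * ι ℤ v}

theorem kw_mem {A : Type} [AddCommGroup A] {K : AddSubgroup A} {k : A} (hk : k ∈ K) (v : A) :
    ι ℤ k * ι ℤ v ∈ kw K := Submodule.subset_span ⟨k, hk, v, rfl⟩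

theorem kw_mem' {A : Type} [AddCommGroup A] {K : AddSubgroup A} {k : A} (hk : k ∈ K) (v : A) :
    ι ℤ v * ι ℤ k ∈ kw K := by
  rw [eq_neg_of_add_eq_zero_left (ι_add_mul_swap (R := ℤ) v k)]
  exact Submodule.neg_mem _ (kw_mem hk v)

theorem kw_mono {A : Type} [AddCommGroup A] {K K' : AddSubgroup A} (h : K ≤ K') :
    kw K ≤ kw K' := Submodule.span_mono (by rintro _ ⟨k, hk, v, rfl⟩; exact ⟨k, h hk, v, rfl⟩)

/-- the induced map -/
noncomputable def EM {A B : Type} [AddCommGroup A] [AddCommGroup B] (f : A →+ B) :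
    ExteriorAlgebra ℤ A →ₐ[ℤ] ExteriorAlgebra ℤ B := ExteriorAlgebra.map f.toIntLinearMap

theorem EM_ι {A B : Type} [AddCommGroup A] [AddCommGroup B] (f : A →+ B) (x y : A) :
    EM f (ι ℤ x * ι ℤ y) = ι ℤ (f x) * ι ℤ (f y) := by
  simp [EM]

theorem EM_comp {A B C : Type} [AddCommGroup A] [AddCommGroup B] [AddCommGroup C] (f : A →+ B)
    (g : B →+ C) (x) : EM (g.comp f) x = EM g (EM f x) := by
  have := ExteriorAlgebra.map_comp_map f.toIntLinearMap g.toIntLinearMap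
  exact (AlgHom.congr_fun this x).symm

theorem EM_id {A : Type} [AddCommGroup A] (x) : EM (AddMonoidHom.id A) x = x := by
  have := ExteriorAlgebra.map_id (R := ℤ) (M := A)
  exact (AlgHom.congr_fun this x)

theorem kw_map {A B : Type} [AddCommGroup A] [AddCommGroup B] (f : A →+ B) (K : AddSubgroup A)
    (K' : AddSubgroup B)
    (h : ∀ k ∈ K, f k ∈ K') {x} (hx : x ∈ kw K) : EM f x ∈ kw K' := by
  induction hx using Submodule.span_induction with
  | mem x hx => obtain ⟨k, hk, v, rfl⟩ := hx; rw [EM_ι]; exact kw_mem (h k hk) _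
  | zero => simp
  | add x y _ _ hx hy => rw [map_add]; exact Submodule.add_mem _ hx hy
  | smul a x _ hx => rw [map_smul]; exact Submodule.smul_mem _ _ hx

theorem kw_tors {A : Type} [AddCommGroup A] (K : AddSubgroup A) (N : ℕ) (hN : ∀ a : A, N • a = 0)
    {x} (hx : x ∈ kw K) : N • x = 0 := by
  induction hx using Submodule.span_induction with
  | mem x hx => 
    obtain ⟨k, hk, v, rfl⟩ := hx
    rw [← smul_mul_assoc, ← map_nsmul, hN]; simp
  | zero => simp
  | add x y _ _ hx hy => rw [smul_add, hx, hy, add_zero]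
  | smul a x _ hx => rw [smul_comm, hx, smul_zero]

theorem ker_EM {A B : Type} [AddCommGroup A] [AddCommGroup B] (f : A →+ B)
    (hf : Function.Surjective f) {x} (hx : x ∈ kw (⊤ : AddSubgroup A)) (h0 : EM f x = 0) :
    x ∈ kw f.ker := by
  obtain ⟨s, hs⟩ := hf.hasRightInverse
  have hs' : ∀ y, f (s y) = y := hs
  let Q := (kw f.ker).mkQ
  have hQ : ∀ a a' c c', f a = f a' → f c = f c' →
      Q (ι ℤ a * ι ℤ c) = Q (ι ℤ a' * ι ℤ c') := by
    intro a a' c c' h h'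
    rw [← sub_eq_zero, ← map_sub]
    apply (Submodule.Quotient.mk_eq_zero _).2
    have : ι ℤ a * ι ℤ c - ι ℤ a' * ι ℤ c' = ι ℤ (a - a') * ι ℤ c + ι ℤ a' * ι ℤ (c - c') := by
      simp [sub_mul, mul_sub]
    rw [this]
    refine Submodule.add_mem _ (kw_mem ?_ _) (kw_mem' ?_ _)
    · simp [AddMonoidHom.mem_ker, h]
    · simp [AddMonoidHom.mem_ker, h']
  obtain ⟨L, hL⟩ := ea_lift2 (A := B) (N := ExteriorAlgebra ℤ A ⧸ kw f.ker)
    (AddMonoidHom.mk' (fun b => AddMonoidHom.mk' (fun c => Q (ι ℤ (s b) * ι ℤ (s c)))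
      (by
        intro c d
        rw [← map_add, ← mul_add, ← map_add]
        apply hQ <;> simp [hs']))
      (by
        intro c d
        ext y
        simp only [AddMonoidHom.mk'_apply, AddMonoidHom.add_apply]
        rw [← map_add, ← add_mul, ← map_add]
        apply hQ <;> simp [hs'])) (by intro x; simp)
  have : ∀ x ∈ kw (⊤ : AddSubgroup A), L (EM f x) = Q x := by
    intro x hx
    induction hx using Submodule.span_induction with
    | mem x hx => 
      obtain ⟨k, hk, v, rfl⟩ := hx
      rw [EM_ι, hL]
      simp only [AddMonoidHom.mk'_apply]
      apply hQ <;> simp [hs']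
    | zero => simp
    | add x y _ _ hx hy => rw [map_add, map_add, hx, hy, map_add]
    | smul a x _ hx => rw [map_smul, map_smul, hx, map_smul]
  have h1 := this x hx
  rw [h0, map_zero] at h1
  exact (Submodule.Quotient.mk_eq_zero _).1 h1.symm

theorem sep_vs (F : Type) [Field F] {Q : Type} [AddCommGroup Q] [Module F Q]
    (x : Q) (h : ∀ α : Q →ₗ[F] F, α x = 0) : x = 0 :=
  (Module.forall_dual_apply_eq_zero_iff F x).1 h

theorem sep_zero (ℓ : ℕ) [Fact ℓ.Prime] {Q : Type} [AddCommGroup Q] (hQ : ∀ z : Q, ℓ • z = 0)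
    (x : Q) (h : ∀ α : Q →+ ZMod ℓ, α x = 0) : x = 0 := by
  let _ : Module (ZMod ℓ) Q := AddCommGroup.zmodModule hQ
  exact sep_vs (ZMod ℓ) x (fun φ => h φ.toAddMonoidHom)

theorem sep_fun (ℓ : ℕ) [Fact ℓ.Prime] {M : Type} [AddCommGroup M] (x : M)
    (h : ∀ α : M →+ ZMod ℓ, α x = 0) : ∃ y, x = ℓ • y := by
  let S : AddSubgroup M := (nsmulAddMonoidHom ℓ : M →+ M).range
  have := sep_zero ℓ (Q := M ⧸ S) (by
    intro z
    obtain ⟨z, rfl⟩ := QuotientAddGroup.mk_surjective z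
    rw [← QuotientAddGroup.mk_nsmul]
    exact (QuotientAddGroup.eq_zero_iff _).2 ⟨z, rfl⟩) (QuotientAddGroup.mk x) (by
    intro φ
    exact h (φ.comp (QuotientAddGroup.mk' S)))
  obtain ⟨y, hy⟩ := (QuotientAddGroup.eq_zero_iff _).1 this
  exact ⟨y, hy.symm⟩

/-- basis vector -/
def bv (ℓ n g : ℕ) (i : Fin g ⊕ Fin g) : Vsp ℓ n g := Pi.single i 1

theorem om_def (ℓ n g : ℕ) : omegaStd ℓ n g =
    ∑ i : Fin g, ι ℤ (bv ℓ n g (Sum.inl i)) * ι ℤ (bv ℓ n g (Sum.inr i)) := rfl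

theorem om_mem (ℓ n g : ℕ) : omegaStd ℓ n g ∈ kw (⊤ : AddSubgroup (Vsp ℓ n g)) := by
  rw [om_def]
  exact Submodule.sum_mem _ fun i _ => kw_mem (AddSubgroup.mem_top _) _

theorem bv_sum (ℓ n g : ℕ) [NeZero (ℓ ^ n)] (v : Vsp ℓ n g) :
    v = ∑ i, (v i).val • bv ℓ n g i := by
  ext j
  rw [Finset.sum_apply]
  simp [bv, Pi.single_apply]

theorem hom_ext_bv {ℓ n g : ℕ} [NeZero (ℓ ^ n)] {M : Type} [AddCommGroup M]
    {f f' : Vsp ℓ n g →+ M} (h : ∀ i, f (bv ℓ n g i) = f' (bv ℓ n g i)) : f = f' := by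
  refine DFunLike.ext _ _ fun v => ?_
  rw [bv_sum ℓ n g v]
  simp only [map_sum, map_nsmul, h]

theorem mkhom {ℓ n g : ℕ} [NeZero (ℓ ^ n)] (y : Fin g ⊕ Fin g → Vsp ℓ n g) :
    ∃ φ : Vsp ℓ n g →+ Vsp ℓ n g, ∀ i, φ (bv ℓ n g i) = y i := by
  refine ⟨((Pi.basisFun (ZMod (ℓ ^ n)) (Fin g ⊕ Fin g)).constr ℕ y).toAddMonoidHom, fun i => ?_⟩
  have := (Pi.basisFun (ZMod (ℓ ^ n)) (Fin g ⊕ Fin g)).constr_basis ℕ y i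
  rw [Pi.basisFun_apply] at this
  exact this

theorem hom_mem {ℓ n g : ℕ} [NeZero (ℓ ^ n)] (K : AddSubgroup (Vsp ℓ n g))
    (φ : Vsp ℓ n g →+ Vsp ℓ n g) (h : ∀ i, φ (bv ℓ n g i) ∈ K) (v) : φ v ∈ K := by
  rw [bv_sum ℓ n g v, map_sum]
  refine AddSubgroup.sum_mem _ fun i _ => ?_
  rw [map_nsmul]
  exact AddSubgroup.nsmul_mem _ (h i) _

theorem v_tors (ℓ n g : ℕ) (v : Vsp ℓ n g) : (ℓ ^ n) • v = 0 := by
  ext i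
  rw [Pi.smul_apply, nsmul_eq_mul, ZMod.natCast_self, zero_mul]; rfl

theorem bij_of_mod (ℓ n g : ℕ) [NeZero (ℓ ^ n)] (f : Vsp ℓ n g →+ Vsp ℓ n g)
    (h : ∀ v, ∃ w x, v = f w + ℓ • x) : Function.Bijective f := by
  have : ∀ k v, ∃ w x, v = f w + ℓ ^ k • x := by
    intro k
    induction k with
    | zero => exact fun v => ⟨0, v, by simp⟩
    | succ k ih =>
      intro v
      obtain ⟨w, x, hv⟩ := ih v
      obtain ⟨w', x', hx⟩ := h x
      refine ⟨w + ℓ ^ k • w', x', ?_⟩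
      rw [hv, map_add, map_nsmul, pow_succ, mul_smul]
      nth_rw 1 [hx]
      rw [smul_add, add_assoc]
  have hs : Function.Surjective f := by
    intro v
    obtain ⟨w, x, hv⟩ := this n v
    exact ⟨w, by rw [hv, v_tors, add_zero]⟩
  exact ⟨Finite.injective_iff_surjective.2 hs, hs⟩

theorem lin_part (ℓ n g : ℕ) [NeZero (ℓ ^ n)] (K : AddSubgroup (Vsp ℓ n g)) {D}
    (hD : D ∈ kw K) : ∃ φ : Vsp ℓ n g →+ Vsp ℓ n g, (∀ v, φ v ∈ K) ∧
      D = ∑ i : Fin g, (ι ℤ (φ (bv ℓ n g (Sum.inl i))) * ι ℤ (bv ℓ n g (Sum.inr i)) +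
        ι ℤ (bv ℓ n g (Sum.inl i)) * ι ℤ (φ (bv ℓ n g (Sum.inr i)))) := by
  induction hD using Submodule.span_induction with
  | mem x hx =>
    obtain ⟨k, hk, v, rfl⟩ := hx
    obtain ⟨φ, hφ⟩ := mkhom (ℓ := ℓ) (n := n) (g := g)
      (Sum.elim (fun i => (v (Sum.inr i)).val • k) (fun i => -((v (Sum.inl i)).val • k)))
    refine ⟨φ, hom_mem K φ ?_, ?_⟩
    · rintro (i | i)
      · rw [hφ]; exact AddSubgroup.nsmul_mem _ hk _
      · rw [hφ]; exact AddSubgroup.neg_mem _ (AddSubgroup.nsmul_mem _ hk _)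
    · nth_rw 1 [bv_sum ℓ n g v]
      simp only [hφ, Sum.elim_inl, Sum.elim_inr, Fintype.sum_sum_type, map_add, map_sum, map_neg,
        map_nsmul, mul_add, Finset.mul_sum, Finset.sum_add_distrib, smul_mul_assoc, mul_smul_comm,
        mul_neg]
      rw [add_comm]
      congr 1
      refine Finset.sum_congr rfl fun i _ => ?_
      rw [eq_neg_of_add_eq_zero_left (ι_add_mul_swap (R := ℤ) k _), smul_neg]
  | zero => exact ⟨0, fun v => K.zero_mem, by simp⟩
  | add x y _ _ hx hy =>
    obtain ⟨φ, h1, rfl⟩ := hx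
    obtain ⟨ψ, h2, rfl⟩ := hy
    refine ⟨φ + ψ, fun v => K.add_mem (h1 v) (h2 v), ?_⟩
    rw [← Finset.sum_add_distrib]
    refine Finset.sum_congr rfl fun i _ => ?_
    simp only [AddMonoidHom.add_apply, map_add, add_mul, mul_add]
    abel
  | smul a x _ hx =>
    obtain ⟨φ, h1, rfl⟩ := hx
    refine ⟨a • φ, fun v => K.zsmul_mem (h1 v) a, ?_⟩
    rw [Finset.smul_sum]
    refine Finset.sum_congr rfl fun i _ => ?_
    simp only [AddMonoidHom.smul_apply, map_zsmul, smul_mul_assoc, mul_smul_comm, smul_add]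

theorem hensel (ℓ n g : ℕ) [NeZero (ℓ ^ n)] (K : AddSubgroup (Vsp ℓ n g))
    (hK : ∀ k ∈ K, ∃ x, k = ℓ • x) (m : ℕ) : ∀ (j : ℕ) (_ : j + m = n) (w')
    (_ : ∃ s ∈ kw K, w' - omegaStd ℓ n g = ℓ ^ j • s),
    ∃ h : Vsp ℓ n g ≃+ Vsp ℓ n g, (∀ v, h v - v ∈ K) ∧ EM h.toAddMonoidHom (omegaStd ℓ n g) = w' := by
  induction m with
  | zero =>
    rintro j hj w' ⟨s, hs, h⟩
    refine ⟨AddEquiv.refl _, fun v => by simp, ?_⟩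
    obtain rfl : j = n := by omega
    rw [kw_tors K _ (v_tors ℓ j g) hs] at h
    rw [sub_eq_zero.1 h]
    exact EM_id _
  | succ m ih =>
    rintro j hj w' ⟨s, hs, h⟩
    obtain ⟨φ, h1, h2⟩ := lin_part ℓ n g K hs
    let ψ := AddMonoidHom.id (Vsp ℓ n g) + ℓ ^ j • φ
    have hψ : ∀ v, ψ v = v + ℓ ^ j • φ v := fun v => rfl
    let u : Vsp ℓ n g ≃+ Vsp ℓ n g := AddEquiv.ofBijective ψ (bij_of_mod ℓ n g ψ (by
      intro v
      obtain ⟨x, hx⟩ := hK _ (h1 v)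
      refine ⟨v, -(ℓ ^ j • x), ?_⟩
      rw [hψ, hx, smul_neg, smul_comm ℓ]
      abel))
    have hu : ∀ v, u v = v + ℓ ^ j • φ v := fun v => rfl
    have hu1 : ∀ v, u v - v ∈ K := fun v => by
      rw [hu, add_sub_cancel_left]; exact K.nsmul_mem (h1 v) _
    have hu2 : ∀ k ∈ K, u.symm k ∈ K := by
      intro k hk
      have := hu1 (u.symm k)
      rw [AddEquiv.apply_symm_apply] at this
      simpa using K.sub_mem hk this
    choose x hx using fun i => hK _ (h1 (bv ℓ n g (Sum.inr i)))
    let s' := ℓ ^ j • ∑ i : Fin g, ι ℤ (φ (bv ℓ n g (Sum.inl i))) * ι ℤ (x i)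
    have hs' : s' ∈ kw K := by
      refine Submodule.smul_of_tower_mem _ _ (Submodule.sum_mem _ fun i _ => kw_mem (h1 _) _)
    have hs'' : s' = ℓ ^ j • ∑ i : Fin g, ι ℤ (φ (bv ℓ n g (Sum.inl i))) * ι ℤ (x i) := rfl
    have hE : EM u.toAddMonoidHom (omegaStd ℓ n g) = w' + ℓ ^ (j + 1) • s' := by
      rw [sub_eq_iff_eq_add.1 h, h2, om_def, map_sum, hs'', Finset.smul_sum, Finset.smul_sum,
        Finset.smul_sum, ← Finset.sum_add_distrib, ← Finset.sum_add_distrib]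
      refine Finset.sum_congr rfl fun i _ => ?_
      rw [EM_ι]
      change ι ℤ (u _) * ι ℤ (u _) = _
      rw [hu, hu]
      have e : ι ℤ (φ (bv ℓ n g (Sum.inr i))) = ℓ • ι ℤ (x i) := by
        rw [← map_nsmul, ← hx]
      simp only [map_add, map_nsmul, add_mul, mul_add, smul_mul_assoc, mul_smul_comm, e, smul_add,
        pow_succ, mul_smul]
      rw [smul_comm ℓ (ℓ ^ j) (ι ℤ (φ (bv ℓ n g (Sum.inl i))) * ι ℤ (x i))]
      abel
    have hinv : ∀ z, EM u.symm.toAddMonoidHom (EM u.toAddMonoidHom z) = z := by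
      intro z
      rw [← EM_comp]
      convert EM_id z
      refine DFunLike.ext _ _ fun v => ?_
      exact u.symm_apply_apply v
    have hinv' : ∀ z, EM u.toAddMonoidHom (EM u.symm.toAddMonoidHom z) = z := by
      intro z
      rw [← EM_comp]
      convert EM_id z
      refine DFunLike.ext _ _ fun v => ?_
      exact u.apply_symm_apply v
    obtain ⟨h', h3, h4⟩ := ih (j + 1) (by omega) (EM u.symm.toAddMonoidHom w')
      ⟨- EM u.symm.toAddMonoidHom s', Submodule.neg_mem _ (kw_map _ K K hu2 hs'), by
        have := hinv (omegaStd ℓ n g)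
        rw [hE, map_add, map_nsmul] at this
        rw [← this, smul_neg]; abel⟩
    refine ⟨h'.trans u, fun v => ?_, ?_⟩
    · have := K.add_mem (hu1 (h' v)) (h3 v)
      simpa using this
    · have : (h'.trans u).toAddMonoidHom = u.toAddMonoidHom.comp h'.toAddMonoidHom := rfl
      rw [this, EM_comp, h4, hinv']

theorem kw_inter (ℓ n g : ℕ) [NeZero (ℓ ^ n)] [Fact ℓ.Prime] (hn : 1 ≤ n)
    (K K' : AddSubgroup (Vsp ℓ n g))
    (hK' : ∀ k, k ∈ K' ↔ k ∈ K ∧ ∃ x, k = ℓ • x) {D E} (hD : D ∈ kw K)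
    (hE : E ∈ kw (⊤ : AddSubgroup (Vsp ℓ n g))) (hDE : D = ℓ • E) : D ∈ kw K' := by
  let U := (Fin g ⊕ Fin g) → ZMod ℓ
  have hdvd : ℓ ∣ ℓ ^ n := dvd_pow_self _ (by omega)
  let c : Vsp ℓ n g →+ U :=
    { toFun := fun v i => ZMod.castHom hdvd (ZMod ℓ) (v i)
      map_zero' := by funext i; simp; rfl
      map_add' := by intro x y; funext i; exact map_add _ _ _ }
  have hc : ∀ v i, c v i = ZMod.castHom hdvd (ZMod ℓ) (v i) := fun _ _ => rfl
  have hker : ∀ v, c v = 0 → ∃ x, v = ℓ • x := by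
    intro v hv
    have : ∀ i, ∃ x, v i = ℓ • x := by
      intro i
      have h1 : ZMod.castHom hdvd (ZMod ℓ) (v i) = 0 := by rw [← hc, hv]; rfl
      rw [← ZMod.natCast_zmod_val (v i), map_natCast, ZMod.natCast_eq_zero_iff] at h1
      obtain ⟨y, hy⟩ := h1
      exact ⟨y, by rw [← ZMod.natCast_zmod_val (v i), hy]; simp⟩
    choose x hx using this
    exact ⟨x, by ext i; rw [hx]; rfl⟩
  let Kb : Submodule (ZMod ℓ) U := AddSubgroup.toZModSubmodule ℓ (K.map c)
  obtain ⟨p, hp⟩ := LinearMap.exists_leftInverse_of_injective Kb.subtype (by simp)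
  have hp' : ∀ w : Kb, p w = w := fun w => LinearMap.congr_fun hp w
  have hch : ∀ i, ∃ k ∈ K, c k = p (c (bv ℓ n g i)) := fun i => (p (c (bv ℓ n g i))).2
  choose y hyK hy using hch
  obtain ⟨π, hπ⟩ := mkhom y
  have hπK : ∀ v, π v ∈ K := hom_mem K π (by intro i; rw [hπ]; exact hyK i)
  have hcπ : ∀ v, c (π v) = p (c v) := by
    have : c.comp π = (Kb.subtype.comp p).toAddMonoidHom.comp c := hom_ext_bv (by
      intro i
      simp [hπ, hy])
    exact fun v => DFunLike.congr_fun this v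
  have hπ1 : ∀ k ∈ K, k - π k ∈ K' := by
    intro k hk
    rw [hK']
    refine ⟨K.sub_mem hk (hπK k), hker _ ?_⟩
    have := hp' ⟨c k, ⟨k, hk, rfl⟩⟩
    rw [map_sub, hcπ, this, sub_self]
  let θ := AddMonoidHom.id (Vsp ℓ n g) - π
  have hθ : ∀ v, θ v = v - π v := fun _ => rfl
  have hA : EM θ D ∈ kw K' := kw_map θ K K' hπ1 hD
  have hB : ∀ E ∈ kw (⊤ : AddSubgroup (Vsp ℓ n g)), ℓ • (E - EM θ E) ∈ kw K' := by
    intro E hE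
    induction hE using Submodule.span_induction with
    | mem x hx =>
      obtain ⟨k, hk, v, rfl⟩ := hx
      have hm : ∀ w, ℓ • π w ∈ K' := fun w => (hK' _).2 ⟨K.nsmul_mem (hπK w) _, _, rfl⟩
      have : ℓ • (ι ℤ k * ι ℤ v - EM θ (ι ℤ k * ι ℤ v)) =
          ι ℤ (ℓ • π k) * ι ℤ (v - π v) + ι ℤ k * ι ℤ (ℓ • π v) := by
        rw [EM_ι, hθ, hθ]
        simp only [map_sub, map_nsmul, sub_mul, mul_sub, smul_mul_assoc, mul_smul_comm, smul_sub]
        abel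
      rw [this]
      exact Submodule.add_mem _ (kw_mem (hm _) _) (kw_mem' (hm _) _)
    | zero => simp
    | add x y _ _ hx hy =>
      have := Submodule.add_mem _ hx hy
      rw [map_add]
      convert this using 1
      rw [← smul_add]; congr 1; abel
    | smul a x _ hx =>
      have := Submodule.smul_mem _ a hx
      rw [map_smul, ← smul_sub, smul_comm]; exact this
  have := Submodule.add_mem _ (hB E hE) hA
  rwa [smul_sub, ← map_nsmul, ← hDE, sub_add_cancel] at this

theorem pair_L {A : Type} [AddCommGroup A] {ℓ : ℕ} (α β : A →+ ZMod ℓ) :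
    ∃ L : ExteriorAlgebra ℤ A →ₗ[ℤ] ZMod ℓ, ∀ x y,
      L (ι ℤ x * ι ℤ y) = α x * β y - α y * β x := by
  obtain ⟨L, hL⟩ := ea_lift2 (A := A) (N := ZMod ℓ)
    (AddMonoidHom.mk' (fun x => AddMonoidHom.mk' (fun y => α x * β y - α y * β x)
      (by intro y z; simp only [map_add]; ring))
      (by intro y z; ext w; simp only [AddMonoidHom.mk'_apply, AddMonoidHom.add_apply, map_add]
          ring)) (by intro x; simp)
  exact ⟨L, hL⟩

theorem div_of_pair (ℓ n g : ℕ) [NeZero (ℓ ^ n)] [Fact ℓ.Prime] (hn : 1 ≤ n)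
    {x : ExteriorAlgebra ℤ (Vsp ℓ n g)} (hx : x ∈ kw (⊤ : AddSubgroup (Vsp ℓ n g)))
    (h : ∀ (α β : Vsp ℓ n g →+ ZMod ℓ) (L : ExteriorAlgebra ℤ (Vsp ℓ n g) →ₗ[ℤ] ZMod ℓ),
      (∀ u v, L (ι ℤ u * ι ℤ v) = α u * β v - α v * β u) → L x = 0) :
    ∃ E ∈ kw (⊤ : AddSubgroup (Vsp ℓ n g)), x = ℓ • E := by
  have hdvd : ℓ ∣ ℓ ^ n := dvd_pow_self _ (by omega)
  obtain ⟨P, hP⟩ := ea_lift2 (A := Vsp ℓ n g) (N := kw (⊤ : AddSubgroup (Vsp ℓ n g)))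
    (AddMonoidHom.mk' (fun x => AddMonoidHom.mk'
      (fun y => ⟨ι ℤ x * ι ℤ y, kw_mem (AddSubgroup.mem_top _) _⟩)
      (by intro y z; apply Subtype.ext; simp [mul_add]))
      (by intro y z; refine DFunLike.ext _ _ fun w => ?_; apply Subtype.ext; simp [add_mul]))
    (by intro x; apply Subtype.ext; simp)
  have hP' : ∀ z ∈ kw (⊤ : AddSubgroup (Vsp ℓ n g)), (P z : ExteriorAlgebra ℤ (Vsp ℓ n g)) = z := by
    intro z hz
    induction hz using Submodule.span_induction with
    | mem x hx => obtain ⟨k, hk, v, rfl⟩ := hx; rw [hP]; rfl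
    | zero => simp
    | add x y _ _ hx hy => rw [map_add, Submodule.coe_add, hx, hy]
    | smul a x _ hx => rw [map_smul, Submodule.coe_smul, hx]
  suffices hs : ∃ y, x = ℓ • y by
    obtain ⟨y, hy⟩ := hs
    refine ⟨P y, (P y).2, ?_⟩
    have := hP' x hx
    rw [hy, map_nsmul] at this
    rw [hy, ← this]; rfl
  apply sep_fun
  intro χ
  let c : (Fin g ⊕ Fin g) → Vsp ℓ n g →+ ZMod ℓ := fun i =>
    (ZMod.castHom hdvd (ZMod ℓ)).toAddMonoidHom.comp (Pi.evalAddMonoidHom _ i)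
  have hc : ∀ i (v : Vsp ℓ n g), c i v = ((v i).val : ZMod ℓ) := by
    intro i v
    change ZMod.castHom hdvd (ZMod ℓ) (v i) = _
    conv_lhs => rw [← ZMod.natCast_zmod_val (v i)]
    rw [map_natCast]
  choose L hL using fun i j => pair_L (c i) (c j)
  let e := Fintype.equivFin (Fin g ⊕ Fin g)
  let X : (Fin g ⊕ Fin g) → (Fin g ⊕ Fin g) → ZMod ℓ := fun i j =>
    χ (ι ℤ (bv ℓ n g i) * ι ℤ (bv ℓ n g j))
  let A : (Fin g ⊕ Fin g) → (Fin g ⊕ Fin g) → ZMod ℓ := fun i j => if e i < e j then X i j else 0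
  have hX : ∀ i j, X j i = - X i j := by
    intro i j
    simp only [X]
    rw [eq_neg_of_add_eq_zero_left (ι_add_mul_swap (R := ℤ) (bv ℓ n g j) (bv ℓ n g i)), map_neg]
  have hX0 : ∀ i, X i i = 0 := by intro i; simp [X]
  have hA : ∀ i j, A i j - A j i = X i j := by
    intro i j
    simp only [A]
    rcases lt_trichotomy (e i) (e j) with h | h | h
    · simp [h, h.not_gt]
    · have := e.injective h
      subst this
      simp [hX0]
    · simp [h, h.not_gt, hX i j]
  have key : ∀ z ∈ kw (⊤ : AddSubgroup (Vsp ℓ n g)), χ z = ∑ i, ∑ j, A i j * L i j z := by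
    intro z hz
    induction hz using Submodule.span_induction with
    | mem x hx =>
      obtain ⟨u, -, v, rfl⟩ := hx
      have e1 : χ (ι ℤ u * ι ℤ v) = ∑ i, ∑ j, c i u * c j v * X i j := by
        conv_lhs => rw [bv_sum ℓ n g u, bv_sum ℓ n g v]
        simp only [map_sum, map_nsmul, Finset.sum_mul_sum, smul_mul_assoc,
          mul_smul_comm]
        refine Finset.sum_congr rfl fun i _ => Finset.sum_congr rfl fun j _ => ?_
        simp only [hc, X, nsmul_eq_mul]
        ring
      have e2 : ∑ i, ∑ j, A i j * L i j (ι ℤ u * ι ℤ v) =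
          ∑ i, ∑ j, A i j * (c i u * c j v) - ∑ i, ∑ j, A j i * (c i u * c j v) := by
        rw [Finset.sum_comm (f := fun i j => A j i * (c i u * c j v)), ← Finset.sum_sub_distrib]
        refine Finset.sum_congr rfl fun i _ => ?_
        rw [← Finset.sum_sub_distrib]
        refine Finset.sum_congr rfl fun j _ => ?_
        rw [hL]; ring
      rw [e1, e2, ← Finset.sum_sub_distrib]
      refine Finset.sum_congr rfl fun i _ => ?_
      rw [← Finset.sum_sub_distrib]
      refine Finset.sum_congr rfl fun j _ => ?_
      rw [← hA]; ring
    | zero => simp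
    | add x y _ _ hx hy => 
      simp only [map_add, hx, hy, mul_add, Finset.sum_add_distrib]
    | smul a x _ hx => 
      simp only [map_zsmul, hx, Finset.smul_sum, mul_smul_comm]
  rw [key x hx]
  refine Finset.sum_eq_zero fun i _ => Finset.sum_eq_zero fun j _ => ?_
  rw [h _ _ _ (hL i j), mul_zero]

/-- standard form -/
noncomputable def stdB (F : Type) [Field F] (g : ℕ) :
    LinearMap.BilinForm F ((Fin g ⊕ Fin g) → F) :=
  LinearMap.mk₂ F (fun a b => ∑ i : Fin g, (a (Sum.inl i) * b (Sum.inr i) -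
    b (Sum.inl i) * a (Sum.inr i)))
    (by intro a a' b; rw [← Finset.sum_add_distrib]; refine Finset.sum_congr rfl fun i _ => ?_
        simp only [Pi.add_apply]; ring)
    (by intro c a b; rw [Finset.smul_sum]; refine Finset.sum_congr rfl fun i _ => ?_
        simp only [Pi.smul_apply, smul_eq_mul]; ring)
    (by intro a a' b; rw [← Finset.sum_add_distrib]; refine Finset.sum_congr rfl fun i _ => ?_
        simp only [Pi.add_apply]; ring)
    (by intro c a b; rw [Finset.smul_sum]; refine Finset.sum_congr rfl fun i _ => ?_
        simp only [Pi.smul_apply, smul_eq_mul]; ring)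

theorem stdB_apply (F : Type) [Field F] (g : ℕ) (a b) : stdB F g a b =
    ∑ i : Fin g, (a (Sum.inl i) * b (Sum.inr i) - b (Sum.inl i) * a (Sum.inr i)) := rfl

theorem stdB_alt (F : Type) [Field F] (g : ℕ) (a) : stdB F g a a = 0 := by
  rw [stdB_apply]; simp

theorem stdB_nd (F : Type) [Field F] (g : ℕ) : (stdB F g).Nondegenerate := by
  constructor
  · intro a h
    funext i
    rcases i with i | i
    · have := h (Pi.single (Sum.inr i) 1)
      rw [stdB_apply] at this
      simpa [Pi.single_apply] using this
    · have := h (Pi.single (Sum.inl i) 1)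
      rw [stdB_apply] at this
      simpa [Pi.single_apply] using this
  · intro a h
    funext i
    rcases i with i | i
    · have := h (Pi.single (Sum.inr i) 1)
      rw [stdB_apply] at this
      simpa [Pi.single_apply] using this
    · have := h (Pi.single (Sum.inl i) 1)
      rw [stdB_apply] at this
      simpa [Pi.single_apply] using this

theorem transitive (ℓ n g : ℕ) [NeZero (ℓ ^ n)] [Fact ℓ.Prime] (hn : 1 ≤ n) {H : Type}
    [AddCommGroup H] (T T' : Vsp ℓ n g →+ H) (hT : Function.Surjective T)
    (hT' : Function.Surjective T')
    (hw : EM T (omegaStd ℓ n g) = EM T' (omegaStd ℓ n g)) :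
    ∃ γ : Vsp ℓ n g ≃+ Vsp ℓ n g, EM γ.toAddMonoidHom (omegaStd ℓ n g) = omegaStd ℓ n g ∧
      ∀ v, T (γ v) = T' v := by
  let mk : ∀ (S : Vsp ℓ n g →+ H), (H →+ ZMod ℓ) →ₗ[ZMod ℓ] ((Fin g ⊕ Fin g) → ZMod ℓ) := fun S =>
    { toFun := fun α i => α (S (bv ℓ n g i))
      map_add' := by intro α β; rfl
      map_smul' := by intro c α; rfl }
  have hmk : ∀ S α i, mk S α i = α (S (bv ℓ n g i)) := fun _ _ _ => rfl
  have hinj : ∀ S : Vsp ℓ n g →+ H, Function.Surjective S → Function.Injective (mk S) := by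
    intro S hS α β h
    have : α.comp S = β.comp S := hom_ext_bv fun i => congrFun h i
    refine DFunLike.ext _ _ fun y => ?_
    obtain ⟨v, rfl⟩ := hS y
    exact DFunLike.congr_fun this v
  have hform : ∀ (M : Type) [AddCommGroup M] (S : Vsp ℓ n g →+ M) (α β : M →+ ZMod ℓ)
      (L : ExteriorAlgebra ℤ M →ₗ[ℤ] ZMod ℓ) (_ : ∀ u v, L (ι ℤ u * ι ℤ v) = α u * β v - α v * β u),
      stdB (ZMod ℓ) g (fun i => α (S (bv ℓ n g i))) (fun i => β (S (bv ℓ n g i))) =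
        L (EM S (omegaStd ℓ n g)) := by
    intro M _ S α β L hL
    rw [stdB_apply, om_def, map_sum, map_sum]
    refine Finset.sum_congr rfl fun i _ => ?_
    rw [EM_ι, hL]; ring
  obtain ⟨Φ, hΦ, hΦT⟩ := w_ext (stdB (ZMod ℓ) g) (stdB_nd _ _) (stdB_alt _ _)
    (Module.finrank (ZMod ℓ) ((Fin g ⊕ Fin g) → ZMod ℓ) -
      Module.finrank (ZMod ℓ) (LinearMap.range (mk T))) _ (mk T) (mk T') (hinj T hT) (hinj T' hT')
    (by
      intro α β
      obtain ⟨L, hL⟩ := pair_L α β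
      have h1 := hform _ T α β L hL
      have h2 := hform _ T' α β L hL
      rw [hw, ← h2] at h1
      exact h1)
    (Nat.add_sub_cancel' (Submodule.finrank_le _))
  let P : (Fin g ⊕ Fin g) → (Fin g ⊕ Fin g) → ZMod ℓ := fun i j => Φ (Pi.single j 1) i
  have hP : ∀ a i, Φ a i = ∑ j, P i j * a j := by
    intro a i
    conv_lhs => rw [← Finset.univ_sum_single a]
    rw [map_sum, Finset.sum_apply]
    refine Finset.sum_congr rfl fun j _ => ?_
    have : (Pi.single j (a j) : (Fin g ⊕ Fin g) → ZMod ℓ) = a j • Pi.single j 1 := by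
      rw [← Pi.single_smul', smul_eq_mul, mul_one]
    rw [this, map_smul, Pi.smul_apply, smul_eq_mul, mul_comm]
  have hg0 : ∀ (M : Type) [AddCommGroup M] (α : M →+ ZMod ℓ) (S : Vsp ℓ n g →+ M) i,
      α (S (∑ j, (P i j).val • bv ℓ n g j)) = Φ (fun j => α (S (bv ℓ n g j))) i := by
    intro M _ α S i
    rw [hP]
    simp only [map_sum, map_nsmul]
    refine Finset.sum_congr rfl fun j _ => ?_
    rw [nsmul_eq_mul, ZMod.natCast_zmod_val]
  have hdiv : ∀ i, ∃ x, T' (bv ℓ n g i) = T (∑ j, (P i j).val • bv ℓ n g j + ℓ • x) := by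
    intro i
    obtain ⟨y, hy⟩ := sep_fun ℓ (T' (bv ℓ n g i) - T (∑ j, (P i j).val • bv ℓ n g j)) (by
      intro α
      rw [map_sub, hg0]
      change mk T' α i - Φ (mk T α) i = 0
      rw [hΦT, sub_self])
    obtain ⟨x, rfl⟩ := hT y
    exact ⟨x, by rw [map_add, map_nsmul, ← hy]; abel⟩
  choose x hx using hdiv
  obtain ⟨f, hf⟩ := mkhom (fun i => ∑ j, (P i j).val • bv ℓ n g j + ℓ • x i)
  have hTf : ∀ v, T (f v) = T' v := by
    have : T.comp f = T' := hom_ext_bv fun i => by rw [AddMonoidHom.comp_apply, hf, hx]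
    exact fun v => DFunLike.congr_fun this v
  have hαf : ∀ (α : Vsp ℓ n g →+ ZMod ℓ) i, α (f (bv ℓ n g i)) = Φ (fun j => α (bv ℓ n g j)) i := by
    intro α i
    rw [hf, map_add, map_nsmul]
    have := hg0 _ α (AddMonoidHom.id _) i
    simp only [AddMonoidHom.id_apply] at this
    rw [this]; simp
  have hbij : Function.Bijective f := by
    apply bij_of_mod
    intro v
    obtain ⟨y, hy⟩ := sep_fun ℓ (QuotientAddGroup.mk' f.range v) (by
      intro α
      have h0 : ∀ w, α (QuotientAddGroup.mk' f.range (f w)) = 0 := by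
        intro w
        have : QuotientAddGroup.mk' f.range (f w) = 0 :=
          (QuotientAddGroup.eq_zero_iff _).2 ⟨w, rfl⟩
        rw [this, map_zero]
      have h1 : Φ (fun j => α.comp (QuotientAddGroup.mk' f.range) (bv ℓ n g j)) = 0 := by
        funext i
        rw [← hαf]; exact h0 _
      rw [LinearEquiv.map_eq_zero_iff] at h1
      have : α.comp (QuotientAddGroup.mk' f.range) = 0 := hom_ext_bv fun i => congrFun h1 i
      exact DFunLike.congr_fun this v)
    obtain ⟨y, rfl⟩ := QuotientAddGroup.mk'_surjective _ y
    rw [← map_nsmul, ← sub_eq_zero, ← map_sub] at hy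
    obtain ⟨w, hw⟩ := (QuotientAddGroup.eq_zero_iff _).1 hy
    exact ⟨w, y, by rw [hw]; abel⟩
  let γ := AddEquiv.ofBijective f hbij
  let K' : AddSubgroup (Vsp ℓ n g) := T.ker ⊓ (nsmulAddMonoidHom ℓ : Vsp ℓ n g →+ Vsp ℓ n g).range
  have hK' : ∀ k, k ∈ K' ↔ k ∈ T.ker ∧ ∃ x, k = ℓ • x := by
    intro k
    rw [AddSubgroup.mem_inf]
    refine and_congr_right fun _ => ⟨?_, ?_⟩
    · rintro ⟨y, rfl⟩; exact ⟨y, rfl⟩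
    · rintro ⟨y, rfl⟩; exact ⟨y, rfl⟩
  have hmem : EM f (omegaStd ℓ n g) - omegaStd ℓ n g ∈ kw (⊤ : AddSubgroup (Vsp ℓ n g)) :=
    Submodule.sub_mem _ (kw_map f ⊤ ⊤ (fun _ _ => AddSubgroup.mem_top _) (om_mem ℓ n g))
      (om_mem ℓ n g)
  have hD1 : EM f (omegaStd ℓ n g) - omegaStd ℓ n g ∈ kw T.ker := by
    apply ker_EM T hT hmem
    have : T.comp f = T' := DFunLike.ext _ _ hTf
    rw [map_sub, ← EM_comp, this, hw, sub_self]
  obtain ⟨E, hE, hDE⟩ := div_of_pair ℓ n g hn hmem (by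
    intro α β L hL
    have h1 := hform _ f α β L hL
    have h2 := hform _ (AddMonoidHom.id _) α β L hL
    rw [EM_id] at h2
    simp only [AddMonoidHom.id_apply] at h2
    rw [map_sub, ← h1, ← h2]
    have e : ∀ α : Vsp ℓ n g →+ ZMod ℓ, (fun i => α (f (bv ℓ n g i))) =
      Φ (fun j => α (bv ℓ n g j)) := fun α => funext (hαf α)
    rw [e, e, hΦ, sub_self])
  have hD := kw_inter ℓ n g hn T.ker K' hK' hD1 hE hDE
  obtain ⟨h, hh1, hh2⟩ := hensel ℓ n g K' (fun k hk => ((hK' k).1 hk).2) n 0 (by omega)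
    (EM f (omegaStd ℓ n g)) ⟨_, hD, by rw [pow_zero, one_smul]⟩
  refine ⟨γ.trans h.symm, ?_, fun v => ?_⟩
  · have : (γ.trans h.symm).toAddMonoidHom = h.symm.toAddMonoidHom.comp f := rfl
    rw [this, EM_comp, ← hh2, ← EM_comp]
    convert EM_id (omegaStd ℓ n g)
    refine DFunLike.ext _ _ fun v => ?_
    exact h.symm_apply_apply v
  · have := ((hK' _).1 (hh1 (h.symm (f v)))).1
    rw [AddMonoidHom.mem_ker, map_sub, h.apply_symm_apply, hTf, sub_eq_zero] at this
    exact this.symm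

theorem diag_hom (ℓ n g : ℕ) [NeZero (ℓ ^ n)] (c : ℤ) : ∃ D : Vsp ℓ n g →+ Vsp ℓ n g,
    (∀ i, D (bv ℓ n g i) = Sum.elim (fun j => c • bv ℓ n g (Sum.inl j))
      (fun j => bv ℓ n g (Sum.inr j)) i) ∧
    EM D (omegaStd ℓ n g) = c • omegaStd ℓ n g := by
  obtain ⟨D, hD⟩ := mkhom (ℓ := ℓ) (n := n) (g := g)
    (Sum.elim (fun j => c • bv ℓ n g (Sum.inl j)) (fun j => bv ℓ n g (Sum.inr j)))
  refine ⟨D, hD, ?_⟩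
  rw [om_def, map_sum, Finset.smul_sum]
  refine Finset.sum_congr rfl fun i _ => ?_
  rw [EM_ι, hD, hD, Sum.elim_inl, Sum.elim_inr, map_zsmul, smul_mul_assoc]

theorem statement16 (ℓ n : ℕ) [Fact ℓ.Prime] (hn : 1 ≤ n) (q : ℤ)
    (hq : IsUnit (q : ZMod ℓ))
    (H : Type) [AddCommGroup H] [Finite H] (hH : ∀ h : H, (ℓ ^ n : ℕ) • h = 0)
    (FH : H ≃+ H) (ωH : ExteriorAlgebra ℤ H) (hωH : ωH ∈ ⋀[ℤ]^2 H)
    (hFHωH : ExteriorAlgebra.map FH.toAddMonoidHom.toIntLinearMap ωH = q • ωH)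
    (g : ℕ) (T₀ : Vsp ℓ n g →+ H) (hT₀surj : Function.Surjective T₀)
    (hT₀ω : ExteriorAlgebra.map T₀.toIntLinearMap (omegaStd ℓ n g) = ωH) :
    Nonempty {F : Vsp ℓ n g ≃+ Vsp ℓ n g //
        ExteriorAlgebra.map F.toAddMonoidHom.toIntLinearMap (omegaStd ℓ n g) =
          q • omegaStd ℓ n g ∧
        ∀ v : Vsp ℓ n g, T₀ (F v) = FH (T₀ v)} ∧
    Nat.card {F : Vsp ℓ n g ≃+ Vsp ℓ n g //
        ExteriorAlgebra.map F.toAddMonoidHom.toIntLinearMap (omegaStd ℓ n g) =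
          q • omegaStd ℓ n g ∧
        ∀ v : Vsp ℓ n g, T₀ (F v) = FH (T₀ v)} =
    Nat.card {u : Vsp ℓ n g ≃+ Vsp ℓ n g //
        ExteriorAlgebra.map u.toAddMonoidHom.toIntLinearMap (omegaStd ℓ n g) =
          omegaStd ℓ n g ∧
        ∀ v : Vsp ℓ n g, T₀ (u v) = T₀ v} := by
  have hℓ : ℓ.Prime := Fact.out
  have hne : NeZero (ℓ ^ n) := ⟨pow_ne_zero _ hℓ.ne_zero⟩
  change EM FH.toAddMonoidHom ωH = q • ωH at hFHωH
  change EM T₀ (omegaStd ℓ n g) = ωH at hT₀ω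
  obtain ⟨a, r, har⟩ : IsCoprime ((ℓ : ℤ) ^ n) q :=
    ((ZMod.coe_int_isUnit_iff_isCoprime q ℓ).1 hq).pow_left
  obtain ⟨Dq, hq1, hq2⟩ := diag_hom ℓ n g q
  obtain ⟨Dr, hr1, hr2⟩ := diag_hom ℓ n g r
  have hzt : ∀ v : Vsp ℓ n g, (r * q) • v = v := by
    intro v
    have h1 : r * q = 1 - a * (ℓ : ℤ) ^ n := by rw [← har]; ring
    have h2 : ((ℓ : ℤ) ^ n) • v = 0 := by
      have := v_tors ℓ n g v
      rw [← natCast_zsmul] at this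
      exact_mod_cast this
    rw [h1, sub_smul, one_smul, mul_smul, h2, smul_zero, sub_zero]
  have hrq : ∀ v, Dr (Dq v) = v := by
    have : Dr.comp Dq = AddMonoidHom.id _ := hom_ext_bv (by
      rintro (i | i)
      · simp only [AddMonoidHom.comp_apply, hq1, Sum.elim_inl, map_zsmul, hr1, AddMonoidHom.id_apply]
        rw [smul_smul, mul_comm, hzt]
      · simp only [AddMonoidHom.comp_apply, hq1, Sum.elim_inr, hr1, AddMonoidHom.id_apply])
    exact fun v => DFunLike.congr_fun this v
  have hqr : ∀ v, Dq (Dr v) = v := by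
    have : Dq.comp Dr = AddMonoidHom.id _ := hom_ext_bv (by
      rintro (i | i)
      · simp only [AddMonoidHom.comp_apply, hq1, Sum.elim_inl, map_zsmul, hr1, AddMonoidHom.id_apply]
        rw [smul_smul, hzt]
      · simp only [AddMonoidHom.comp_apply, hq1, Sum.elim_inr, hr1, AddMonoidHom.id_apply])
    exact fun v => DFunLike.congr_fun this v
  have hωt : (r * q) • omegaStd ℓ n g = omegaStd ℓ n g := by
    rw [om_def, Finset.smul_sum]
    refine Finset.sum_congr rfl fun i _ => ?_
    rw [← smul_mul_assoc, ← map_zsmul, hzt]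
  let Fq : Vsp ℓ n g ≃+ Vsp ℓ n g :=
    { toFun := Dq, invFun := Dr, left_inv := hrq, right_inv := hqr, map_add' := map_add Dq }
  obtain ⟨γ, hγ1, hγ2⟩ := transitive ℓ n g hn T₀ ((FH.toAddMonoidHom.comp T₀).comp Dr) hT₀surj
    (by
      intro y
      obtain ⟨v, hv⟩ := hT₀surj (FH.symm y)
      refine ⟨Dq v, ?_⟩
      change FH (T₀ (Dr (Dq v))) = y
      rw [hrq, hv, FH.apply_symm_apply])
    (by
      rw [EM_comp, EM_comp, hr2, map_zsmul, map_zsmul, hT₀ω, hFHωH, smul_smul, ← hT₀ω,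
        ← map_zsmul, hωt])
  have hne : Nonempty {F : Vsp ℓ n g ≃+ Vsp ℓ n g //
        ExteriorAlgebra.map F.toAddMonoidHom.toIntLinearMap (omegaStd ℓ n g) =
          q • omegaStd ℓ n g ∧
        ∀ v : Vsp ℓ n g, T₀ (F v) = FH (T₀ v)} := by
    refine ⟨Fq.trans γ, ?_, fun v => ?_⟩
    · have : (Fq.trans γ).toAddMonoidHom = γ.toAddMonoidHom.comp Dq := rfl
      change EM (Fq.trans γ).toAddMonoidHom _ = _
      rw [this, EM_comp, hq2, map_zsmul, hγ1]
    · change T₀ (γ (Dq v)) = _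
      rw [hγ2]
      change FH (T₀ (Dr (Dq v))) = _
      rw [hrq]
  refine ⟨hne, ?_⟩
  obtain ⟨F₀, hF1, hF2⟩ := hne
  change EM F₀.toAddMonoidHom _ = _ at hF1
  have hFi : EM F₀.symm.toAddMonoidHom (q • omegaStd ℓ n g) = omegaStd ℓ n g := by
    rw [← hF1, ← EM_comp]
    convert EM_id (omegaStd ℓ n g)
    refine DFunLike.ext _ _ fun v => ?_
    exact F₀.symm_apply_apply v
  refine Nat.card_congr
    { toFun := fun F => ⟨F.1.trans F₀.symm, ?_, fun v => ?_⟩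
      invFun := fun u => ⟨u.1.trans F₀, ?_, fun v => ?_⟩
      left_inv := fun F => ?_
      right_inv := fun u => ?_ }
  · have h1 : EM F.1.toAddMonoidHom _ = _ := F.2.1
    change EM (F₀.symm.toAddMonoidHom.comp F.1.toAddMonoidHom) _ = _
    rw [EM_comp, h1, hFi]
  · apply FH.injective
    rw [← F.2.2 v, ← hF2]
    simp
  · have h1 : EM u.1.toAddMonoidHom _ = _ := u.2.1
    change EM (F₀.toAddMonoidHom.comp u.1.toAddMonoidHom) _ = _
    rw [EM_comp, h1, hF1]
  · rw [AddEquiv.trans_apply, hF2, u.2.2]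
  · apply Subtype.ext; refine DFunLike.ext _ _ fun v => ?_
    simp
  · apply Subtype.ext; refine DFunLike.ext _ _ fun v => ?_
    simp
end
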